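/- Let η > 0 and let H be a graph with hcf(H) = 1 and χ(H) =: r ≥ 2. Let h := |H|, let σ be a real number with σ(H) ≤ σ < h/r, and set ω := (h − σ)/(r − 1). Then there exists an integer n₁ = n₁(η, H, σ) such that the following holds: if G is a graph on n ≥ n₁ vertices such that h divides n and G has degree sequence d₁ ≤ … ≤ d_n satisfying d_i ≥ (1 − (ω + σ)/h)·n + (σ/ω)·i + ηn for all 1 ≤ i ≤ ωn/h, then G contains a perfect H-tiling. -/

import Mathlib

open SimpleGraph

/-- The degree of a vertex, as the cardinality of its neighbour set. -/
noncomputable def degN {V : Type*} (G : SimpleGraph V) (v : V) : ℕ :=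
  (G.neighborSet v).ncard

/-- `f` is a copy of `H` in `G`: an injective map preserving adjacency. -/
def IsCopy {α β : Type*} (H : SimpleGraph α) (G : SimpleGraph β) (f : α → β) : Prop :=
  Function.Injective f ∧ ∀ ⦃u v : α⦄, H.Adj u v → G.Adj (f u) (f v)

/-- An `H`-tiling in `G`: a collection of vertex-disjoint copies of `H` in `G`. -/
def IsTiling {α β : Type*} (H : SimpleGraph α) (G : SimpleGraph β) (T : Set (α → β)) : Prop :=
  (∀ f ∈ T, IsCopy H G f) ∧
    T.Pairwise fun f g => Disjoint (Set.range f) (Set.range g)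

/-- `G` contains a perfect `H`-tiling. -/
def HasPerfectTiling {α β : Type*} (H : SimpleGraph α) (G : SimpleGraph β) : Prop :=
  ∃ T : Set (α → β), IsTiling H G T ∧ ∀ v : β, ∃ f ∈ T, v ∈ Set.range f

/-- `σ(H)` relative to `r` colours: the smallest possible size of a colour class in
any proper colouring of `H` with `r` colours. -/
noncomputable def minClassSize {α : Type*} (H : SimpleGraph α) (r : ℕ) : ℕ :=
  sInf {s : ℕ | ∃ (c : H.Coloring (Fin r)) (i : Fin r), s = {v | c v = i}.ncard}

/-- `hcf_χ(H) = 1`: the highest common factor of all differences of colour class sizes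
over optimal colourings is 1 (equivalently, no `d ≥ 2` divides all such differences). -/
def HcfChiOne {α : Type*} (H : SimpleGraph α) (r : ℕ) : Prop :=
  ∀ d : ℕ, 2 ≤ d →
    ¬ ∀ (c : H.Coloring (Fin r)) (i j : Fin r),
        (d : ℤ) ∣ (({v | c v = i}.ncard : ℤ) - ({v | c v = j}.ncard : ℤ))

/-- `hcf_χ(H) ≤ 2`: some difference of colour class sizes is nonzero (so `hcf_χ(H) ≠ ∞`)
and no `d ≥ 3` divides all such differences. -/
def HcfChiLeTwo {α : Type*} (H : SimpleGraph α) (r : ℕ) : Prop :=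
  (∃ (c : H.Coloring (Fin r)) (i j : Fin r),
      {v | c v = i}.ncard ≠ {v | c v = j}.ncard) ∧
    ∀ d : ℕ, 3 ≤ d →
      ¬ ∀ (c : H.Coloring (Fin r)) (i j : Fin r),
          (d : ℤ) ∣ (({v | c v = i}.ncard : ℤ) - ({v | c v = j}.ncard : ℤ))

/-- `hcf_c(H) = 1`: the highest common factor of the orders of the components of `H` is 1. -/
def HcfCompOne {α : Type*} (H : SimpleGraph α) : Prop :=
  ∀ d : ℕ, 2 ≤ d → ∃ C : H.ConnectedComponent, ¬ d ∣ C.supp.ncard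

/-- `hcf(H) = 1` for a graph `H` with `χ(H) = r`. -/
def HcfOne {α : Type*} (H : SimpleGraph α) (r : ℕ) : Prop :=
  (r = 2 → HcfCompOne H ∧ HcfChiLeTwo H 2) ∧ (r ≠ 2 → HcfChiOne H r)

namespace KuhnOsthus

open Finset

universe u

section FractionalOptimum
open scoped Classical

variable {τ V : Type*} [Fintype τ] [Fintype V]

/-- The fractional tilings with tile weights `c` whose coverage is at most one everywhere and
whose total coverage is at least `|V| - ε`. -/
def fracTilings (c : τ → V → ℝ) (valid : τ → Prop) (ε : ℝ) : Set (τ → ℝ) :=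
  {T | (∀ K, 0 ≤ T K) ∧ (∀ K, ¬ valid K → T K = 0) ∧ (∀ v, ∑ K, T K * c K v ≤ 1) ∧
    (Fintype.card V : ℝ) - ε ≤ ∑ v, ∑ K, T K * c K v}

lemma isCompact_fracTilings {c : τ → V → ℝ} {valid : τ → Prop} {ε m : ℝ}
    (hc : ∀ K v, 0 ≤ c K v) (hm0 : 0 < m) (hm : ∀ K, valid K → ∃ v, m ≤ c K v) :
    IsCompact (fracTilings c valid ε) := by
  have hsub : fracTilings c valid ε ⊆ Set.pi Set.univ (fun _ => Set.Icc (0 : ℝ) (1 / m)) := by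
    rintro T ⟨h0, hv, h1, -⟩ K -
    refine ⟨h0 K, ?_⟩
    by_cases hK : valid K
    · obtain ⟨v, hv'⟩ := hm K hK
      rw [le_div_iff₀ hm0]
      calc T K * m ≤ T K * c K v := mul_le_mul_of_nonneg_left hv' (h0 K)
        _ ≤ ∑ K, T K * c K v :=
          Finset.single_le_sum (f := fun K => T K * c K v)
            (fun K _ => mul_nonneg (h0 K) (hc K v)) (mem_univ K)
        _ ≤ 1 := h1 v
    · rw [hv K hK]; positivity
  refine IsCompact.of_isClosed_subset (isCompact_univ_pi fun _ => isCompact_Icc) ?_ hsub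
  have e : fracTilings c valid ε = (⋂ K, {T | 0 ≤ T K}) ∩ ((⋂ K, ⋂ (_ : ¬ valid K), {T | T K = 0}) ∩
      ((⋂ v, {T : τ → ℝ | ∑ K, T K * c K v ≤ 1}) ∩
        {T | (Fintype.card V : ℝ) - ε ≤ ∑ v, ∑ K, T K * c K v})) := by
    ext T; simp [fracTilings]
  rw [e]
  refine (isClosed_iInter fun K => isClosed_le (by fun_prop) (by fun_prop)).inter
    (IsClosed.inter ?_ (IsClosed.inter ?_ ?_))
  · exact isClosed_iInter fun K => isClosed_iInter fun _ => isClosed_eq (by fun_prop) (by fun_prop)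
  · exact isClosed_iInter fun v => isClosed_le (by fun_prop) (by fun_prop)
  · exact isClosed_le (by fun_prop) (by fun_prop)

lemma sum_add_single_sub_single_mul (T : τ → ℝ) (K K' : τ) (e : ℝ) (f : τ → ℝ) :
    ∑ L, (T L + (Pi.single K' e : τ → ℝ) L - (Pi.single K e : τ → ℝ) L) * f L =
      ∑ L, T L * f L + e * (f K' - f K) := by
  simp only [sub_mul, add_mul, sum_sub_distrib, sum_add_distrib, Pi.single_apply, ite_mul,
    zero_mul, sum_ite_eq', mem_univ, if_true]
  ring

lemma sum_scale_add_single_mul (T : τ → ℝ) (K : τ) (t e : ℝ) (f : τ → ℝ) :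
    ∑ L, (t * T L + (Pi.single K e : τ → ℝ) L) * f L = t * ∑ L, T L * f L + e * f K := by
  simp only [add_mul, sum_add_distrib, Pi.single_apply, ite_mul,
    zero_mul, sum_ite_eq', mem_univ, if_true, mul_sum, mul_assoc]

lemma exists_pos_forall_lt {ι : Type*} (S : Finset ι) (f : ι → ℝ) (hf : ∀ i ∈ S, 0 < f i) (b : ℝ)
    (hb : 0 < b) : ∃ e > 0, e ≤ b ∧ ∀ i ∈ S, e < f i := by
  induction S using Finset.induction_on with
  | empty => exact ⟨b, hb, le_rfl, by simp⟩
  | insert a S ha ih =>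
    obtain ⟨e, he, heb, h⟩ := ih fun i hi => hf i (mem_insert_of_mem hi)
    have h1 := hf a (mem_insert_self _ _)
    refine ⟨min e (f a / 2), by positivity, (min_le_left _ _).trans heb, fun i hi => ?_⟩
    rcases mem_insert.1 hi with rfl | hi
    · exact (min_le_right _ _).trans_lt (by linarith)
    · exact (min_le_left _ _).trans_lt (h i hi)

/-- A fractional tiling minimising the total waste `∑ T K * d K` and, subject to this, maximising
the number of vertices that are not fully covered. -/
lemma exists_extremal_fracTiling {c : τ → V → ℝ} {d : τ → ℝ} {valid : τ → Prop} {ε m : ℝ}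
    (hε : 0 < ε) (hc : ∀ K v, 0 ≤ c K v) (hd : ∀ K, 0 ≤ d K) (hsum : ∀ K, ∑ v, c K v + d K = 1)
    (hm0 : 0 < m) (hm : ∀ K, valid K → ∃ v, m ≤ c K v)
    (hne : (fracTilings c valid ε).Nonempty) :
    ∃ T ∈ fracTilings c valid ε, ∑ K, T K * d K = 0 ∨
      ((∃ v, ∑ K, T K * c K v < 1) ∧
      (∀ K K', 0 < T K → valid K' → (∀ v, ¬ ∑ L, T L * c L v < 1 → c K' v ≤ c K v) →
        d K' ≤ d K → d K' = d K ∧ ∀ v, c K' v < c K v → ∑ L, T L * c L v < 1) ∧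
      (∀ K, valid K → d K = 0 → ∃ v, 0 < c K v ∧ ¬ ∑ L, T L * c L v < 1)) := by
  have hc1 : ∀ K v, c K v ≤ 1 := fun K v => by
    have := Finset.single_le_sum (f := fun v => c K v) (fun v _ => hc K v) (mem_univ v)
    linarith [hsum K, hd K]
  have hcomp := isCompact_fracTilings (ε := ε) hc hm0 hm
  obtain ⟨T₀, hT₀, hmin⟩ := hcomp.exists_isMinOn hne
    (f := fun T => ∑ K, T K * d K) (by fun_prop)
  let D : (τ → ℝ) → ℝ := fun T => ∑ K, T K * d K
  let Z : (τ → ℝ) → Finset V := fun T => univ.filter fun v => ∑ K, T K * c K v < 1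
  let A : Set ℕ := {z | ∃ T ∈ fracTilings c valid ε, D T = D T₀ ∧ (Z T).card = z}
  have hA : A.Nonempty := ⟨_, T₀, hT₀, rfl, rfl⟩
  have hAb : BddAbove A := ⟨Fintype.card V, by rintro _ ⟨T, -, -, rfl⟩; exact card_le_univ _⟩
  obtain ⟨T, hT, hDT, hZT⟩ := Nat.sSup_mem hA hAb
  have hminD : ∀ T' ∈ fracTilings c valid ε, D T ≤ D T' := fun T' hT' => hDT ▸ hmin hT'
  have hmaxZ : ∀ T' ∈ fracTilings c valid ε, D T' = D T → (Z T').card ≤ (Z T).card := by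
    intro T' hT' h
    rw [hZT]
    exact le_csSup hAb ⟨T', hT', h.trans hDT, rfl⟩
  refine ⟨T, hT, ?_⟩
  obtain ⟨h0, hval, h1, htot⟩ := hT
  have hD0 : 0 ≤ D T := sum_nonneg fun K _ => mul_nonneg (h0 K) (hd K)
  rcases hD0.eq_or_lt with h | hDpos
  · exact Or.inl h.symm
  right
  have hcov0 : ∀ v, 0 ≤ ∑ K, T K * c K v := fun v =>
    sum_nonneg fun K _ => mul_nonneg (h0 K) (hc K v)
  have hcard : ∑ v, ∑ K, T K * c K v ≤ Fintype.card V := by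
    calc _ ≤ ∑ v : V, (1 : ℝ) := sum_le_sum fun v _ => h1 v
      _ = _ := by simp
  set N : ℝ := ((Fintype.card V : ℕ) : ℝ) with hN
  have hN0 : 0 ≤ N := by positivity
  refine ⟨?_, ?_, ?_⟩
  · by_contra! hfull
    have hTK : ∃ K : τ, True := by
      by_contra! h
      have : IsEmpty τ := ⟨fun K => h K⟩
      simp [D] at hDpos
    set t : ℝ := min 1 (ε / (N + 1)) with ht
    have ht0 : 0 < t := by positivity
    have ht1 : t ≤ 1 := min_le_left _ _
    have ht2 : t * N ≤ ε := by
      have : t * (N + 1) ≤ ε := by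
        rw [← le_div_iff₀ (by positivity)]; exact min_le_right _ _
      nlinarith
    have key : ∀ f : τ → ℝ, ∑ L, ((1 - t) * T L) * f L = (1 - t) * ∑ L, T L * f L := fun f => by
      rw [mul_sum]; exact sum_congr rfl fun _ _ => by ring
    have := hminD (fun L => (1 - t) * T L) ⟨fun K => mul_nonneg (by linarith) (h0 K),
      fun K hK => by simp [hval K hK], fun v => by
        rw [key]; nlinarith [h1 v, hcov0 v], by
        simp only [key, ← mul_sum]
        have : N ≤ ∑ v, ∑ K, T K * c K v := by
          calc N = ∑ v : V, (1 : ℝ) := by simp [hN]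
            _ ≤ _ := sum_le_sum fun v _ => hfull v
        nlinarith⟩
    simp only [D, key] at this hDpos
    nlinarith
  · intro K K' hTK hK' hle hdle
    obtain ⟨e, he, heK, heZ⟩ := exists_pos_forall_lt (Z T) (fun v => 1 - ∑ L, T L * c L v)
      (fun v hv => by have := (mem_filter.1 hv).2; linarith) (T K) hTK
    let T' : τ → ℝ := fun L => T L + (Pi.single K' e : τ → ℝ) L - (Pi.single K e : τ → ℝ) L
    have key : ∀ f : τ → ℝ, ∑ L, T' L * f L = ∑ L, T L * f L + e * (f K' - f K) :=
      sum_add_single_sub_single_mul T K K' e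
    have hvalK : valid K := by
      by_contra h; rw [hval K h] at hTK; exact lt_irrefl _ hTK
    have hlt : ∀ v ∈ Z T, ∑ L, T' L * c L v < 1 := fun v hv => by
      rw [key]
      nlinarith [heZ v hv, hc K v, hc1 K' v]
    have hT' : T' ∈ fracTilings c valid ε := by
      refine ⟨fun L => ?_, fun L hL => ?_, fun v => ?_, ?_⟩
      · have : (Pi.single K e : τ → ℝ) L ≤ T L := by
          rw [Pi.single_apply]; split_ifs with h
          · rw [h]; exact heK
          · exact h0 L
        have : 0 ≤ (Pi.single K' e : τ → ℝ) L := by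
          rw [Pi.single_apply]; split_ifs <;> linarith
        simp only [T']; linarith
      · have h1 : L ≠ K := by rintro rfl; exact hL hvalK
        have h2 : L ≠ K' := by rintro rfl; exact hL hK'
        simp [T', hval L hL, Pi.single_apply, h1, h2]
      · by_cases hv : v ∈ Z T
        · exact (hlt v hv).le
        · have h2 : ¬ ∑ L, T L * c L v < 1 := fun h => hv (by simp [Z, h])
          rw [key]; nlinarith [hle v h2, h1 v]
      · simp only [key, sum_add_distrib, ← mul_sum, sum_sub_distrib]
        have := hsum K; have := hsum K'
        nlinarith
    have hDT' : D T' = D T + e * (d K' - d K) := key d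
    have h2 := hminD T' hT'
    have hdeq : d K' = d K := by
      refine le_antisymm hdle ?_
      by_contra! h
      nlinarith
    refine ⟨hdeq, fun v hv => ?_⟩
    by_contra hvZ
    have hvZ' : v ∉ Z T := by simpa [Z] using hvZ
    have hsub : insert v (Z T) ⊆ Z T' := by
      intro u hu
      rcases mem_insert.1 hu with rfl | hu
      · simp only [Z, mem_filter, mem_univ, true_and]
        rw [key]; nlinarith [h1 u]
      · simpa [Z] using hlt u hu
    have h3 := card_le_card hsub
    rw [card_insert_of_notMem hvZ'] at h3
    have := hmaxZ T' hT' (by rw [hDT', hdeq]; ring)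
    omega
  · intro K hK hdK
    by_contra! hall
    obtain ⟨e, he, heε, heZ⟩ := exists_pos_forall_lt (Z T) (fun v => 1 - ∑ L, T L * c L v)
      (fun v hv => by have := (mem_filter.1 hv).2; linarith) 1 one_pos
    set t : ℝ := e / (N + 1) with ht
    have ht0 : 0 < t := by positivity
    have hte : t * (N + 1) = e := by rw [ht]; field_simp
    have ht1 : t ≤ 1 := by nlinarith
    let T' : τ → ℝ := fun L => (1 - t) * T L + (Pi.single K e : τ → ℝ) L
    have key : ∀ f : τ → ℝ, ∑ L, T' L * f L = (1 - t) * ∑ L, T L * f L + e * f K :=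
      sum_scale_add_single_mul T K (1 - t) e
    have hT' : T' ∈ fracTilings c valid ε := by
      refine ⟨fun L => ?_, fun L hL => ?_, fun v => ?_, ?_⟩
      · have : 0 ≤ (Pi.single K e : τ → ℝ) L := by
          rw [Pi.single_apply]; split_ifs <;> linarith
        have := mul_nonneg (sub_nonneg.2 ht1) (h0 L)
        simp only [T']; linarith
      · have h1 : L ≠ K := by rintro rfl; exact hL hK
        simp [T', hval L hL, Pi.single_apply, h1]
      · rw [key]
        by_cases hv : v ∈ Z T
        · nlinarith [heZ v hv, hc1 K v, hcov0 v]
        · have h2 : ¬ ∑ L, T L * c L v < 1 := fun h => hv (by simp [Z, h])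
          have h3 : c K v ≤ 0 := by
            by_contra! h; exact h2 (hall v h)
          nlinarith [h1 v, hcov0 v]
      · simp only [key, sum_add_distrib, ← mul_sum]
        have := hsum K
        nlinarith
    have h2 := hminD T' hT'
    have h3 : D T' = (1 - t) * D T + e * d K := key d
    rw [hdK] at h3
    nlinarith

end FractionalOptimum

section DegreeCondition
open scoped Classical

variable {V : Type*} [Fintype V]

/-- The number of vertices that are not adjacent to `v` (including `v` itself). -/
noncomputable def nonNbr (G : SimpleGraph V) (v : V) : ℕ := (univ.filter fun u => ¬ G.Adj v u).card

/-- A weak form of the degree sequence condition: every nonempty vertex set contains a vertex whose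
degree is large in terms of the size of the set. -/
def DegCond (G : SimpleGraph V) (w s η : ℝ) : Prop :=
  ∀ Z : Finset V, Z.Nonempty → ∃ x ∈ Z,
    (nonNbr G x : ℝ) + s * min (Fintype.card V : ℝ) (Z.card / w) ≤ (w + s - η) * Fintype.card V

end DegreeCondition

section FractionalCliqueTiling
open scoped Classical

variable {V : Type*} {q : ℕ}

/-- The weight that a clique tile gives to its vertex in position `i`. -/
noncomputable def posWeight (w s : ℝ) (i : Fin (q + 1)) : ℝ := if i = 0 then s else w

/-- The weight that the tile `K` (with `none` standing for a missing vertex) gives to `v`. -/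
noncomputable def tileCov (w s : ℝ) (K : Fin (q + 1) → Option V) (v : V) : ℝ :=
  ∑ i, if K i = some v then posWeight w s i else 0

/-- The total weight of the missing vertices of the tile `K`. -/
noncomputable def tileWaste (w s : ℝ) (K : Fin (q + 1) → Option V) : ℝ :=
  ∑ i, if K i = none then posWeight w s i else 0

/-- The vertices of the tile `K` form a nonempty clique. -/
def IsTile (G : SimpleGraph V) (K : Fin (q + 1) → Option V) : Prop :=
  (∀ i j u v, i ≠ j → K i = some u → K j = some v → G.Adj u v) ∧ ∃ i v, K i = some v

lemma sum_posWeight (w s : ℝ) : ∑ i : Fin (q + 1), posWeight w s i = s + q * w := by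
  simp [Fin.sum_univ_succ, posWeight]

lemma sum_update_apply {ι β : Type*} [Fintype ι] [DecidableEq ι] (f : ι → β → ℝ) (K : ι → β) (j : ι)
    (y : β) :
    ∑ i, f i (Function.update K j y i) = ∑ i, f i (K i) + (f j y - f j (K j)) := by
  rw [← Finset.add_sum_erase _ _ (mem_univ j), ← Finset.add_sum_erase univ (fun i => f i (K i))
    (mem_univ j), Function.update_self]
  have : ∑ x ∈ univ.erase j, f x (Function.update K j y x) = ∑ x ∈ univ.erase j, f x (K x) :=
    sum_congr rfl fun x hx => by rw [Function.update_of_ne (ne_of_mem_erase hx)]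
  rw [this]; ring

lemma sum_tileCov_mem (w s : ℝ) (K : Fin (q + 1) → Option V) (U : Finset V) :
    ∑ v ∈ U, tileCov w s K v = ∑ i, if ∃ v ∈ U, K i = some v then posWeight w s i else 0 := by
  unfold tileCov
  rw [sum_comm]
  refine sum_congr rfl fun i _ => ?_
  cases hK : K i with
  | none => simp
  | some u => simp

lemma sum_tileCov_add_tileWaste [Fintype V] (w s : ℝ) (K : Fin (q + 1) → Option V) :
    ∑ v, tileCov w s K v + tileWaste w s K = s + q * w := by
  rw [sum_tileCov_mem, tileWaste, ← sum_add_distrib, ← sum_posWeight]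
  refine sum_congr rfl fun i _ => ?_
  cases hK : K i <;> simp

variable {w s : ℝ}

lemma posWeight_pos (hs : 0 < s) (hw : 0 < w) (i : Fin (q + 1)) : 0 < posWeight w s i := by
  unfold posWeight; split_ifs <;> assumption

lemma tileCov_nonneg (hs : 0 < s) (hw : 0 < w) (K : Fin (q + 1) → Option V) (v : V) :
    0 ≤ tileCov w s K v :=
  sum_nonneg fun i _ => by split_ifs; exacts [(posWeight_pos hs hw i).le, le_rfl]

lemma tileWaste_nonneg (hs : 0 < s) (hw : 0 < w) (K : Fin (q + 1) → Option V) :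
    0 ≤ tileWaste w s K :=
  sum_nonneg fun i _ => by split_ifs; exacts [(posWeight_pos hs hw i).le, le_rfl]

lemma tileCov_pos (hs : 0 < s) (hw : 0 < w) {K : Fin (q + 1) → Option V} {v : V} {i}
    (h : K i = some v) : posWeight w s i ≤ tileCov w s K v := by
  have := single_le_sum (f := fun i => if K i = some v then posWeight w s i else 0)
    (fun i _ => by split_ifs; exacts [(posWeight_pos hs hw i).le, le_rfl]) (mem_univ i)
  simpa [h, tileCov] using this

lemma tileCov_update (K : Fin (q + 1) → Option V) (j) (y : Option V) (v : V) :
    tileCov w s (Function.update K j y) v = tileCov w s K v +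
      ((if y = some v then posWeight w s j else 0) - if K j = some v then posWeight w s j else 0) :=
  sum_update_apply (fun i z => if z = some v then posWeight w s i else 0) K j y

lemma tileWaste_update (K : Fin (q + 1) → Option V) (j) (y : Option V) :
    tileWaste w s (Function.update K j y) = tileWaste w s K +
      ((if y = none then posWeight w s j else 0) - if K j = none then posWeight w s j else 0) :=
  sum_update_apply (fun i z => if z = none then posWeight w s i else 0) K j y

/-- Tiles that are used in an extremal fractional tiling put a lot of weight on the non-neighbours
of an uncovered vertex `x`. -/
lemma extremal_nonNbr_weight [Fintype V] {G : SimpleGraph V} (hs : 0 < s) (hsw : s < w)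
    {Z : Finset V} {x : V}
    (hx : x ∈ Z) {K : Fin (q + 1) → Option V} (hK : IsTile G K)
    (hmove : ∀ K' : Fin (q + 1) → Option V, IsTile G K' →
      (∀ v, v ∉ Z → tileCov w s K' v ≤ tileCov w s K v) →
      tileWaste w s K' ≤ tileWaste w s K → tileWaste w s K' = tileWaste w s K ∧
        ∀ v, tileCov w s K' v < tileCov w s K v → v ∈ Z)
    (hfull : tileWaste w s K = 0 → ∃ v, 0 < tileCov w s K v ∧ v ∉ Z) :
    w ≤ ∑ v ∈ univ.filter (fun u => ¬ G.Adj x u), tileCov w s K v ∧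
    w + s - s / w * ∑ v ∈ Z, tileCov w s K v ≤
      ∑ v ∈ univ.filter (fun u => ¬ G.Adj x u), tileCov w s K v := by
  have hw : 0 < w := hs.trans hsw
  set B : Fin (q + 1) → Prop := fun i => ∃ u, K i = some u ∧ ¬ G.Adj x u with hB
  have hnn : ∑ v ∈ univ.filter (fun u => ¬ G.Adj x u), tileCov w s K v =
      ∑ i, if B i then posWeight w s i else 0 := by
    rw [sum_tileCov_mem]
    refine sum_congr rfl fun i _ => ?_
    congr 1
    simp [hB, and_comm]
  have hpw : ∀ i : Fin (q + 1), 0 < posWeight w s i := posWeight_pos hs hw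
  have hzw : 0 ≤ ∑ v ∈ Z, tileCov w s K v := sum_nonneg fun v _ => tileCov_nonneg hs hw K v
  -- inserting `x` at position `j` and moving the vertex at `j` to position `i` when only `i` is bad
  have tile_swap : ∀ i j, (∀ l, B l → l = i) →
      IsTile G (Function.update (Function.update K i (K j)) j (some x)) := by
    intro i j hBi
    have hadj : ∀ l u, l ≠ i → K l = some u → G.Adj x u := by
      intro l u hl hu
      by_contra h
      exact hl (hBi l ⟨u, hu, h⟩)
    refine ⟨?_, j, x, by simp⟩
    have hval : ∀ l u, l ≠ j → Function.update (Function.update K i (K j)) j (some x) l = some u →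
        ∃ l', l' ≠ i ∧ K l' = some u ∧ (l = i ∧ l' = j ∨ l ≠ i ∧ l' = l) := by
      intro l u hl hu
      rw [Function.update_of_ne hl] at hu
      by_cases hli : l = i
      · subst hli
        rw [Function.update_self] at hu
        exact ⟨j, hl.symm, hu, Or.inl ⟨rfl, rfl⟩⟩
      · rw [Function.update_of_ne hli] at hu
        exact ⟨l, hli, hu, Or.inr ⟨hli, rfl⟩⟩
    intro a b u v hab hu hv
    by_cases haj : a = j
    · subst haj
      rw [Function.update_self] at hu
      obtain rfl := Option.some_inj.1 hu
      obtain ⟨l', hl', hKl', -⟩ := hval b v hab.symm hv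
      exact hadj l' v hl' hKl'
    · obtain ⟨a', ha', hKa, hca⟩ := hval a u haj hu
      by_cases hbj : b = j
      · subst hbj
        rw [Function.update_self] at hv
        obtain rfl := Option.some_inj.1 hv
        exact (hadj a' u ha' hKa).symm
      · obtain ⟨b', hb', hKb, hcb⟩ := hval b v hbj hv
        refine hK.1 a' b' u v ?_ hKa hKb
        rintro rfl
        rcases hca with ⟨h1, h2⟩ | ⟨h1, h2⟩ <;> rcases hcb with ⟨h3, h4⟩ | ⟨h3, h4⟩
        · exact hab (h1.trans h3.symm)
        · exact hbj (h4.symm.trans h2)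
        · exact haj (h2.symm.trans h4)
        · exact hab (h2.symm.trans h4)
  have hxne : ∀ v, v ∉ Z → v ≠ x := fun v hv h => hv (h ▸ hx)
  have not_all : ¬ ∀ j, ∃ u ∈ Z, K j = some u := by
    intro hall
    have hd : tileWaste w s K = 0 := sum_eq_zero fun j _ => by
      obtain ⟨u, -, hu⟩ := hall j
      simp [hu]
    obtain ⟨v, hv, hvZ⟩ := hfull hd
    have : tileCov w s K v = 0 := sum_eq_zero fun j _ => by
      obtain ⟨u, huZ, hu⟩ := hall j
      rw [hu, if_neg]
      intro h
      obtain rfl := Option.some_inj.1 h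
      exact hvZ huZ
    linarith
  -- moving `x` to position `j` directly
  have direct : ∀ j, (∀ l, B l → l = j) → ∃ u ∈ Z, K j = some u := by
    intro j hBj
    have h1 := tile_swap j j hBj
    rw [Function.update_eq_self] at h1
    have hle : ∀ v, v ∉ Z →
        tileCov w s (Function.update K j (some x)) v ≤ tileCov w s K v := by
      intro v hv
      rw [tileCov_update, if_neg (fun h => hxne v hv (Option.some_inj.1 h).symm)]
      have := hpw j
      split_ifs <;> linarith
    obtain ⟨h2, h3⟩ := hmove _ h1 hle (by
      rw [tileWaste_update]
      have := hpw j
      simp only [reduceCtorEq, if_false]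
      split_ifs <;> linarith)
    rw [tileWaste_update] at h2
    have hj := hpw j
    cases hKj : K j with
    | none => simp only [hKj, reduceCtorEq, if_false, if_true] at h2; linarith
    | some u =>
      refine ⟨u, ?_, rfl⟩
      by_contra hu
      refine hu (h3 u ?_)
      rw [tileCov_update, if_neg (fun h => hxne u hu (Option.some_inj.1 h).symm), if_pos hKj]
      linarith
  by_cases hB0 : ∀ l, B l → l = 0
  · exfalso
    by_cases hBe : ∀ l, ¬ B l
    · exact not_all fun j => direct j fun l hl => absurd hl (hBe l)
    push Not at hBe
    obtain ⟨l, hl⟩ := hBe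
    obtain rfl := hB0 l hl
    refine not_all fun j => ?_
    by_cases hj : j = 0
    · subst hj; exact direct 0 hB0
    have h1 := tile_swap 0 j hB0
    obtain ⟨u0, hu0, -⟩ := hl
    have hw0 : posWeight w s (0 : Fin (q + 1)) = s := by simp [posWeight]
    have hwj : posWeight w s j = w := by simp [posWeight, hj]
    have hcov : ∀ v, v ≠ x →
        tileCov w s (Function.update (Function.update K 0 (K j)) j (some x)) v =
        tileCov w s K v + ((if K j = some v then s else 0) - if K 0 = some v then s else 0) -
          if K j = some v then w else 0 := by
      intro v hv
      rw [tileCov_update, tileCov_update, if_neg (fun h => hv (Option.some_inj.1 h).symm),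
        Function.update_of_ne hj, hw0, hwj]
      ring
    have hwaste : tileWaste w s (Function.update (Function.update K 0 (K j)) j (some x)) =
        tileWaste w s K + ((if K j = none then s else 0) - if K j = none then w else 0) := by
      rw [tileWaste_update, tileWaste_update, Function.update_of_ne hj, hw0, hwj, hu0]
      simp
      ring
    obtain ⟨h2, h3⟩ := hmove _ h1 (fun v hv => by
        rw [hcov v (hxne v hv)]; split_ifs <;> linarith) (by
        rw [hwaste]; split_ifs <;> linarith)
    rw [hwaste] at h2
    cases hKj : K j with
    | none => simp only [hKj, if_true] at h2; linarith
    | some u =>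
      refine ⟨u, ?_, rfl⟩
      by_contra hu
      refine hu (h3 u ?_)
      rw [hcov u (hxne u hu), if_pos hKj, if_pos hKj]
      split_ifs <;> linarith
  push Not at hB0
  obtain ⟨j, hBj, hj0⟩ := hB0
  have hwj : posWeight w s j = w := by simp [posWeight, hj0]
  rw [hnn]
  by_cases hBu : ∀ l, B l → l = j
  · obtain ⟨u, huZ, hu⟩ := direct j hBu
    have hz : w ≤ ∑ v ∈ Z, tileCov w s K v := by
      calc w ≤ tileCov w s K u := hwj.symm.le.trans (tileCov_pos hs hw hu)
        _ ≤ _ := single_le_sum (fun v _ => tileCov_nonneg hs hw K v) huZ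
    have hb : w ≤ ∑ i, if B i then posWeight w s i else 0 := by
      have := single_le_sum (f := fun i => if B i then posWeight w s i else 0)
        (fun i _ => by split_ifs; exacts [(hpw i).le, le_rfl]) (mem_univ j)
      simpa only [hBj, if_true, hwj] using this
    refine ⟨hb, ?_⟩
    have : s ≤ s / w * ∑ v ∈ Z, tileCov w s K v := by
      calc s = s / w * w := by field_simp
        _ ≤ _ := mul_le_mul_of_nonneg_left hz (by positivity)
    linarith
  · push Not at hBu
    obtain ⟨l, hBl, hlj⟩ := hBu
    have hsl : s ≤ posWeight w s l := by unfold posWeight; split_ifs <;> linarith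
    have hb : w + s ≤ ∑ i, if B i then posWeight w s i else 0 := by
      have h2 : ∑ i ∈ {j, l}, (if B i then posWeight w s i else 0) ≤
          ∑ i, if B i then posWeight w s i else 0 :=
        sum_le_sum_of_subset_of_nonneg (subset_univ _)
          (fun i _ _ => by split_ifs; exacts [(hpw i).le, le_rfl])
      rw [sum_pair hlj.symm, if_pos hBj, if_pos hBl, hwj] at h2
      linarith
    have : 0 ≤ s / w * ∑ v ∈ Z, tileCov w s K v := by positivity
    exact ⟨by linarith, by linarith⟩

/-- The degree condition gives an almost perfect fractional tiling with weighted cliques. -/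
lemma exists_fractional_clique_tiling [Fintype V] (G : SimpleGraph V) {η ε : ℝ} (hs : 0 < s)
    (hsw : s < w)
    (hq : s + q * w = 1) (hε : 0 < ε) (hG : DegCond G w s η)
    (hεη : (w + s) * ε < η * Fintype.card V) :
    ∃ T : (Fin (q + 1) → V) → ℝ, (∀ K, 0 ≤ T K) ∧
      (∀ K, T K ≠ 0 → ∀ i j, i ≠ j → G.Adj (K i) (K j)) ∧
      (∀ v, ∑ K, T K * ∑ i, (if K i = v then posWeight w s i else 0) ≤ 1) ∧
      (Fintype.card V : ℝ) - ε ≤ ∑ K, T K := by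
  have hw : 0 < w := hs.trans hsw
  have hpw : ∀ i : Fin (q + 1), 0 < posWeight w s i := posWeight_pos hs hw
  obtain ⟨T, ⟨h0, hval, h1, htot⟩, hT⟩ := exists_extremal_fracTiling (V := V)
    (c := tileCov (q := q) w s) (d := tileWaste w s) (valid := IsTile G) (ε := ε) (m := s)
    hε (tileCov_nonneg hs hw) (tileWaste_nonneg hs hw)
    (fun K => (sum_tileCov_add_tileWaste w s K).trans hq) hs (by
      rintro K ⟨-, i, v, hv⟩
      refine ⟨v, le_trans ?_ (tileCov_pos hs hw hv)⟩
      unfold posWeight; split_ifs <;> linarith) (by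
      let J : V → Fin (q + 1) → Option V := fun v i => if i = 0 then some v else none
      have hJ : ∀ v u, tileCov w s (J v) u = if v = u then s else 0 := by
        intro v u
        simp [tileCov, J, Fin.sum_univ_succ, posWeight]
      have key : ∀ f : (Fin (q + 1) → Option V) → ℝ,
          ∑ K, (∑ v, if K = J v then 1 / s else 0) * f K = ∑ v, 1 / s * f (J v) := by
        intro f
        simp only [sum_mul]
        rw [sum_comm]
        simp
      refine ⟨fun K => ∑ v, if K = J v then 1 / s else 0, fun K => ?_, fun K hK => ?_,
        fun v => ?_, ?_⟩
      · exact sum_nonneg fun v _ => by split_ifs <;> positivity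
      · refine sum_eq_zero fun v _ => if_neg ?_
        rintro rfl
        refine hK ⟨fun i j u v' hij hu hv => ?_, 0, v, by simp [J]⟩
        simp only [J, Option.ite_none_right_eq_some] at hu hv
        exact absurd (hu.1.trans hv.1.symm) hij
      · rw [key]
        simp only [hJ]
        simp [hs.ne']
      · have : ∀ v, ∑ K, (∑ v, if K = J v then 1 / s else 0) * tileCov w s K v = 1 := by
          intro v
          rw [key]
          simp only [hJ]
          simp [hs.ne']
        rw [sum_congr rfl fun v _ => this v]
        simp
        exact hε.le)
  have hD : ∑ K, T K * tileWaste w s K = 0 := by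
    rcases hT with h | ⟨⟨z, hz⟩, hmove, hfull⟩
    · exact h
    exfalso
    set Z : Finset V := univ.filter fun v => ∑ K, T K * tileCov w s K v < 1 with hZ
    have memZ : ∀ v, v ∈ Z ↔ ∑ K, T K * tileCov w s K v < 1 := fun v => by simp [hZ]
    obtain ⟨x, hxZ, hx⟩ := hG Z ⟨z, (memZ z).2 hz⟩
    have main : ∀ K, T K ≠ 0 → _ := fun K hTK =>
      extremal_nonNbr_weight (G := G) hs hsw hxZ (K := K)
        (by by_contra h; exact hTK (hval K h))
        (fun K' hK' hle hd => by
          obtain ⟨h3, h4⟩ := hmove K K' (lt_of_le_of_ne (h0 K) hTK.symm) hK'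
            (fun v hv => hle v (fun h => hv ((memZ v).1 h))) hd
          exact ⟨h3, fun v hv => (memZ v).2 (h4 v hv)⟩)
        (fun hd => by
          obtain ⟨v, hv, hv'⟩ := hfull K (by by_contra h; exact hTK (hval K h)) hd
          exact ⟨v, hv, fun h => hv' ((memZ v).1 h)⟩)
    set M := ∑ K, T K with hM
    have swap : ∀ U : Finset V, ∑ K, T K * ∑ v ∈ U, tileCov w s K v ≤ U.card := by
      intro U
      simp only [mul_sum]
      rw [sum_comm]
      calc _ ≤ ∑ v ∈ U, (1 : ℝ) := sum_le_sum fun v _ => h1 v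
        _ = _ := by simp
    have hMk : (Fintype.card V : ℝ) - ε ≤ M := by
      refine htot.trans ?_
      rw [sum_comm]
      refine sum_le_sum fun K _ => ?_
      rw [← mul_sum]
      have := sum_tileCov_add_tileWaste w s K
      have := tileWaste_nonneg hs hw K
      nlinarith [h0 K]
    have e1 : w * M ≤ nonNbr G x := by
      refine le_trans ?_ (swap _)
      rw [hM, mul_sum]
      refine sum_le_sum fun K _ => ?_
      by_cases hTK : T K = 0
      · simp [hTK]
      · rw [mul_comm]
        exact mul_le_mul_of_nonneg_left (main K hTK).1 (h0 K)
    have e2 : (w + s) * M - s / w * Z.card ≤ nonNbr G x := by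
      have a1 : s / w * ∑ K, T K * ∑ v ∈ Z, tileCov w s K v ≤ s / w * Z.card :=
        mul_le_mul_of_nonneg_left (swap Z) (by positivity)
      have a2 : (w + s) * M - s / w * ∑ K, T K * ∑ v ∈ Z, tileCov w s K v ≤ nonNbr G x := by
        refine le_trans ?_ (swap _)
        rw [hM, mul_sum, mul_sum, ← sum_sub_distrib]
        refine sum_le_sum fun K _ => ?_
        by_cases hTK : T K = 0
        · simp [hTK]
        · have := mul_le_mul_of_nonneg_left (main K hTK).2 (h0 K)
          linarith
      linarith
    have e3 : s / w * Z.card = s * (Z.card / w) := by ring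
    rcases le_total (Fintype.card V : ℝ) (Z.card / w) with h | h
    · rw [min_eq_left h] at hx
      nlinarith
    · rw [min_eq_right h] at hx
      nlinarith
  have hreal : ∀ K, K ∉ Set.range (fun (K : Fin (q + 1) → V) i => some (K i)) → T K = 0 := by
    intro K hK
    by_contra hTK
    have h2 := (sum_eq_zero_iff_of_nonneg
      (fun K _ => mul_nonneg (h0 K) (tileWaste_nonneg hs hw K))).1 hD K (mem_univ _)
    have h3 : tileWaste w s K = 0 := (mul_eq_zero.1 h2).resolve_left hTK
    have h4 := (sum_eq_zero_iff_of_nonneg (fun i _ => by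
      split_ifs; exacts [(hpw i).le, le_rfl])).1 h3
    have h5 : ∀ i, ∃ v, some v = K i := by
      intro i
      have := h4 i (mem_univ i)
      cases hKi : K i with
      | none => rw [if_pos hKi] at this; exact absurd this (hpw i).ne'
      | some v => exact ⟨v, rfl⟩
    choose f hf using h5
    exact hK ⟨f, funext hf⟩
  have hinj : Function.Injective (fun (K : Fin (q + 1) → V) i => some (K i)) := by
    intro K K' h
    funext i
    exact Option.some_inj.1 (congrFun h i)
  have conv : ∀ f : (Fin (q + 1) → Option V) → ℝ,
      ∑ K : Fin (q + 1) → V, T (fun i => some (K i)) * f (fun i => some (K i)) =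
        ∑ K, T K * f K := fun f =>
    Fintype.sum_of_injective _ hinj _ _ (fun K hK => by rw [hreal K hK, zero_mul]) fun _ => rfl
  refine ⟨fun K => T fun i => some (K i), fun K => h0 _, fun K hK i j hij => ?_, fun v => ?_, ?_⟩
  · have : IsTile G fun i => some (K i) := by
      by_contra h; exact hK (hval _ h)
    exact this.1 i j _ _ hij rfl rfl
  · have := conv fun K => tileCov w s K v
    simp only [tileCov, Option.some_inj] at this
    rw [this]
    exact h1 v
  · have h2 := conv fun _ => 1
    simp only [mul_one] at h2
    rw [h2]
    refine htot.trans ?_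
    rw [sum_comm]
    refine sum_le_sum fun K _ => ?_
    rw [← mul_sum]
    have := sum_tileCov_add_tileWaste w s K
    have := tileWaste_nonneg hs hw K
    nlinarith [h0 K]

end FractionalCliqueTiling

section FractionalTiling
open scoped Classical

variable {α : Type*} [Fintype α] {H : SimpleGraph α} {q : ℕ}

lemma sum_card_filter_comp {J β γ : Type*} [DecidableEq γ] (c : α → β) (lam : J → ℝ)
    (S : Finset J) (f : J → β → γ) (i : γ) :
    ∑ t ∈ S, lam t * ((univ.filter fun a => f t (c a) = i).card : ℝ) =
      ∑ a, ∑ t ∈ S, lam t * if f t (c a) = i then 1 else 0 := by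
  rw [sum_comm]
  refine sum_congr rfl fun t _ => ?_
  rw [← mul_sum]
  simp

lemma sum_ite_add_eq {A : Type*} [AddGroup A] [Fintype A] [DecidableEq A] (y i : A) :
    ∑ t : A, (if y + t = i then (1 : ℝ) else 0) = 1 := by
  have : ∀ t, (y + t = i) ↔ (t = -y + i) := fun t => eq_neg_add_iff_add_eq.symm
  simp only [this]
  simp

/-- Averaging over cyclic shifts of a colouring, any class size vector `(σ, ρ, …, ρ)` with `σ`
between the size of the smallest class and the average class size can be realised. -/
lemma exists_colouring_weights (hq : q ≠ 0) (c : H.Coloring (Fin (q + 1))) {σ : ℝ}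
    (hx : ((univ.filter fun a => c a = 0).card : ℝ) ≤ σ) (hσ : σ < Fintype.card α / (q + 1)) :
    ∃ (lam : Fin q ⊕ Fin (q + 1) → ℝ) (C : Fin q ⊕ Fin (q + 1) → H.Coloring (Fin (q + 1))),
      (∀ j, 0 ≤ lam j) ∧ ∑ j, lam j = 1 ∧
      ∀ i, ∑ j, lam j * ((univ.filter fun a => C j a = i).card : ℝ) =
        posWeight ((Fintype.card α - σ) / q) σ i := by
  have : NeZero q := ⟨hq⟩
  have hq0 : (0 : ℝ) < q := by positivity
  set x : ℝ := ((univ.filter fun a => c a = 0).card : ℝ) with hxdef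
  set n : ℝ := (Fintype.card α : ℝ) with hn
  have hd : 0 < n / (q + 1) - x := by linarith
  set θ : ℝ := (n / (q + 1) - σ) / (n / (q + 1) - x) with hθ
  have hθ0 : 0 ≤ θ := div_nonneg (by linarith) hd.le
  have hθ1 : θ ≤ 1 := by rw [hθ, div_le_one hd]; linarith
  have hθx : θ * x + (1 - θ) * (n / (q + 1)) = σ := by
    have : θ * (n / (q + 1) - x) = n / (q + 1) - σ := div_mul_cancel₀ _ hd.ne'
    linarith
  let f : Fin q ⊕ Fin (q + 1) → Fin (q + 1) → Fin (q + 1) :=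
    Sum.elim (fun t => Fin.cases 0 fun y => (y + t).succ) fun t y => y + t
  have hf : ∀ j, Function.Injective (f j) := by
    rintro (t | t)
    · intro y z h
      cases y using Fin.cases <;> cases z using Fin.cases
      · rfl
      · exact (Fin.succ_ne_zero _ (by simpa only [f, Sum.elim_inl, Fin.cases_zero, Fin.cases_succ]
            using h.symm)).elim
      · exact (Fin.succ_ne_zero _ (by simpa only [f, Sum.elim_inl, Fin.cases_zero, Fin.cases_succ]
            using h)).elim
      · simpa [f] using h
    · intro y z h
      simpa [f] using h
  let lam : Fin q ⊕ Fin (q + 1) → ℝ := Sum.elim (fun _ => θ / q) fun _ => (1 - θ) / (q + 1)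
  refine ⟨lam, fun j => Coloring.mk (fun a => f j (c a))
    fun {a b} hab h => c.valid hab (hf j h), ?_, ?_, ?_⟩
  · rintro (t | t)
    · exact div_nonneg hθ0 hq0.le
    · exact div_nonneg (by linarith) (by positivity)
  · simp [lam]; field_simp; ring
  · intro i
    have e0 := sum_card_filter_comp (fun a => c a) lam univ f i
    have e1 : ∀ y, ∑ t, lam t * (if f t y = i then 1 else 0) =
        θ / q * (if y = 0 then if i = 0 then (q : ℝ) else 0 else if i = 0 then 0 else 1) +
        (1 - θ) / (q + 1) := by
      intro y
      have e3 : ∑ t : Fin (q + 1), (if f (Sum.inr t) y = i then (1 : ℝ) else 0) = 1 :=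
        sum_ite_add_eq y i
      have e2 : ∑ t : Fin q, (if f (Sum.inl t) y = i then (1 : ℝ) else 0) =
          (if y = 0 then if i = 0 then (q : ℝ) else 0 else if i = 0 then 0 else 1) := by
        cases y using Fin.cases with
        | zero =>
          simp only [f, Sum.elim_inl, Fin.cases_zero, if_true]
          by_cases hi : i = 0
          · simp [hi]
          · simp [hi, Ne.symm hi]
        | succ y =>
          simp only [f, Sum.elim_inl, Fin.cases_succ, Fin.succ_ne_zero, if_false]
          cases i using Fin.cases with
          | zero => simp [Fin.succ_ne_zero]
          | succ i =>
            simp only [Fin.succ_inj, Fin.succ_ne_zero, if_false]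
            exact sum_ite_add_eq y i
      rw [Fintype.sum_sum_type]
      simp only [lam, Sum.elim_inl, Sum.elim_inr, ← mul_sum]
      rw [e2, e3, mul_one]
    refine e0.trans ?_
    simp only [e1, sum_add_distrib, ← mul_sum]
    have hx' : ∀ u v : ℝ, ∑ a, (if c a = 0 then u else v) = x * u + (n - x) * v := by
      intro u v
      have : ∀ a, (if c a = 0 then u else v) = (if c a = 0 then 1 else 0) * (u - v) + v := by
        intro a; split_ifs <;> ring
      rw [sum_congr rfl fun a _ => this a, sum_add_distrib, ← sum_mul]
      simp [hxdef, hn]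
      ring
    rw [hx']
    simp only [sum_const, card_univ, nsmul_eq_mul]
    rw [← hn]
    unfold posWeight
    split_ifs
    · rw [← hθx]; field_simp; ring
    · rw [← hθx]; field_simp; ring

/-- The degree condition gives an almost perfect fractional tiling with homomorphic copies
of `H`. -/
lemma exists_fractional_tiling {V : Type*} [Fintype V] (hq : q ≠ 0) (c : H.Coloring (Fin (q + 1)))
    {σ : ℝ} (hσ0 : 0 < σ)
    (hx : ((univ.filter fun a => c a = 0).card : ℝ) ≤ σ) (hσ : σ < Fintype.card α / (q + 1))
    {w s : ℝ} (hs : s = σ / Fintype.card α) (hsw : s + q * w = 1)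
    (R : SimpleGraph V) {η ε : ℝ} (hε : 0 < ε) (hR : DegCond R w s η)
    (hεη : (w + s) * ε < η * Fintype.card V) :
    ∃ W : (α → V) → ℝ, (∀ φ, 0 ≤ W φ) ∧ (∀ φ, W φ ≠ 0 → ∀ a b, H.Adj a b → R.Adj (φ a) (φ b)) ∧
      (∀ v, ∑ φ, W φ * ((univ.filter fun a => φ a = v).card : ℝ) ≤ 1) ∧
      (Fintype.card V : ℝ) - ε ≤ Fintype.card α * ∑ φ, W φ := by
  set n : ℝ := (Fintype.card α : ℝ) with hn
  have hq0 : (0 : ℝ) < q := by positivity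
  have hn0 : 0 < n := by
    by_contra! h
    have : n / (q + 1) ≤ 0 := div_nonpos_of_nonpos_of_nonneg h (by positivity)
    linarith
  have hs0 : 0 < s := by rw [hs]; positivity
  have hw : (n - σ) / q = n * w := by
    have : n * s = σ := by rw [hs]; field_simp
    rw [div_eq_iff hq0.ne', ← this]
    nlinarith
  have hslt : s < w := by
    have h1 : s * (q + 1) < 1 := by
      rw [hs, div_mul_eq_mul_div, div_lt_one hn0]
      rwa [lt_div_iff₀ (by positivity)] at hσ
    nlinarith
  obtain ⟨T, hT0, hTadj, hT1, hTtot⟩ := exists_fractional_clique_tiling R hs0 hslt hsw hε hR hεη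
  obtain ⟨lam, C, hlam, hlam1, hC⟩ := exists_colouring_weights hq c hx hσ
  have hpw : ∀ i : Fin (q + 1), posWeight ((n - σ) / q) σ i = n * posWeight w s i := by
    intro i
    unfold posWeight
    split_ifs
    · rw [hs]; field_simp
    · exact hw
  let W : (α → V) → ℝ := fun φ => ∑ K, ∑ j, if φ = (fun a => K (C j a)) then T K * lam j / n else 0
  have key : ∀ f : (α → V) → ℝ,
      ∑ φ, W φ * f φ = ∑ K, ∑ j, T K * lam j / n * f (fun a => K (C j a)) := by
    intro f
    simp only [W, sum_mul]
    rw [sum_comm]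
    refine sum_congr rfl fun K _ => ?_
    rw [sum_comm]
    refine sum_congr rfl fun j _ => ?_
    simp
  refine ⟨W, fun φ => sum_nonneg fun K _ => sum_nonneg fun j _ => ?_, fun φ hφ a b hab => ?_,
    fun v => ?_, ?_⟩
  · split_ifs
    · exact div_nonneg (mul_nonneg (hT0 K) (hlam j)) hn0.le
    · exact le_rfl
  · obtain ⟨K, -, hK⟩ := exists_ne_zero_of_sum_ne_zero hφ
    obtain ⟨j, -, hj⟩ := exists_ne_zero_of_sum_ne_zero hK
    have h1 : φ = fun a => K (C j a) := by
      by_contra h; rw [if_neg h] at hj; exact hj rfl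
    rw [if_pos h1] at hj
    have hTK : T K ≠ 0 := by
      intro h; rw [h] at hj; simp at hj
    rw [h1]
    exact hTadj K hTK _ _ ((C j).valid hab)
  · rw [key]
    refine le_trans (le_of_eq ?_) (hT1 v)
    refine sum_congr rfl fun K _ => ?_
    have e1 : ∀ j, ((univ.filter fun a => K (C j a) = v).card : ℝ) =
        ∑ i, if K i = v then ((univ.filter fun a => C j a = i).card : ℝ) else 0 := by
      intro j
      rw [← sum_filter, ← Nat.cast_sum, ← card_biUnion]
      · congr 2
        ext a
        simp
      · intro i _ i' _ hii
        refine disjoint_left.2 fun a ha ha' => hii ?_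
        rw [← (mem_filter.1 ha).2, ← (mem_filter.1 ha').2]
    calc ∑ j, T K * lam j / n * ((univ.filter fun a => K (C j a) = v).card : ℝ)
        = ∑ j, ∑ i, T K / n * (if K i = v then
            lam j * ((univ.filter fun a => C j a = i).card : ℝ) else 0) := by
          refine sum_congr rfl fun j _ => ?_
          rw [e1, mul_sum]
          refine sum_congr rfl fun i _ => ?_
          split_ifs <;> ring
      _ = _ := by
          rw [sum_comm, mul_sum]
          refine sum_congr rfl fun i _ => ?_
          split_ifs
          · rw [← mul_sum, hC, hpw]; field_simp
          · simp
  · have := key fun _ => 1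
    simp only [mul_one] at this
    rw [this]
    refine hTtot.trans (le_of_eq ?_)
    rw [mul_sum]
    refine sum_congr rfl fun K _ => ?_
    have : ∀ j, T K * lam j / n = T K / n * lam j := fun j => by ring
    simp only [this, ← mul_sum, hlam1]
    field_simp

end FractionalTiling

section Embedding
open scoped Classical

variable {α V : Type*} [Fintype α]

/-- The vertex set `S` is the union of vertex-disjoint copies of `H` in `G`. -/
inductive Tileable (H : SimpleGraph α) (G : SimpleGraph V) : Finset V → Prop
  | empty : Tileable H G ∅
  | union_image {S : Finset V} {f : α → V} : Tileable H G S → IsCopy H G f →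
      Disjoint S (univ.image f) → Tileable H G (S ∪ univ.image f)

variable {H : SimpleGraph α} {G : SimpleGraph V}

lemma Tileable.union {S S' : Finset V} (hS : Tileable H G S) (hS' : Tileable H G S')
    (hd : Disjoint S S') : Tileable H G (S ∪ S') := by
  induction hS' with
  | empty => simpa using hS
  | @union_image S₁ f h1 h2 h3 ih =>
    rw [disjoint_union_right] at hd
    rw [← union_assoc]
    exact (ih hd.1).union_image h2 (disjoint_union_left.2 ⟨hd.2, h3⟩)

lemma Tileable.image_copy {f : α → V} (hf : IsCopy H G f) : Tileable H G (univ.image f) := by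
  have := Tileable.union_image (Tileable.empty (H := H) (G := G)) hf (by simp)
  simpa using this

lemma Tileable.dvd_card {S : Finset V} (hS : Tileable H G S) : Fintype.card α ∣ S.card := by
  induction hS with
  | empty => simp
  | @union_image S f h1 h2 h3 ih =>
    rw [card_union_of_disjoint h3, card_image_of_injective _ h2.1, card_univ]
    exact (Nat.dvd_add_right ih).2 dvd_rfl

lemma Tileable.map {V' : Type*} {G' : SimpleGraph V'} {e : V → V'} (he : IsCopy G G' e)
    {S : Finset V} (hS : Tileable H G S) : Tileable H G' (S.image e) := by
  induction hS with
  | empty => simpa using Tileable.empty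
  | @union_image S f h1 h2 h3 ih =>
    rw [image_union, image_image]
    refine ih.union_image ⟨he.1.comp h2.1, fun u v huv => he.2 (h2.2 huv)⟩ ?_
    rw [← image_image]
    exact (disjoint_image he.1).2 h3

lemma Tileable.biUnion {I : Type*} (J : Finset I) {S : I → Finset V}
    (hS : ∀ i ∈ J, Tileable H G (S i)) (hd : (J : Set I).PairwiseDisjoint S) :
    Tileable H G (J.biUnion S) := by
  induction J using Finset.induction_on with
  | empty => simpa using Tileable.empty
  | insert a J ha ih =>
    rw [biUnion_insert]
    refine (hS a (mem_insert_self _ _)).union (ih (fun i hi => hS i (mem_insert_of_mem hi))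
      (hd.subset (by simp))) ?_
    rw [disjoint_biUnion_right]
    intro i hi
    exact hd (by simp) (by simp [hi]) (by rintro rfl; exact ha hi)

lemma Tileable.hasPerfectTiling [Nonempty α] {S : Finset V} (hS : Tileable H G S) :
    ∃ T : Set (α → V), IsTiling H G T ∧ ∀ v, v ∈ S ↔ ∃ f ∈ T, v ∈ Set.range f := by
  induction hS with
  | empty => exact ⟨∅, ⟨by simp, by simp⟩, by simp⟩
  | @union_image S f h1 h2 h3 ih =>
    obtain ⟨T, ⟨hT1, hT2⟩, hT3⟩ := ih
    have hdis : ∀ g ∈ T, Disjoint (Set.range f) (Set.range g) := by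
      intro g hg
      rw [Set.disjoint_left]
      rintro _ ⟨a, rfl⟩ h
      exact disjoint_left.1 h3 ((hT3 _).2 ⟨g, hg, h⟩) (mem_image_of_mem _ (mem_univ _))
    refine ⟨insert f T, ⟨?_, ?_⟩, ?_⟩
    · rintro g (rfl | hg)
      · exact h2
      · exact hT1 g hg
    · refine Set.pairwise_insert.2 ⟨hT2, fun g hg _ => ⟨hdis g hg, (hdis g hg).symm⟩⟩
    · intro v
      simp [hT3, or_comm]

/-- The set of vertices of `A` with few neighbours in a large subset `Y` of the other side of a
dense uniform pair is small. -/
lemma card_filter_lt_of_isUniform [Fintype V] {ε d : ℝ} (hε : 0 < ε) {A B X Y : Finset V}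
    (hu : G.IsUniform ε A B) (hd : d ≤ G.edgeDensity A B) (hXA : X ⊆ A) (hYB : Y ⊆ B)
    (hY : B.card * ε ≤ Y.card) (hY0 : 0 < Y.card) (hA : 0 < A.card) :
    ((X.filter fun x => ((Y.filter fun y => G.Adj x y).card : ℝ) < (d - ε) * Y.card).card : ℝ) <
      A.card * ε := by
  by_contra! h
  set X' := X.filter fun x => ((Y.filter fun y => G.Adj x y).card : ℝ) < (d - ε) * Y.card with hX'
  have h1 := hu ((filter_subset _ _).trans hXA) hYB h hY
  have hX0 : (0 : ℝ) < X'.card := lt_of_lt_of_le (by positivity) h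
  have hY0' : (0 : ℝ) < Y.card := by exact_mod_cast hY0
  have h2 : (G.edgeDensity X' Y : ℝ) < d - ε := by
    rw [edgeDensity_def]
    push_cast
    rw [div_lt_iff₀ (by positivity)]
    have e : ((G.interedges X' Y).card : ℝ) =
        ∑ x ∈ X', ((Y.filter fun y => G.Adj x y).card : ℝ) := by
      rw [interedges_def, ← Nat.cast_sum]
      congr 1
      simp only [card_filter]
      rw [sum_product]
    rw [e]
    calc _ < ∑ x ∈ X', (d - ε) * Y.card := by
          refine sum_lt_sum_of_nonempty (card_pos.1 (by exact_mod_cast hX0)) fun x hx => ?_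
          exact (mem_filter.1 hx).2
      _ = _ := by simp; ring
  have := abs_lt.1 h1
  linarith

/-- Greedy embedding of a subset of the vertices of `H` into large candidate sets inside parts
that are pairwise uniform and dense along the edges of `H`. -/
lemma exists_partial_copy [Fintype V] [Nonempty V] {ε d t : ℝ} (hε : 0 < ε) (hd0 : 0 < d)
    (hd1 : d ≤ 1) (A : α → Finset V)
    (hu : ∀ a b, H.Adj a b → G.IsUniform ε (A a) (A b) ∧ d ≤ G.edgeDensity (A a) (A b))
    (htA : ∀ a, Fintype.card α * (ε * (A a).card) < t) (ht : 1 ≤ (d / 2 - ε) * t) (ht0 : 0 < t)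
    (S : Finset α) : ∀ C : α → Finset V, (∀ a, C a ⊆ A a) →
      (∀ a ∈ S, t * (2 / d) ^ S.card ≤ (C a).card) →
      ∃ f : α → V, (∀ a ∈ S, f a ∈ C a) ∧ Set.InjOn f S ∧
        ∀ a ∈ S, ∀ b ∈ S, H.Adj a b → G.Adj (f a) (f b) := by
  have h2d : 1 ≤ 2 / d := by rw [le_div_iff₀ hd0]; linarith
  have hεd : 0 < d / 2 - ε := by
    by_contra! h
    nlinarith
  induction S using Finset.induction_on with
  | empty =>
    intro C _ _
    exact ⟨fun _ => Classical.arbitrary V, by simp, by simp, by simp⟩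
  | insert a S ha ih =>
    intro C hCA hC
    have hCt : ∀ b ∈ insert a S, t ≤ (C b).card := fun b hb =>
      le_trans (le_mul_of_one_le_right ht0.le (one_le_pow₀ h2d)) (hC b hb)
    have hCpos : ∀ b ∈ insert a S, 0 < (C b).card := fun b hb => by
      have := ht0.trans_le (hCt b hb)
      exact_mod_cast this
    have haS := mem_insert_self a S
    have hApos : 0 < (A a).card := (hCpos a haS).trans_le (card_le_card (hCA a))
    have hcardα : 1 ≤ (Fintype.card α : ℝ) := by
      exact_mod_cast Fintype.card_pos_iff.2 ⟨a⟩
    let bad : α → Finset V := fun b => (C a).filter fun x =>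
      ((C b).filter fun y => G.Adj x y).card < (d - ε) * (C b).card
    have hbad : ∀ b ∈ S.filter (H.Adj a), ((bad b).card : ℝ) ≤ (A a).card * ε := by
      intro b hb
      obtain ⟨hbS, hab⟩ := mem_filter.1 hb
      have hb' : b ∈ insert a S := mem_insert_of_mem hbS
      refine (card_filter_lt_of_isUniform hε (hu a b hab).1 (hu a b hab).2 (hCA a) (hCA b) ?_
        (hCpos b hb') hApos).le
      have h1 := hCt b hb'
      have h2 := htA b
      have : (0 : ℝ) ≤ ε * (A b).card := by positivity
      nlinarith
    have hlt : (((S.filter (H.Adj a)).biUnion bad).card : ℝ) < (C a).card := by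
      calc (((S.filter (H.Adj a)).biUnion bad).card : ℝ)
          ≤ ∑ b ∈ S.filter (H.Adj a), ((bad b).card : ℝ) := by exact_mod_cast card_biUnion_le
        _ ≤ ∑ b ∈ S.filter (H.Adj a), (A a).card * ε := sum_le_sum hbad
        _ = (S.filter (H.Adj a)).card * ((A a).card * ε) := by simp
        _ ≤ Fintype.card α * ((A a).card * ε) := by
            gcongr
            exact card_le_univ _
        _ < t := by rw [mul_comm ((A a).card : ℝ)]; exact htA a
        _ ≤ _ := hCt a haS
    obtain ⟨x, hxC, hxbad⟩ := exists_mem_notMem_of_card_lt_card (Nat.cast_lt.1 hlt)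
    have hx : ∀ b ∈ S, H.Adj a b →
        (d - ε) * (C b).card ≤ ((C b).filter fun y => G.Adj x y).card := by
      intro b hb hab
      by_contra! h
      exact hxbad (mem_biUnion.2 ⟨b, mem_filter.2 ⟨hb, hab⟩, mem_filter.2 ⟨hxC, h⟩⟩)
    let C' : α → Finset V := fun b => (C b).filter fun y => y ≠ x ∧ (H.Adj a b → G.Adj x y)
    have hC' : ∀ b ∈ S, d / 2 * (C b).card ≤ ((C' b).card : ℝ) := by
      intro b hb
      have hCb := hCt b (mem_insert_of_mem hb)
      by_cases hab : H.Adj a b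
      · have e : C' b = (C b).filter fun y => G.Adj x y := by
          refine filter_congr fun y _ => ⟨fun h => h.2 hab, fun h => ⟨h.ne', fun _ => h⟩⟩
        rw [e]
        refine le_trans ?_ (hx b hb hab)
        gcongr
        linarith
      · have e : C' b = (C b).erase x := by
          ext y
          simp [C', hab, and_comm]
        have h1 : ((C b).card : ℝ) ≤ ((C b).erase x).card + 1 := by
          have := pred_card_le_card_erase (s := C b) (a := x)
          have h2 : (C b).card ≤ ((C b).erase x).card + 1 := by omega
          exact_mod_cast h2
        rw [e]
        nlinarith
    obtain ⟨f, hf1, hf2, hf3⟩ := ih C' (fun b => (filter_subset _ _).trans (hCA b)) (by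
      intro b hb
      refine le_trans ?_ (hC' b hb)
      have := hC b (mem_insert_of_mem hb)
      rw [card_insert_of_notMem ha, pow_succ] at this
      calc t * (2 / d) ^ S.card = d / 2 * (t * ((2 / d) ^ S.card * (2 / d))) := by
            field_simp
        _ ≤ _ := by gcongr)
    have hne : ∀ b ∈ S, b ≠ a := fun b hb h => ha (h ▸ hb)
    have hfx : ∀ b ∈ S, f b ≠ x ∧ (H.Adj a b → G.Adj x (f b)) := fun b hb =>
      (mem_filter.1 (hf1 b hb)).2
    refine ⟨Function.update f a x, ?_, ?_, ?_⟩
    · intro b hb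
      rcases mem_insert.1 hb with rfl | hb
      · simpa using hxC
      · rw [Function.update_of_ne (hne b hb)]
        exact (mem_filter.1 (hf1 b hb)).1
    · intro b hb c hc hbc
      rcases mem_insert.1 (mem_coe.1 hb) with rfl | hb' <;>
        rcases mem_insert.1 (mem_coe.1 hc) with rfl | hc'
      · rfl
      · rw [Function.update_self, Function.update_of_ne (hne c hc')] at hbc
        exact absurd hbc.symm (hfx c hc').1
      · rw [Function.update_self, Function.update_of_ne (hne b hb')] at hbc
        exact absurd hbc (hfx b hb').1
      · rw [Function.update_of_ne (hne b hb'), Function.update_of_ne (hne c hc')] at hbc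
        exact hf2 hb' hc' hbc
    · intro b hb c hc hbc
      rcases mem_insert.1 hb with rfl | hb' <;> rcases mem_insert.1 hc with rfl | hc'
      · exact absurd hbc (H.loopless.irrefl _)
      · rw [Function.update_self, Function.update_of_ne (hne c hc')]
        exact (hfx c hc').2 hbc
      · rw [Function.update_self, Function.update_of_ne (hne b hb')]
        exact ((hfx b hb').2 hbc.symm).symm
      · rw [Function.update_of_ne (hne b hb'), Function.update_of_ne (hne c hc')]
        exact hf3 b hb' c hc' hbc

/-- Greedy removal of disjoint copies of `H` with prescribed multiplicities for each homomorphism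
to the reduced graph. -/
lemma exists_tileable_of_multiplicities [Fintype V] [Nonempty V] {I : Type*} [Fintype I]
    {ε d t δ L : ℝ} (hε : 0 < ε)
    (hd0 : 0 < d) (hd1 : d ≤ 1) (A : I → Finset V) (hAd : Pairwise fun i j => Disjoint (A i) (A j))
    (hL : ∀ i, L ≤ (A i).card)
    (htA : ∀ i, Fintype.card α * (ε * (A i).card) < t) (ht : 1 ≤ (d / 2 - ε) * t) (ht0 : 0 < t)
    (htL : t * (2 / d) ^ Fintype.card α ≤ δ * L) (m : ℕ) : ∀ N : (α → I) → ℕ, ∑ φ, N φ = m →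
    (∀ φ, N φ ≠ 0 → ∀ a b, H.Adj a b →
      G.IsUniform ε (A (φ a)) (A (φ b)) ∧ d ≤ G.edgeDensity (A (φ a)) (A (φ b))) →
    (∀ i, ∑ φ, (N φ : ℝ) * ((univ.filter fun a => φ a = i).card : ℝ) ≤ (1 - δ) * L) →
    ∃ S : Finset V, Tileable H G S ∧ S.card = Fintype.card α * m ∧
      ∀ i, (S ∩ A i).card = ∑ φ, N φ * (univ.filter fun a => φ a = i).card := by
  induction m with
  | zero =>
    intro N hN _ _
    have : ∀ φ, N φ = 0 := fun φ => (sum_eq_zero_iff.1 hN) φ (mem_univ φ)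
    exact ⟨∅, Tileable.empty, by simp, by simp [this]⟩
  | succ m ih =>
    intro N hN hNu hNL
    obtain ⟨φ, -, hφ⟩ : ∃ φ ∈ univ, N φ ≠ 0 := exists_ne_zero_of_sum_ne_zero (by omega)
    obtain ⟨N', hN'⟩ : ∃ N' : (α → I) → ℕ, ∀ ψ, N ψ = N' ψ + if ψ = φ then 1 else 0 := by
      refine ⟨fun ψ => N ψ - if ψ = φ then 1 else 0, fun ψ => ?_⟩
      dsimp only
      split_ifs with h
      · subst h; omega
      · omega
    have hsum : ∀ f : (α → I) → ℕ, ∑ ψ, N ψ * f ψ = ∑ ψ, N' ψ * f ψ + f φ := by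
      intro f
      simp [hN', add_mul, sum_add_distrib]
    have hle : ∀ ψ, N' ψ ≤ N ψ := fun ψ => by rw [hN' ψ]; omega
    have hNL' : ∀ i, ∑ φ, (N' φ : ℝ) * ((univ.filter fun a => φ a = i).card : ℝ) ≤
        (1 - δ) * L := fun i => by
      refine le_trans (sum_le_sum fun ψ _ => ?_) (hNL i)
      gcongr
      exact_mod_cast hle ψ
    obtain ⟨S, hS, hScard, hSA⟩ := ih N' (by
      have := hsum fun _ => 1
      simp only [mul_one] at this
      omega) (fun ψ hψ => hNu ψ (by have := hle ψ; omega)) hNL'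
    have hCsize : ∀ i, δ * L ≤ ((A i \ S).card : ℝ) := by
      intro i
      have h1 : ((S ∩ A i).card : ℝ) ≤ (1 - δ) * L := by
        rw [hSA i]; push_cast; exact hNL' i
      have h2 : ((A i \ S).card : ℝ) + (S ∩ A i).card = (A i).card := by
        rw [inter_comm]; exact_mod_cast card_sdiff_add_card_inter (A i) S
      have := hL i
      linarith
    obtain ⟨f, hf1, hf2, hf3⟩ := exists_partial_copy (H := H) (G := G) hε hd0 hd1 (fun a => A (φ a))
      (fun a b hab => hNu φ hφ a b hab) (fun a => htA (φ a)) ht ht0 univ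
      (fun a => A (φ a) \ S) (fun a => sdiff_subset) (fun a _ => by
        rw [card_univ]; exact htL.trans (hCsize _))
    have hfinj : Function.Injective f := fun a b h => hf2 (by simp) (by simp) h
    have hcopy : IsCopy H G f := ⟨hfinj, fun a b hab => hf3 a (mem_univ _) b (mem_univ _) hab⟩
    have hfA : ∀ a, f a ∈ A (φ a) := fun a => (mem_sdiff.1 (hf1 a (mem_univ a))).1
    have hdis : Disjoint S (univ.image f) := by
      rw [disjoint_right]
      intro v hv
      obtain ⟨a, -, rfl⟩ := mem_image.1 hv
      exact (mem_sdiff.1 (hf1 a (mem_univ a))).2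
    refine ⟨S ∪ univ.image f, hS.union_image hcopy hdis, ?_, fun i => ?_⟩
    · rw [card_union_of_disjoint hdis, hScard, card_image_of_injective _ hfinj, card_univ]; ring
    · rw [union_inter_distrib_right, card_union_of_disjoint
        (hdis.mono inter_subset_left inter_subset_left), hSA i, hsum]
      congr 1
      have : univ.image f ∩ A i = (univ.filter fun a => φ a = i).image f := by
        ext v
        simp only [mem_inter, mem_image, mem_univ, true_and, mem_filter]
        constructor
        · rintro ⟨⟨a, rfl⟩, hv⟩
          refine ⟨a, ?_, rfl⟩
          by_contra h
          exact disjoint_left.1 (hAd h) (hfA a) hv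
        · rintro ⟨a, rfl, rfl⟩
          exact ⟨⟨a, rfl⟩, hfA a⟩
      rw [this, card_image_of_injective _ hfinj]

end Embedding

section ReducedGraph
open scoped Classical

variable {V I : Type*} {G : SimpleGraph V}

lemma sum_card_filter_adj (X Y : Finset V) :
    ∑ x ∈ X, ((Y.filter fun y => G.Adj x y).card : ℝ) = G.edgeDensity X Y * (X.card * Y.card) := by
  have e : ((G.interedges X Y).card : ℝ) = ∑ x ∈ X, ((Y.filter fun y => G.Adj x y).card : ℝ) := by
    rw [interedges_def, ← Nat.cast_sum]
    congr 1
    simp only [card_filter]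
    rw [sum_product]
  rw [← e, edgeDensity_def]
  push_cast
  by_cases h : (X.card : ℝ) * Y.card = 0
  · have h0 : G.interedges X Y = ∅ := by
      rcases mul_eq_zero.1 h with h | h <;>
        simp [interedges_def, card_eq_zero.1 (Nat.cast_eq_zero.1 h)]
    rw [h0]; simp
  · rw [div_mul_cancel₀ _ h]

/-- Most vertices of a part have few neighbours in the parts to which its density is small. -/
lemma card_filter_sparse [Fintype V] {A : I → Finset V}
    (hAd : Pairwise fun i j => Disjoint (A i) (A j))
    {ζ : ℝ} (hζ : 0 < ζ) (X : Finset V) (J : Finset I)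
    (hJ : ∀ j ∈ J, (G.edgeDensity X (A j) : ℝ) ≤ ζ ^ 2) :
    (1 - ζ) * X.card ≤ ((X.filter fun x =>
      (((J.biUnion A).filter fun y => G.Adj x y).card : ℝ) ≤ ζ * Fintype.card V).card : ℝ) := by
  have hU : (J.biUnion A).card = ∑ j ∈ J, (A j).card :=
    card_biUnion fun i _ j _ hij => hAd hij
  have hUn : ((J.biUnion A).card : ℝ) ≤ Fintype.card V := by exact_mod_cast card_le_univ _
  have h1 : ∑ x ∈ X, (((J.biUnion A).filter fun y => G.Adj x y).card : ℝ) ≤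
      ζ ^ 2 * (X.card * Fintype.card V) := by
    calc _ = ∑ x ∈ X, ∑ j ∈ J, (((A j).filter fun y => G.Adj x y).card : ℝ) := by
          refine sum_congr rfl fun x _ => ?_
          rw [filter_biUnion, card_biUnion]
          · push_cast; rfl
          · exact fun i _ j _ hij => (hAd hij).mono (filter_subset _ _) (filter_subset _ _)
      _ = ∑ j ∈ J, G.edgeDensity X (A j) * ((X.card : ℝ) * (A j).card) := by
          rw [sum_comm]
          exact sum_congr rfl fun j _ => sum_card_filter_adj X (A j)
      _ ≤ ∑ j ∈ J, ζ ^ 2 * ((X.card : ℝ) * (A j).card) := by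
          refine sum_le_sum fun j hj => ?_
          have := hJ j hj
          gcongr
      _ = ζ ^ 2 * (X.card * (J.biUnion A).card) := by
          rw [hU, ← mul_sum, ← mul_sum]; push_cast; rfl
      _ ≤ _ := by gcongr
  set Y := X.filter fun x =>
      (((J.biUnion A).filter fun y => G.Adj x y).card : ℝ) ≤ ζ * Fintype.card V with hY
  set Y' := X.filter fun x =>
      ¬ (((J.biUnion A).filter fun y => G.Adj x y).card : ℝ) ≤ ζ * Fintype.card V with hY'
  have h2 : (Y.card : ℝ) + Y'.card = X.card := by
    exact_mod_cast card_filter_add_card_filter_not _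
  have h3 : (Y'.card : ℝ) * (ζ * Fintype.card V) ≤ ζ ^ 2 * (X.card * Fintype.card V) := by
    refine le_trans ?_ h1
    calc (Y'.card : ℝ) * (ζ * Fintype.card V) = ∑ x ∈ Y', ζ * Fintype.card V := by simp
      _ ≤ ∑ x ∈ Y', (((J.biUnion A).filter fun y => G.Adj x y).card : ℝ) :=
          sum_le_sum fun x hx => (not_le.1 (mem_filter.1 hx).2).le
      _ ≤ _ := sum_le_sum_of_subset_of_nonneg (filter_subset _ _) fun _ _ _ => by positivity
  by_cases hX : X.card = 0
  · simp [hX]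
  have hV : (0 : ℝ) < Fintype.card V := by
    have : X.card ≤ Fintype.card V := card_le_univ X
    exact_mod_cast (by omega : 0 < Fintype.card V)
  have h4 : (Y'.card : ℝ) ≤ ζ * X.card := by
    have h5 : (Y'.card : ℝ) * (ζ * Fintype.card V) ≤ ζ * X.card * (ζ * Fintype.card V) := by
      linarith
    exact le_of_mul_le_mul_right h5 (by positivity)
  linarith

/-- The reduced graph inherits the degree condition. -/
lemma degCond_reduced [Fintype V] [Fintype I] {w s η ζ L : ℝ} (hs : 0 < s) (hsw : s < w)
    (hws : w + s ≤ 1)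
    (hζ : 0 < ζ) (hζη : 16 * ζ ≤ η) (hζ1 : ζ < 1) (hG : DegCond G w s η) {A : I → Finset V}
    (hAd : Pairwise fun i j => Disjoint (A i) (A j)) (hL0 : 0 < L) (hL : ∀ i, L ≤ (A i).card)
    (hLI : (1 - 2 * ζ) * Fintype.card V ≤ L * Fintype.card I) {R : SimpleGraph I}
    (hR : ∀ i, L * ((univ.filter fun j => ¬ R.Adj i j ∧
      ζ ^ 2 ≤ G.edgeDensity (A i) (A j)).card : ℝ) ≤ 2 * ζ * Fintype.card V) :
    DegCond R w s (η / 2) := by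
  intro Z hZ
  have hw : 0 < w := hs.trans hsw
  let J : I → Finset I := fun i => univ.filter fun j => G.edgeDensity (A i) (A j) < ζ ^ 2
  let typ : I → Finset V := fun i => (A i).filter fun x =>
      ((((J i).biUnion A).filter fun y => G.Adj x y).card : ℝ) ≤ ζ * Fintype.card V
  have htyp : ∀ i, (1 - ζ) * (A i).card ≤ ((typ i).card : ℝ) := fun i =>
    card_filter_sparse hAd hζ (A i) (J i) fun j hj => (mem_filter.1 hj).2.le
  have hbig : ∀ K : Finset I, L * K.card ≤ ((K.biUnion A).card : ℝ) := by
    intro K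
    rw [card_biUnion fun i _ j _ hij => hAd hij]
    push_cast
    calc L * K.card = ∑ i ∈ K, L := by simp; ring
      _ ≤ _ := sum_le_sum fun i _ => hL i
  have hle : ∀ K : Finset I, L * (K.card : ℝ) ≤ Fintype.card V := fun K =>
    (hbig K).trans (by exact_mod_cast card_le_univ _)
  set n : ℝ := (Fintype.card V : ℝ) with hn
  have hZt : (1 - ζ) * (L * Z.card) ≤ ((Z.biUnion typ).card : ℝ) := by
    rw [card_biUnion fun i _ j _ hij => (hAd hij).mono (filter_subset _ _) (filter_subset _ _)]
    push_cast
    calc (1 - ζ) * (L * Z.card) = ∑ i ∈ Z, (1 - ζ) * L := by simp; ring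
      _ ≤ _ := sum_le_sum fun i _ => le_trans
        (mul_le_mul_of_nonneg_left (hL i) (by linarith)) (htyp i)
  have hZpos : (0 : ℝ) < Z.card := by exact_mod_cast hZ.card_pos
  obtain ⟨x, hx, hxn⟩ := hG (Z.biUnion typ) (card_pos.1 (by
    have h : (0 : ℝ) < (Z.biUnion typ).card :=
      lt_of_lt_of_le (mul_pos (by linarith) (mul_pos hL0 hZpos)) hZt
    exact_mod_cast h))
  obtain ⟨i, hiZ, hxi⟩ := mem_biUnion.1 hx
  refine ⟨i, hiZ, ?_⟩
  have h1 : L * (nonNbr R i : ℝ) ≤ nonNbr G x + 3 * ζ * n := by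
    have e1 : nonNbr R i ≤ (univ.filter fun j => ¬ R.Adj i j ∧
        ζ ^ 2 ≤ G.edgeDensity (A i) (A j)).card + (J i).card := by
      unfold nonNbr
      rw [← card_union_of_disjoint]
      · refine card_le_card fun j hj => ?_
        simp only [J, mem_union, mem_filter, mem_univ, true_and] at hj ⊢
        rcases lt_or_ge ((G.edgeDensity (A i) (A j) : ℚ) : ℝ) (ζ ^ 2) with h | h
        · exact Or.inr h
        · exact Or.inl ⟨hj, h⟩
      · refine disjoint_left.2 fun j hj hj' => ?_
        simp only [J, mem_filter, mem_univ, true_and] at hj hj'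
        exact absurd hj.2 (not_le.2 hj')
    have e2 : (((J i).biUnion A).card : ℝ) ≤ nonNbr G x + ζ * n := by
      have h2 : (((J i).biUnion A).filter fun y => ¬ G.Adj x y).card ≤ nonNbr G x :=
        card_le_card (filter_subset_filter _ (subset_univ _))
      have h3 := (mem_filter.1 hxi).2
      have h4 : ((((J i).biUnion A).filter fun y => G.Adj x y).card : ℝ) +
        (((J i).biUnion A).filter fun y => ¬ G.Adj x y).card = ((J i).biUnion A).card := by
        exact_mod_cast card_filter_add_card_filter_not _
      have h5 : ((((J i).biUnion A).filter fun y => ¬ G.Adj x y).card : ℝ) ≤ nonNbr G x := by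
        exact_mod_cast h2
      linarith
    have e3 : L * (nonNbr R i : ℝ) ≤ L * ((univ.filter fun j => ¬ R.Adj i j ∧
        ζ ^ 2 ≤ G.edgeDensity (A i) (A j)).card : ℝ) + L * (J i).card := by
      rw [← mul_add]
      gcongr
      exact_mod_cast e1
    have := hR i
    have := hbig (J i)
    linarith
  set k : ℝ := (Fintype.card I : ℝ) with hk
  have hkn : L * k ≤ n := by simpa [hk] using hle univ
  have h2 : L * min k (Z.card / w) ≤ min n ((Z.biUnion typ).card / w) + ζ * n / w := by
    have hn0 : 0 ≤ ζ * n / w := by positivity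
    rw [← min_add_add_right]
    refine le_min ?_ ?_
    · have : L * min k (Z.card / w) ≤ L * k := by gcongr; exact min_le_left _ _
      linarith
    · have h3 : L * min k (Z.card / w) ≤ L * (Z.card / w) := by gcongr; exact min_le_right _ _
      refine h3.trans ?_
      rw [← add_div, ← mul_div_assoc]
      gcongr
      have := hle Z
      nlinarith
  have h3 : s * (ζ * n / w) ≤ ζ * n := by
    rw [← mul_div_assoc, div_le_iff₀ hw]
    have : 0 ≤ ζ * n := by positivity
    nlinarith
  have h4 : s * (L * min k (Z.card / w)) ≤ s * min n ((Z.biUnion typ).card / w) +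
      s * (ζ * n / w) := by
    rw [← mul_add]; gcongr
  have h5 : L * ((nonNbr R i : ℝ) + s * min k (Z.card / w)) ≤ L * ((w + s - η / 2) * k) := by
    have hη : 0 < η := by linarith
    have h6 : (w + s - η + 4 * ζ) * n ≤ (w + s - η / 2) * (L * k) := by
      have hn0 : 0 ≤ n := by positivity
      have h7 : 0 ≤ n - L * k := by linarith
      have h8 : (w + s - η / 2) * (n - L * k) ≤ 2 * ζ * n := by
        have : (w + s - η / 2) * (n - L * k) ≤ 1 * (n - L * k) := by
          gcongr; linarith
        linarith
      nlinarith
    linarith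
  exact le_of_mul_le_mul_left h5 hL0

end ReducedGraph

section AlmostTiling
open scoped Classical

/-- The regularity lemma, keeping only the parts that form few irregular pairs. -/
lemma exists_regular_parts {ζ ε : ℝ} (hζ : 0 < ζ) (hε : 0 < ε) (hεζ : ε ≤ ζ ^ 2) (hζ1 : ζ < 1) :
    ∃ K : ℕ, 0 < K ∧ ∀ (V : Type u) [Fintype V] (G : SimpleGraph V),
      (K : ℝ) ≤ ζ * Fintype.card V → ∃ (I : Finset (Finset V)) (L : ℕ),
      (∀ X ∈ I, L ≤ X.card ∧ X.card ≤ L + 1) ∧ (∀ X ∈ I, ∀ Y ∈ I, X ≠ Y → Disjoint X Y) ∧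
      (1 - 2 * ζ) * Fintype.card V ≤ L * I.card ∧ I.card ≤ K ∧ Fintype.card V ≤ 2 * K * L ∧
      ∀ X : I, L * ((univ.filter fun Y : I => X = Y ∨ ¬ G.IsUniform ε X.1 Y.1).card : ℝ) ≤
        2 * ζ * Fintype.card V := by
  set l : ℕ := ⌈1 / ζ⌉₊ with hl
  set K := SzemerediRegularity.bound ε l with hK
  have hlK : l ≤ K := SzemerediRegularity.le_bound ε l
  have hK0 : 0 < K := SzemerediRegularity.bound_pos ε l
  refine ⟨K, hK0, fun V _ G hV => ?_⟩
  have hn0 : 0 ≤ (Fintype.card V : ℝ) := by positivity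
  have hKn : K ≤ Fintype.card V := by
    have : (K : ℝ) ≤ Fintype.card V := by nlinarith
    exact_mod_cast this
  obtain ⟨P, hPe, hPl, hPK, hPu⟩ := szemeredi_regularity G hε (hlK.trans hKn)
  set n := Fintype.card V with hn
  set k := P.parts.card with hk
  have hlζ : 1 / ζ ≤ l := Nat.le_ceil _
  have hk1 : 1 ≤ ζ * k := by
    have : 1 / ζ ≤ k := hlζ.trans (by exact_mod_cast hPl)
    rwa [div_le_iff₀ hζ, mul_comm] at this
  have hk0 : 0 < k := by
    by_contra! h
    have : k = 0 := by omega
    rw [this] at hk1; simp at hk1; linarith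
  set L := n / k with hL
  have hkL : k * L ≤ n := Nat.mul_div_le n k
  have hkL' : n < k * (L + 1) := by
    have := Nat.lt_mul_div_succ n hk0
    simpa using this
  have hL1 : 1 ≤ L := (Nat.one_le_div_iff hk0).2 (hPK.trans hKn)
  have hpart : ∀ X ∈ P.parts, L ≤ X.card ∧ X.card ≤ L + 1 := fun X hX =>
    ⟨by simpa using hPe.average_le_card_part hX, by simpa using hPe.card_part_le_average_add_one hX⟩
  let irr : Finset V → Finset (Finset V) := fun X =>
    P.parts.filter fun Y => X ≠ Y ∧ ¬ G.IsUniform ε X Y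
  have hirr : ∑ X ∈ P.parts, ((irr X).card : ℝ) ≤ ζ ^ 2 * k ^ 2 := by
    have e : ∑ X ∈ P.parts, (irr X).card = (P.nonUniforms G ε).card := by
      rw [← card_sigma]
      refine card_bij (fun x _ => (x.1, x.2)) ?_ ?_ ?_
      · rintro ⟨X, Y⟩ h
        simp only [mem_sigma, irr, mem_filter] at h
        exact (P.mk_mem_nonUniforms G).2 ⟨h.1, h.2.1, h.2.2.1, h.2.2.2⟩
      · rintro ⟨X, Y⟩ _ ⟨X', Y'⟩ _ h
        simp only [Prod.mk.injEq] at h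
        obtain ⟨rfl, rfl⟩ := h
        rfl
      · rintro ⟨X, Y⟩ h
        rw [P.mk_mem_nonUniforms G] at h
        exact ⟨⟨X, Y⟩, by simp [irr, h], rfl⟩
    have e2 : ((k * (k - 1) : ℕ) : ℝ) ≤ (k : ℝ) ^ 2 := by
      rw [pow_two]
      exact_mod_cast Nat.mul_le_mul_left k (Nat.sub_le k 1)
    calc ∑ X ∈ P.parts, ((irr X).card : ℝ) = ((P.nonUniforms G ε).card : ℝ) := by
          exact_mod_cast e
      _ ≤ ((k * (k - 1) : ℕ) : ℝ) * ε := hPu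
      _ ≤ (k : ℝ) ^ 2 * ζ ^ 2 := by gcongr
      _ = _ := by ring
  let I := P.parts.filter fun X => ((irr X).card : ℝ) ≤ ζ * k
  have hIcard : (1 - ζ) * k ≤ (I.card : ℝ) := by
    set B := P.parts.filter fun X => ¬ ((irr X).card : ℝ) ≤ ζ * k with hB
    have h1 : (I.card : ℝ) + B.card = k := by exact_mod_cast card_filter_add_card_filter_not _
    have h2 : (B.card : ℝ) * (ζ * k) ≤ ζ ^ 2 * k ^ 2 := by
      refine le_trans ?_ hirr
      calc (B.card : ℝ) * (ζ * k) = ∑ X ∈ B, ζ * k := by simp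
        _ ≤ ∑ X ∈ B, ((irr X).card : ℝ) :=
          sum_le_sum fun X hX => (not_le.1 (mem_filter.1 hX).2).le
        _ ≤ _ := sum_le_sum_of_subset_of_nonneg (filter_subset _ _) fun _ _ _ => by positivity
    have h3 : (B.card : ℝ) ≤ ζ * k := by
      refine le_of_mul_le_mul_right (a := ζ * k) ?_ (by linarith)
      linarith
    linarith
  have hkLr : (k : ℝ) * L ≤ n := by exact_mod_cast hkL
  have hkLr' : (n : ℝ) ≤ k * (L + 1) := by exact_mod_cast hkL'.le
  have hkK : (k : ℝ) ≤ K := by exact_mod_cast hPK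
  refine ⟨I, L, fun X hX => hpart X (mem_filter.1 hX).1, fun X hX Y hY hXY =>
    P.disjoint (mem_filter.1 hX).1 (mem_filter.1 hY).1 hXY, ?_,
    (card_le_card (filter_subset _ _)).trans hPK, ?_, ?_⟩
  · have h1 : (1 - ζ) * n ≤ k * L := by linarith
    have h2 : (1 - ζ) * (k * L) ≤ L * I.card := by
      have : (L : ℝ) * ((1 - ζ) * k) ≤ L * I.card := by gcongr
      linarith
    have h3 : (1 - ζ) * ((1 - ζ) * n) ≤ (1 - ζ) * (k * L) := by
      gcongr
    nlinarith [mul_nonneg (sq_nonneg ζ) hn0]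
  · calc n ≤ k * (L + 1) := hkL'.le
      _ ≤ K * (2 * L) := Nat.mul_le_mul hPK (by omega)
      _ = _ := by ring
  · rintro ⟨X, hX⟩
    have h1 : (univ.filter fun Y : I => (⟨X, hX⟩ : I) = Y ∨ ¬ G.IsUniform ε X Y.1).card ≤
        (irr X).card + 1 := by
      refine le_trans (card_le_card_of_injOn (t := insert X (irr X)) Subtype.val ?_
        (Subtype.val_injective.injOn)) (card_insert_le _ _)
      rintro ⟨Y, hY⟩ h
      simp only [coe_filter, mem_univ, true_and, Set.mem_ofPred_eq, Subtype.mk.injEq] at h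
      rw [mem_coe, mem_insert]
      by_cases hXY : X = Y
      · exact Or.inl hXY.symm
      · exact Or.inr (mem_filter.2 ⟨(mem_filter.1 hY).1, hXY, h.resolve_left hXY⟩)
    have h2 := (mem_filter.1 hX).2
    have h3 : ((univ.filter fun Y : I => (⟨X, hX⟩ : I) = Y ∨ ¬ G.IsUniform ε X Y.1).card : ℝ) ≤
        ζ * k + ζ * k := by
      have : ((univ.filter fun Y : I => (⟨X, hX⟩ : I) = Y ∨ ¬ G.IsUniform ε X Y.1).card : ℝ) ≤
        (irr X).card + 1 := by exact_mod_cast h1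
      linarith
    calc _ ≤ (L : ℝ) * (ζ * k + ζ * k) := by gcongr
      _ = 2 * ζ * (k * L) := by ring
      _ ≤ _ := by gcongr

variable {α : Type*} [Fintype α] {H : SimpleGraph α} {q : ℕ}

/-- The degree condition forces a tiling covering all but a small proportion of the vertices. -/
lemma exists_almost_tiling (hq : q ≠ 0) (c : H.Coloring (Fin (q + 1)))
    {σ : ℝ} (hσ0 : 0 < σ)
    (hx : ((univ.filter fun a => c a = 0).card : ℝ) ≤ σ) (hσ : σ < Fintype.card α / (q + 1))
    {w s : ℝ} (hs : s = σ / Fintype.card α) (hsw : s + q * w = 1) (hslt : s < w)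
    {η ε₀ : ℝ} (hη : 0 < η) (hε₀ : 0 < ε₀) :
    ∃ n₀ : ℕ, ∀ (V : Type u) [Fintype V] (G : SimpleGraph V), n₀ ≤ Fintype.card V →
      DegCond G w s η → ∃ S : Finset V, Tileable H G S ∧
        (Fintype.card V : ℝ) - S.card ≤ ε₀ * Fintype.card V := by
  set h : ℕ := Fintype.card α with hh
  have hh0 : 0 < h := by
    by_contra! h0
    have : h = 0 := by omega
    rw [this] at hσ; simp at hσ; linarith
  have hs0 : 0 < s := by rw [hs]; positivity
  have hw0 : 0 < w := hs0.trans hslt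
  have hws : w + s ≤ 1 := by
    have : (1 : ℝ) ≤ q := by exact_mod_cast Nat.one_le_iff_ne_zero.2 hq
    nlinarith
  set ζ : ℝ := min (min (η / 16) (ε₀ / 5)) (1 / 4) with hζdef
  have hζ : 0 < ζ := by positivity
  have hζη : 16 * ζ ≤ η := by
    have : ζ ≤ η / 16 := (min_le_left _ _).trans (min_le_left _ _)
    linarith
  have hζε : 5 * ζ ≤ ε₀ := by
    have : ζ ≤ ε₀ / 5 := (min_le_left _ _).trans (min_le_right _ _)
    linarith
  have hζ4 : ζ ≤ 1 / 4 := min_le_right _ _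
  set d : ℝ := ζ ^ 2 with hd
  have hd0 : 0 < d := by positivity
  have hd1 : d ≤ 1 := by nlinarith
  set κ : ℝ := ζ * (d / 2) ^ h with hκ
  have hκ0 : 0 < κ := by positivity
  set ε : ℝ := min (d / 4) (κ / (4 * h)) with hε
  have hε0 : 0 < ε := by positivity
  have hεd : ε ≤ d / 4 := min_le_left _ _
  have hεκ : 4 * h * ε ≤ κ := by
    have : ε ≤ κ / (4 * h) := min_le_right _ _
    rwa [le_div_iff₀ (by positivity), mul_comm] at this
  obtain ⟨K, hK0, hK⟩ := exists_regular_parts.{u} hζ hε0 (by linarith : ε ≤ ζ ^ 2) (by linarith)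
  set n₀ : ℕ := ⌈K / ζ⌉₊ + 2 * K * ⌈4 / (d * κ)⌉₊ + ⌈h * (K : ℝ) ^ h / ζ⌉₊ + 1 with hn₀
  refine ⟨n₀, fun V _ G hV hG => ?_⟩
  set n := Fintype.card V with hn
  have hn1 : (K : ℝ) ≤ ζ * n := by
    have h1 : K / ζ ≤ n := (Nat.le_ceil _).trans (by exact_mod_cast (by omega : ⌈K / ζ⌉₊ ≤ n))
    rwa [div_le_iff₀ hζ, mul_comm] at h1
  have hn3 : h * (K : ℝ) ^ h ≤ ζ * n := by
    have h1 : h * (K : ℝ) ^ h / ζ ≤ n :=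
      (Nat.le_ceil _).trans (by exact_mod_cast (by omega : ⌈h * (K : ℝ) ^ h / ζ⌉₊ ≤ n))
    rw [div_le_iff₀ hζ] at h1
    linarith
  have hVne : Nonempty V := Fintype.card_pos_iff.1 (by omega)
  obtain ⟨I, L, hIL, hId, hIn, hIK, hnKL, hIirr⟩ := hK V G hn1
  have hL4 : 4 / (d * κ) ≤ L := by
    refine (Nat.le_ceil _).trans ?_
    have h1 : 2 * K * ⌈4 / (d * κ)⌉₊ ≤ 2 * K * L := by omega
    exact_mod_cast Nat.le_of_mul_le_mul_left h1 (by omega)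
  have hL0 : (0 : ℝ) < L := lt_of_lt_of_le (by positivity) hL4
  have hL1 : (1 : ℝ) ≤ L := by exact_mod_cast hL0
  have hLd : 1 ≤ d / 4 * (κ * L) := by
    rw [div_le_iff₀ (by positivity)] at hL4
    nlinarith
  let A : I → Finset V := Subtype.val
  have hAd : Pairwise fun i j => Disjoint (A i) (A j) := fun i j hij =>
    hId i i.2 j j.2 fun h => hij (Subtype.ext h)
  have hAL : ∀ i, (L : ℝ) ≤ (A i).card := fun i => by exact_mod_cast (hIL i i.2).1
  let R : SimpleGraph I :=
    { Adj := fun X Y => X ≠ Y ∧ G.IsUniform ε X.1 Y.1 ∧ d ≤ G.edgeDensity X.1 Y.1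
      symm := ⟨fun X Y h => ⟨h.1.symm, h.2.1.symm, by rw [edgeDensity_comm]; exact h.2.2⟩⟩
      loopless := ⟨fun X h => h.1 rfl⟩ }
  have hRdeg : DegCond R w s (η / 2) := by
    refine degCond_reduced hs0 hslt hws hζ hζη (by linarith) hG hAd hL0 hAL ?_ ?_
    · simpa using hIn
    · intro i
      refine le_trans ?_ (hIirr i)
      gcongr
      rintro hj
      by_contra hcon
      rw [not_or, not_not] at hcon
      exact hj.1 ⟨hcon.1, hcon.2, hj.2⟩
  set k := Fintype.card I with hk
  have hkI : k = I.card := Fintype.card_coe I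
  have hkpos : (0 : ℝ) < k := by
    rw [hkI]
    by_contra! h0
    have : (0 : ℝ) < n := by exact_mod_cast Fintype.card_pos
    nlinarith
  obtain ⟨W, hW0, hWR, hW1, hWtot⟩ := exists_fractional_tiling hq c hσ0 hx hσ hs hsw R
    (ε := ζ * k) (mul_pos hζ hkpos) hRdeg (by
      have h1 : (w + s) * (ζ * k) ≤ 1 * (ζ * k) := by gcongr
      have h2 : ζ * k < η / 2 * k := by gcongr; linarith
      linarith)
  let N : (α → I) → ℕ := fun φ => ⌊(1 - ζ) * L * W φ⌋₊
  have hNle : ∀ φ, (N φ : ℝ) ≤ (1 - ζ) * L * W φ := fun φ =>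
    Nat.floor_le (mul_nonneg (mul_nonneg (by linarith) hL0.le) (hW0 φ))
  obtain ⟨S, hS, hScard, -⟩ := exists_tileable_of_multiplicities (H := H) (G := G)
    (t := κ * L) (δ := ζ) (L := L) hε0 hd0 hd1 A hAd
    hAL (fun i => by
      have h1 : ((A i).card : ℝ) ≤ 2 * L := by
        have : ((A i).card : ℝ) ≤ L + 1 := by exact_mod_cast (hIL i i.2).2
        linarith
      calc (h : ℝ) * (ε * (A i).card) ≤ h * (ε * (2 * L)) := by gcongr
        _ = (4 * h * ε) * (L / 2) := by ring
        _ ≤ κ * (L / 2) := by gcongr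
        _ < κ * L := by gcongr; linarith)
    (hLd.trans (by gcongr; linarith)) (by positivity) (by
      rw [hκ]
      have : (d / 2) ^ h * (2 / d) ^ h = 1 := by
        rw [← mul_pow]; field_simp; simp
      calc ζ * (d / 2) ^ h * L * (2 / d) ^ h = ζ * L * ((d / 2) ^ h * (2 / d) ^ h) := by ring
        _ ≤ _ := by rw [this, mul_one]) _ N rfl (fun φ hφ a b hab => by
      have h1 : W φ ≠ 0 := fun h0 => hφ (by simp [N, h0])
      exact (hWR φ h1 a b hab).2) (fun i => by
      refine le_trans (sum_le_sum fun φ _ =>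
        mul_le_mul_of_nonneg_right (hNle φ) (Nat.cast_nonneg _)) ?_
      simp only [mul_assoc, ← mul_sum]
      refine mul_le_mul_of_nonneg_left (mul_le_of_le_one_right hL0.le ?_) (by linarith)
      convert hW1 i)
  refine ⟨S, hS, ?_⟩
  have hsum : (1 - ζ) * L * ∑ φ, W φ ≤ (∑ φ, N φ : ℕ) + (K : ℝ) ^ h := by
    have h1 : ∀ φ, (1 - ζ) * L * W φ ≤ N φ + 1 := fun φ => (Nat.lt_floor_add_one _).le
    calc _ = ∑ φ, (1 - ζ) * L * W φ := by rw [mul_sum]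
      _ ≤ ∑ φ, ((N φ : ℝ) + 1) := sum_le_sum fun φ _ => h1 φ
      _ = (∑ φ, N φ : ℕ) + (k : ℝ) ^ h := by
          rw [sum_add_distrib]; simp [hk, hh]
      _ ≤ _ := by
          gcongr
          rw [hkI]; exact hIK
  have hn0 : (0 : ℝ) ≤ n := by positivity
  have hkL : (1 - 2 * ζ) * n ≤ L * k := by rw [hkI]; exact hIn
  have hS' : (S.card : ℝ) = h * (∑ φ, N φ : ℕ) := by rw [hScard]; push_cast; rfl
  have h1 : (1 - ζ) * L * ((k : ℝ) - ζ * k) ≤ (1 - ζ) * L * (h * ∑ φ, W φ) := by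
    have : (0 : ℝ) ≤ 1 - ζ := by linarith
    gcongr
  have h2 : (h : ℝ) * ((1 - ζ) * L * ∑ φ, W φ) ≤ h * ((∑ φ, N φ : ℕ) + (K : ℝ) ^ h) := by gcongr
  have h3 : (1 - ζ) * (1 - ζ) * ((1 - 2 * ζ) * n) ≤ (1 - ζ) * (1 - ζ) * (L * k) := by
    have : (0 : ℝ) ≤ 1 - ζ := by linarith
    gcongr
  have h4 : (1 - 4 * ζ) ≤ (1 - ζ) * (1 - ζ) * (1 - 2 * ζ) := by
    have := mul_nonneg (sq_nonneg ζ) (by linarith : 0 ≤ 5 - 2 * ζ)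
    linarith
  have h5 : (1 - 4 * ζ) * n ≤ (1 - ζ) * (1 - ζ) * (1 - 2 * ζ) * n :=
    mul_le_mul_of_nonneg_right h4 hn0
  have h6 : 5 * ζ * n ≤ ε₀ * n := mul_le_mul_of_nonneg_right hζε hn0
  rw [hS']
  linarith

end AlmostTiling

section CliqueCounting
open scoped Classical

lemma mul_le_card_filter_prod {A B : Type*} [Fintype A] [Fintype B] {P : A → Prop}
    {Q : A → B → Prop} {p q : ℝ} (hq0 : 0 ≤ q) (hp : p ≤ (univ.filter P).card)
    (hq : ∀ a, P a → q ≤ (univ.filter (Q a)).card) :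
    p * q ≤ (univ.filter fun x : A × B => P x.1 ∧ Q x.1 x.2).card := by
  have h1 : (univ.filter fun x : A × B => P x.1 ∧ Q x.1 x.2).card =
      ∑ a ∈ univ.filter P, (univ.filter (Q a)).card := by
    rw [← card_sigma]
    refine card_bij' (fun x _ => ⟨x.1, x.2⟩) (fun x _ => (x.1, x.2)) ?_ ?_ ?_ ?_ <;> simp
  rw [h1]
  push_cast
  calc p * q ≤ ((univ.filter P).card : ℝ) * q := mul_le_mul_of_nonneg_right hp hq0
    _ = ∑ a ∈ univ.filter P, q := by simp
    _ ≤ _ := sum_le_sum fun a ha => hq a (by simpa using ha)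

lemma mul_le_card_filter_equiv {A B C : Type*} [Fintype A] [Fintype B] [Fintype C] (e : C ≃ A × B)
    {P : A → Prop} {Q : A → B → Prop} {R : C → Prop} {p q : ℝ} (hq0 : 0 ≤ q)
    (hp : p ≤ (univ.filter P).card) (hq : ∀ a, P a → q ≤ (univ.filter (Q a)).card)
    (hR : ∀ x, P (e x).1 → Q (e x).1 (e x).2 → R x) :
    p * q ≤ (univ.filter R).card := by
  refine (mul_le_card_filter_prod hq0 hp hq).trans ?_
  exact_mod_cast card_le_card_of_injOn e.symm (fun x hx => by
    have := hR (e.symm x)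
    simp only [coe_filter, Set.mem_ofPred_eq, mem_univ, true_and, Equiv.apply_symm_apply]
      at hx this ⊢
    exact this hx.1 hx.2) e.symm.injective.injOn

variable {V : Type*} [Fintype V]

/-- The vertices with few non-neighbours. -/
def Good (G : SimpleGraph V) (w η : ℝ) (v : V) : Prop := (nonNbr G v : ℝ) ≤ (w - η) * Fintype.card V

/-- A set of vertices in which all but at most one vertex is good. -/
def AlmostGood (G : SimpleGraph V) (w η : ℝ) (S : Finset V) : Prop :=
  (S.filter fun v => ¬ Good G w η v).card ≤ 1

variable {G : SimpleGraph V} {w s η : ℝ}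

lemma DegCond.nonNbr_le (hG : DegCond G w s η) (hs : 0 < s) (hw : 0 < w) (v : V) :
    (nonNbr G v : ℝ) ≤ (w + s - η) * Fintype.card V := by
  obtain ⟨x, hx, h⟩ := hG {v} (singleton_nonempty v)
  rw [mem_singleton] at hx
  subst hx
  have : 0 ≤ s * min (Fintype.card V : ℝ) ((({x} : Finset V).card : ℝ) / w) :=
    mul_nonneg hs.le (le_min (by positivity) (by positivity))
  linarith

lemma DegCond.card_not_good_le (hG : DegCond G w s η) (hw : 0 < w) :
    ((univ.filter fun v => ¬ Good G w η v).card : ℝ) ≤ w * Fintype.card V := by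
  by_contra! h
  have h0 : (0 : ℝ) ≤ w * Fintype.card V := by positivity
  obtain ⟨x, hx, h'⟩ := hG (univ.filter fun v => ¬ Good G w η v)
    (card_pos.1 (by exact_mod_cast h0.trans_lt h))
  rw [min_eq_left (by rw [le_div_iff₀ hw]; linarith)] at h'
  refine (mem_filter.1 hx).2 ?_
  unfold Good
  linarith

lemma DegCond.le_card_common (hG : DegCond G w s η) (hs : 0 < s) (hw : 0 < w) (S : Finset V)
    (hS : AlmostGood G w η S) :
    (1 - s - S.card * (w - η)) * Fintype.card V ≤
      (univ.filter fun u => ∀ v ∈ S, G.Adj v u).card := by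
  have h1 : (univ.filter fun u => ¬ ∀ v ∈ S, G.Adj v u).card ≤ ∑ v ∈ S, nonNbr G v := by
    refine le_trans (card_le_card ?_) (card_biUnion_le (s := S)
      (t := fun v => univ.filter fun u => ¬ G.Adj v u))
    intro u hu
    simpa using hu
  have h2 : (univ.filter fun u => ∀ v ∈ S, G.Adj v u).card +
      (univ.filter fun u => ¬ ∀ v ∈ S, G.Adj v u).card = Fintype.card V := by
    rw [card_filter_add_card_filter_not, card_univ]
  have h3 : ∑ v ∈ S, (nonNbr G v : ℝ) ≤ S.card * (w - η) * Fintype.card V + s * Fintype.card V := by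
    calc ∑ v ∈ S, (nonNbr G v : ℝ)
        ≤ ∑ v ∈ S, ((w - η) * Fintype.card V + if ¬ Good G w η v then
            s * Fintype.card V else 0) := by
          refine sum_le_sum fun v _ => ?_
          split_ifs with h
          · simpa [Good] using h
          · have := hG.nonNbr_le hs hw v
            linarith
      _ = S.card * (w - η) * Fintype.card V +
          (S.filter fun v => ¬ Good G w η v).card * (s * Fintype.card V) := by
          rw [sum_add_distrib, ← sum_filter]
          simp [mul_assoc]
      _ ≤ _ := by
          have : ((S.filter fun v => ¬ Good G w η v).card : ℝ) ≤ 1 := by exact_mod_cast hS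
          have := mul_le_mul_of_nonneg_right this (by positivity : 0 ≤ s * (Fintype.card V : ℝ))
          linarith
  have h1' : ((univ.filter fun u => ¬ ∀ v ∈ S, G.Adj v u).card : ℝ) ≤
      ∑ v ∈ S, (nonNbr G v : ℝ) := by
    exact_mod_cast h1
  have h2' : ((univ.filter fun u => ∀ v ∈ S, G.Adj v u).card : ℝ) +
      (univ.filter fun u => ¬ ∀ v ∈ S, G.Adj v u).card = Fintype.card V := by exact_mod_cast h2
  linarith

variable {q : ℕ}

lemma DegCond.le_card_common_of_card_le (hG : DegCond G w s η) (hs : 0 < s) (hw : 0 < w)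
    (hη : 0 < η) (hsw : s + q * w = 1) (S : Finset V) (hS : AlmostGood G w η S) (hS0 : S.Nonempty)
    (hSq : S.card ≤ q) :
    η * Fintype.card V ≤ (univ.filter fun u => ∀ v ∈ S, G.Adj v u).card := by
  refine le_trans ?_ (hG.le_card_common hs hw S hS)
  refine mul_le_mul_of_nonneg_right ?_ (by positivity)
  have h1 : (1 : ℝ) ≤ S.card := by exact_mod_cast hS0.card_pos
  have h2 : (S.card : ℝ) ≤ q := by exact_mod_cast hSq
  nlinarith

lemma DegCond.le_card_common_good (hG : DegCond G w s η) (hs : 0 < s) (hw : 0 < w)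
    (hη : 0 < η) (hsw : s + q * w = 1) (S : Finset V) (hS : AlmostGood G w η S) (hS0 : S.Nonempty)
    (hSq : S.card < q) :
    η * Fintype.card V ≤ (univ.filter fun u => (∀ v ∈ S, G.Adj v u) ∧ Good G w η u).card := by
  have h0 := hG.le_card_common hs hw S hS
  have h1 : (1 : ℝ) ≤ S.card := by exact_mod_cast hS0.card_pos
  have h2 : (S.card : ℝ) + 1 ≤ q := by exact_mod_cast hSq
  have h3 : (univ.filter fun u => ∀ v ∈ S, G.Adj v u).card ≤
      (univ.filter fun u => (∀ v ∈ S, G.Adj v u) ∧ Good G w η u).card +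
        (univ.filter fun u => ¬ Good G w η u).card := by
    refine le_trans (card_le_card ?_) (card_union_le _ _)
    intro u hu
    simp only [mem_union, mem_filter, mem_univ, true_and] at hu ⊢
    tauto
  have h3' : ((univ.filter fun u => ∀ v ∈ S, G.Adj v u).card : ℝ) ≤
      (univ.filter fun u => (∀ v ∈ S, G.Adj v u) ∧ Good G w η u).card +
        (univ.filter fun u => ¬ Good G w η u).card := by exact_mod_cast h3
  have h4 := hG.card_not_good_le hw
  have h5 : (η + w) * (Fintype.card V : ℝ) ≤ (1 - s - S.card * (w - η)) * Fintype.card V := by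
    refine mul_le_mul_of_nonneg_right ?_ (by positivity)
    nlinarith
  linarith

/-- `f` lists a clique in the common neighbourhood of `S` all of whose vertices except possibly the
last one are good. -/
def IsExtension (G : SimpleGraph V) (w η : ℝ) (S : Finset V) {d : ℕ} (f : Fin d → V) : Prop :=
  (∀ v ∈ S, ∀ i, G.Adj v (f i)) ∧ (∀ i j, i ≠ j → G.Adj (f i) (f j)) ∧
    ∀ i : Fin d, (i : ℕ) + 1 < d → Good G w η (f i)

lemma DegCond.le_card_isExtension (hG : DegCond G w s η) (hs : 0 < s) (hw : 0 < w)
    (hη : 0 < η) (hsw : s + q * w = 1) {d : ℕ} (S : Finset V) (hS : d ≠ 0 → AlmostGood G w η S)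
    (hS0 : S.Nonempty) (hSq : S.card + d ≤ q + 1) :
    (η * Fintype.card V) ^ d ≤ (univ.filter fun f : Fin d → V => IsExtension G w η S f).card := by
  induction d generalizing S with
  | zero =>
    simp only [pow_zero, Nat.one_le_cast]
    refine card_pos.2 ⟨Fin.elim0, mem_filter.2 ⟨mem_univ _, ?_⟩⟩
    simp [IsExtension]
  | succ d ih =>
    rw [pow_succ']
    refine mul_le_card_filter_equiv (Fin.consEquiv (fun _ : Fin (d + 1) => V)).symm
      (P := fun u => (∀ v ∈ S, G.Adj v u) ∧ (d = 0 ∨ Good G w η u))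
      (Q := fun u f => IsExtension G w η (insert u S) f) (by positivity) ?_ ?_ ?_
    · rcases Nat.eq_zero_or_pos d with h | h
      · simpa [h] using hG.le_card_common_of_card_le hs hw hη hsw S (hS (by omega)) hS0 (by omega)
      · simpa [h.ne'] using hG.le_card_common_good hs hw hη hsw S (hS (by omega)) hS0 (by omega)
    · rintro u ⟨h1, h2⟩
      refine ih (insert u S) (fun hd => ?_) (insert_nonempty _ _) ?_
      · unfold AlmostGood at *
        rw [filter_insert, if_neg (by simpa using h2.resolve_left hd)]
        exact hS (by omega)
      · have := card_insert_le u S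
        omega
    · rintro f ⟨h1, h2⟩ ⟨h3, h4, h5⟩
      change ∀ v ∈ insert (f 0) S, ∀ i, G.Adj v (f (Fin.succ i)) at h3
      change ∀ i j, i ≠ j → G.Adj (f (Fin.succ i)) (f (Fin.succ j)) at h4
      change ∀ i : Fin d, _ → Good G w η (f (Fin.succ i)) at h5
      change ∀ v ∈ S, G.Adj v (f 0) at h1
      change d = 0 ∨ Good G w η (f 0) at h2
      refine ⟨fun v hv i => ?_, fun i j hij => ?_, fun i hi => ?_⟩
      · refine Fin.cases ?_ (fun i => ?_) i
        · exact h1 v hv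
        · exact h3 v (mem_insert_of_mem hv) i
      · revert hij
        refine Fin.cases ?_ (fun i => ?_) i <;> refine Fin.cases ?_ (fun j => ?_) j <;> intro hij
        · exact absurd rfl hij
        · exact h3 _ (mem_insert_self _ _) j
        · exact (h3 _ (mem_insert_self _ _) i).symm
        · exact h4 i j (fun h => hij (by rw [h]))
      · revert hi
        refine Fin.cases ?_ (fun i => ?_) i <;> intro hi
        · rcases h2 with h | h
          · simp [h] at hi
          · exact h
        · exact h5 i (by simpa using hi)

end CliqueCounting

section Gadget
open scoped Classical

/-- The vertices of the part of the gadget that belongs to a single root. -/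
abbrev Cell (d : ℕ) : Type := Fin (d + 1) ⊕ (Fin 1 ⊕ (Fin 1 ⊕ (Fin d ⊕ Fin d)))

variable {V : Type*} [Fintype V] {G : SimpleGraph V} {w s η : ℝ} {d : ℕ}

/-- The map `f` embeds the part of the gadget with root `x` and hub `g`: a clique attached to `x`
together with a vertex completing it, and, for `d ≠ 0`, two cliques that lead to the hub. -/
def CellOK (G : SimpleGraph V) (w η : ℝ) (x g : V) (f : Cell d → V) : Prop :=
  IsExtension G w η {x} (f ∘ .inl) ∧
  IsExtension G w η (univ.image (f ∘ .inl)) (f ∘ .inr ∘ .inl) ∧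
  IsExtension G w η (if d = 0 then {g} else {g, f (.inl 0)}) (f ∘ .inr ∘ .inr ∘ .inl) ∧
  IsExtension G w η {f (.inl 0), f (.inr (.inr (.inl 0)))} (f ∘ .inr ∘ .inr ∘ .inr ∘ .inl) ∧
  IsExtension G w η {g, f (.inr (.inr (.inl 0)))} (f ∘ .inr ∘ .inr ∘ .inr ∘ .inr)

lemma almostGood_pair {x y : V} (hx : Good G w η x) : AlmostGood G w η {x, y} := by
  unfold AlmostGood
  rw [filter_insert, if_neg (by simpa using hx)]
  exact (card_filter_le _ _).trans (by simp)

lemma DegCond.le_card_cellOK (hG : DegCond G w s η) (hs : 0 < s) (hw : 0 < w)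
    (hη : 0 < η) (hsw : s + (d + 1 : ℕ) * w = 1) (x g : V) (hg : Good G w η g) :
    (η * Fintype.card V) ^ Fintype.card (Cell d) ≤
      (univ.filter fun f : Cell d → V => CellOK G w η x g f).card := by
  have hE {m : ℕ} (S : Finset V) (h1 : m ≠ 0 → AlmostGood G w η S) (h2 : S.Nonempty)
    (h3 : S.card + m ≤ d + 1 + 1) := hG.le_card_isExtension hs hw hη hsw S h1 h2 h3
  have hcard : Fintype.card (Cell d) = (d + 1) + (1 + (1 + (d + d))) := by
    simp [Cell]
  rw [hcard, pow_add]
  refine mul_le_card_filter_equiv (Equiv.sumArrowEquivProdArrow _ _ V)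
    (P := fun a => IsExtension G w η {x} a)
    (Q := fun a (f : Fin 1 ⊕ (Fin 1 ⊕ (Fin d ⊕ Fin d)) → V) =>
      IsExtension G w η (univ.image a) (f ∘ .inl) ∧
      IsExtension G w η (if d = 0 then {g} else {g, a 0}) (f ∘ .inr ∘ .inl) ∧
      IsExtension G w η {a 0, f (.inr (.inl 0))} (f ∘ .inr ∘ .inr ∘ .inl) ∧
      IsExtension G w η {g, f (.inr (.inl 0))} (f ∘ .inr ∘ .inr ∘ .inr))
    (by positivity) (hE _ (fun _ => ?_) (by simp) (by simp; omega)) (fun a ha => ?_)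
    (fun f h1 h2 => ⟨h1, h2⟩)
  · exact (card_filter_le _ _).trans (by simp)
  have ha0 : d ≠ 0 → Good G w η (a 0) := fun hd => ha.2.2 0 (by simp; omega)
  rw [pow_add]
  refine mul_le_card_filter_equiv (Equiv.sumArrowEquivProdArrow _ _ V)
    (P := fun b => IsExtension G w η (univ.image a) b)
    (Q := fun b (f : Fin 1 ⊕ (Fin d ⊕ Fin d) → V) =>
      IsExtension G w η (if d = 0 then {g} else {g, a 0}) (f ∘ .inl) ∧
      IsExtension G w η {a 0, f (.inl 0)} (f ∘ .inr ∘ .inl) ∧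
      IsExtension G w η {g, f (.inl 0)} (f ∘ .inr ∘ .inr))
    (by positivity) (hE _ (fun _ => ?_) (by simp) ?_) (fun b _ => ?_)
    (fun f h1 h2 => ⟨h1, h2⟩)
  · refine (card_le_card (t := {a (Fin.last d)}) ?_).trans (by simp)
    intro v hv
    obtain ⟨hv1, hv2⟩ := mem_filter.1 hv
    obtain ⟨i, -, rfl⟩ := mem_image.1 hv1
    have : i = Fin.last d := by
      by_contra h
      have : (i : ℕ) ≠ d := fun h' => h (Fin.ext h')
      exact hv2 (ha.2.2 i (by omega))
    simp [this]
  · have := card_image_le (s := univ) (f := a)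
    rw [card_univ, Fintype.card_fin] at this
    omega
  rw [pow_add]
  refine mul_le_card_filter_equiv (Equiv.sumArrowEquivProdArrow _ _ V)
    (P := fun b => IsExtension G w η (if d = 0 then {g} else {g, a 0}) b)
    (Q := fun b (f : Fin d ⊕ Fin d → V) => IsExtension G w η {a 0, b 0} (f ∘ .inl) ∧
      IsExtension G w η {g, b 0} (f ∘ .inr))
    (by positivity) (hE _ (fun _ => ?_) (by split_ifs <;> simp) ?_) (fun b _ => ?_)
    (fun f h1 h2 => ⟨h1, h2⟩)
  · split_ifs with h
    · exact (card_filter_le _ _).trans (by simp)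
    · exact almostGood_pair hg
  · split_ifs with h
    · simp
    · have := card_le_two (a := g) (b := a 0)
      omega
  rw [pow_add]
  refine mul_le_card_filter_equiv (Equiv.sumArrowEquivProdArrow _ _ V)
    (P := fun f => IsExtension G w η {a 0, b 0} f)
    (Q := fun _ f => IsExtension G w η {g, b 0} f)
    (by positivity) (hE _ (fun hd => almostGood_pair (ha0 hd)) (by simp) ?_)
    (fun _ _ => hE _ (fun hd => almostGood_pair hg) (by simp) ?_)
    (fun f h1 h2 => ⟨h1, h2⟩)
  · have := card_le_two (a := a 0) (b := b 0)
    omega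
  · have := card_le_two (a := g) (b := b 0)
    omega

lemma pow_le_card_filter_pi {α A B : Type*} [Fintype α] [Fintype A] [Fintype B]
    {P : α → (A → B) → Prop} {p : ℝ} (hp : 0 ≤ p)
    (hP : ∀ a, p ≤ (univ.filter (P a)).card) :
    p ^ Fintype.card α ≤
      (univ.filter fun f : α × A → B => ∀ a, P a fun j => f (a, j)).card := by
  have h : (univ.filter fun f : α × A → B => ∀ a, P a fun j => f (a, j)).card =
      ∏ a, (univ.filter (P a)).card := by
    rw [← Fintype.card_piFinset]
    refine card_equiv (Equiv.curry α A B) fun f => ?_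
    simp only [mem_filter, mem_univ, true_and, Fintype.mem_piFinset]
    exact Iff.rfl
  rw [h]
  push_cast
  rw [← card_univ, ← prod_const]
  exact prod_le_prod (fun _ _ => hp) fun a _ => hP a

/-- The cliques of the gadget: the three cliques of a cell, the latter two of which are
used only if `d ≠ 0`. -/
def gadgetClique {α : Type*} (d : ℕ) (a : α) : Fin 3 → Fin (d + 2) → Option (α × Cell d)
  | 0 => Fin.cons (some (a, .inr (.inl 0))) fun i => some (a, .inl i)
  | 1 => Fin.cons (some (a, .inl 0))
      (Fin.cons (some (a, .inr (.inr (.inl 0)))) fun i => some (a, .inr (.inr (.inr (.inl i)))))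
  | 2 => Fin.cons none
      (Fin.cons (some (a, .inr (.inr (.inl 0)))) fun i => some (a, .inr (.inr (.inr (.inr i)))))

/-- The adjacencies that occur in the cliques of the gadget. -/
def gadgetGraph (α : Type*) (d : ℕ) : SimpleGraph (Option (α × Cell d)) where
  Adj i j := i ≠ j ∧ ∃ (a : α) (t : Fin 3) (p p' : Fin (d + 2)), (d = 0 → t = 0) ∧ p ≠ p' ∧
    gadgetClique d a t p = i ∧ gadgetClique d a t p' = j
  symm := ⟨fun _ _ ⟨h, a, t, p, p', ht, hp, h1, h2⟩ => ⟨h.symm, a, t, p', p, ht, hp.symm, h2, h1⟩⟩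
  loopless := ⟨fun _ h => h.1 rfl⟩

/-- An embedding of the gadget with prescribed roots. -/
def IsGadget {α : Type*} (G : SimpleGraph V) (X : α → V) (f : Option (α × Cell d) → V) : Prop :=
  (∀ i j, (gadgetGraph α d).Adj i j → G.Adj (f i) (f j)) ∧
    ∀ a p, p ≠ 0 → G.Adj (X a) (f (gadgetClique d a 0 p))

lemma forall_adj_cons {V ι : Type*} {G : SimpleGraph V} {n : ℕ} {e : ι → V} {x : ι} {f : Fin n → ι}
    (h1 : ∀ i, G.Adj (e x) (e (f i))) (h2 : ∀ i j, i ≠ j → G.Adj (e (f i)) (e (f j)))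
    (p p' : Fin (n + 1)) (h : p ≠ p') :
    G.Adj (e ((Fin.cons x f : Fin (n + 1) → ι) p)) (e ((Fin.cons x f : Fin (n + 1) → ι) p')) := by
  revert h
  refine Fin.cases ?_ (fun i => ?_) p <;> refine Fin.cases ?_ (fun j => ?_) p' <;> intro hij
  · exact absurd rfl hij
  · exact h1 j
  · exact (h1 i).symm
  · exact h2 i j fun h => hij (by rw [h])

lemma isGadget_of_cellOK {α : Type*} {X : α → V} {f : Option (α × Cell d) → V}
    (h : ∀ a, CellOK G w η (X a) (f none) fun j => f (some (a, j))) : IsGadget G X f := by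
  constructor
  · rintro i j ⟨-, a, t, p, p', ht, hp, rfl, rfl⟩
    obtain ⟨h1, h2, h3, h4, h5⟩ := h a
    fin_cases t
    · exact forall_adj_cons (e := f) (fun i => (h2.1 _ (mem_image_of_mem _ (mem_univ i)) 0).symm)
        (fun i j hij => h1.2.1 i j hij) p p' hp
    · have hd : d ≠ 0 := fun hd => by simpa using ht hd
      rw [if_neg hd] at h3
      refine forall_adj_cons (e := f) (fun i => ?_) (forall_adj_cons (e := f) (fun i => ?_)
        fun i j hij => h4.2.1 i j hij) p p' hp
      · refine Fin.cases ?_ (fun i => ?_) i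
        · exact h3.1 _ (by simp) 0
        · exact h4.1 _ (by simp) i
      · exact h4.1 _ (by simp) i
    · have hd : d ≠ 0 := fun hd => by simpa using ht hd
      rw [if_neg hd] at h3
      refine forall_adj_cons (e := f) (fun i => ?_) (forall_adj_cons (e := f) (fun i => ?_)
        fun i j hij => h5.2.1 i j hij) p p' hp
      · refine Fin.cases ?_ (fun i => ?_) i
        · exact h3.1 _ (by simp) 0
        · exact h5.1 _ (by simp) i
      · exact h5.1 _ (by simp) i
  · intro a p hp
    obtain ⟨i, rfl⟩ := Fin.exists_succ_eq.2 hp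
    exact (h a).1.1 _ (by simp) i

lemma DegCond.exists_le_card_isGadget {α : Type*} [Fintype α] (hs : 0 < s) (hw : 0 < w)
    (hη : 0 < η) (hsw : s + (d + 1 : ℕ) * w = 1) :
    ∃ c : ℝ, 0 < c ∧ ∀ (V : Type*) [Fintype V] (G : SimpleGraph V), DegCond G w s η →
      ∀ X : α → V, c * (Fintype.card V : ℝ) ^ Fintype.card (Option (α × Cell d)) ≤
        (univ.filter fun f : Option (α × Cell d) → V => IsGadget G X f).card := by
  refine ⟨s * (η ^ Fintype.card (Cell d)) ^ Fintype.card α, by positivity, fun V _ G hG X => ?_⟩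
  have hgood : s * (Fintype.card V : ℝ) ≤ (univ.filter fun v => Good G w η v).card := by
    have h1 := hG.card_not_good_le hw
    have h2 : (univ.filter fun v => Good G w η v).card +
        (univ.filter fun v => ¬ Good G w η v).card =
        Fintype.card V := by
      rw [card_filter_add_card_filter_not, card_univ]
    have h2' : ((univ.filter fun v => Good G w η v).card : ℝ) +
        (univ.filter fun v => ¬ Good G w η v).card = Fintype.card V := by exact_mod_cast h2
    have h3 : (s + w) * (Fintype.card V : ℝ) ≤ 1 * Fintype.card V := by
      refine mul_le_mul_of_nonneg_right ?_ (by positivity)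
      push_cast at hsw
      have : 0 ≤ d * w := by positivity
      linarith
    linarith
  have hcard : Fintype.card (Option (α × Cell d)) = 1 + Fintype.card (Cell d) * Fintype.card α := by
    rw [Fintype.card_option, Fintype.card_prod]; ring
  have := mul_le_card_filter_equiv (Equiv.piOptionEquivProd (β := fun _ : Option (α × Cell d) => V))
    (P := fun g => Good G w η g)
    (Q := fun g f => ∀ a, CellOK G w η (X a) g fun j => f (a, j))
    (R := fun f => IsGadget G X f)
    (q := ((η * Fintype.card V) ^ Fintype.card (Cell d)) ^ Fintype.card α)
    (by positivity) hgood (fun g hg => ?_) (fun f _ h2 => isGadget_of_cellOK h2)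
  · refine le_trans (le_of_eq ?_) this
    rw [hcard, pow_add, mul_pow, mul_pow, pow_mul]
    ring
  · have h := pow_le_card_filter_pi (P := fun a f => CellOK G w η (X a) g f)
      (p := (η * Fintype.card V) ^ Fintype.card (Cell d)) (by positivity) fun a => by
        convert hG.le_card_cellOK hs hw hη hsw (X a) g hg
    convert h

end Gadget

section Lattice
open scoped Classical

lemma AddSubgroup.one_mem_of_forall_two_le {Z : AddSubgroup ℤ}
    (h : ∀ d : ℕ, 2 ≤ d → ∃ z ∈ Z, ¬ (d : ℤ) ∣ z) : (1 : ℤ) ∈ Z := by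
  obtain ⟨g, hg⟩ := Int.subgroup_cyclic Z
  have hdvd : ∀ z ∈ Z, (g.natAbs : ℤ) ∣ z := by
    intro z hz
    rw [hg, AddSubgroup.mem_closure_singleton] at hz
    obtain ⟨k, rfl⟩ := hz
    rw [Int.natAbs_dvd]
    exact ⟨k, by rw [smul_eq_mul, mul_comm]⟩
  have h1 : g.natAbs = 1 := by
    rcases Nat.lt_or_ge g.natAbs 2 with h2 | h2
    · rcases Nat.eq_zero_or_pos g.natAbs with h0 | h0
      · obtain ⟨z, hz, hz'⟩ := h 2 le_rfl
        have := hdvd z hz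
        rw [h0] at this
        exact absurd (by simp [Int.zero_dvd.1 (by simpa using this)]) hz'
      · omega
    · obtain ⟨z, hz, hz'⟩ := h _ h2
      exact absurd (hdvd z hz) hz'
  have hgZ : g ∈ Z := by rw [hg]; exact AddSubgroup.subset_closure rfl
  rcases Int.natAbs_eq g with h2 | h2 <;> rw [h1] at h2 <;> rw [h2] at hgZ
  · simpa using hgZ
  · simpa using Z.neg_mem hgZ

lemma AddSubgroup.exists_list_of_mem_closure {A T : Type*} [AddCommGroup A] {S : Set T}
    {f : T → A} {x : A}
    (hx : x ∈ AddSubgroup.closure (f '' S)) :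
    ∃ l₁ l₂ : List T, (∀ t ∈ l₁, t ∈ S) ∧ (∀ t ∈ l₂, t ∈ S) ∧
      x + (l₁.map f).sum = (l₂.map f).sum := by
  induction hx using AddSubgroup.closure_induction with
  | mem x hx =>
    obtain ⟨t, ht, rfl⟩ := hx
    exact ⟨[], [t], by simp, by simpa using ht, by simp⟩
  | zero => exact ⟨[], [], by simp, by simp, by simp⟩
  | add x y _ _ hx hy =>
    obtain ⟨l₁, l₂, h1, h2, h3⟩ := hx
    obtain ⟨m₁, m₂, h1', h2', h3'⟩ := hy
    refine ⟨l₁ ++ m₁, l₂ ++ m₂, ?_, ?_, ?_⟩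
    · simp only [List.mem_append]; rintro t (h | h); exacts [h1 t h, h1' t h]
    · simp only [List.mem_append]; rintro t (h | h); exacts [h2 t h, h2' t h]
    · simp only [List.map_append, List.sum_append]
      rw [← h3, ← h3']; abel
  | neg x _ hx =>
    obtain ⟨l₁, l₂, h1, h2, h3⟩ := hx
    exact ⟨l₂, l₁, h2, h1, by rw [← h3]; abel⟩

variable {α ι : Type*} [Fintype α] {H : SimpleGraph α} {R : SimpleGraph ι}

/-- The number of elements that a map sends to each point. -/
noncomputable def indexVec {β : Type*} [Fintype β] (φ : β → ι) : ι → ℤ := ∑ v, Pi.single (φ v) 1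

lemma indexVec_apply {β : Type*} [Fintype β] (φ : β → ι) (i : ι) :
    indexVec φ i = (univ.filter fun v => φ v = i).card := by
  simp [indexVec, Finset.sum_apply, Pi.single_apply, eq_comm]

/-- The subgroup generated by the index vectors of homomorphisms from `H` to `R`. -/
noncomputable def homLattice (H : SimpleGraph α) (R : SimpleGraph ι) : AddSubgroup (ι → ℤ) :=
  AddSubgroup.closure (indexVec '' {φ | ∀ u v, H.Adj u v → R.Adj (φ u) (φ v)})

lemma indexVec_mem_homLattice {φ : α → ι} (h : ∀ u v, H.Adj u v → R.Adj (φ u) (φ v)) :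
    indexVec φ ∈ homLattice H R := AddSubgroup.subset_closure ⟨φ, h, rfl⟩

lemma sum_single_sub_single_swap {α : Type*} {r : ℕ} (K : Fin r → ι) (t : α → Fin r) (A : Finset α)
    {p p' : Fin r} (hp : p ≠ p') :
    ∑ v ∈ A, ((Pi.single (K (t v)) 1 : ι → ℤ) - Pi.single (K (Equiv.swap p p' (t v))) 1) =
      (((A.filter fun v => t v = p).card : ℤ) - (A.filter fun v => t v = p').card) •
        (Pi.single (K p) 1 - Pi.single (K p') 1) := by
  have : ∀ v ∈ A, ((Pi.single (K (t v)) 1 : ι → ℤ) - Pi.single (K (Equiv.swap p p' (t v))) 1) =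
      ((if t v = p then (1 : ℤ) else 0) - if t v = p' then 1 else 0) •
        (Pi.single (K p) 1 - Pi.single (K p') 1) := by
    intro v _
    by_cases h1 : t v = p
    · simp [h1, hp]
    · by_cases h2 : t v = p'
      · simp [h2, hp.symm]
      · simp [h1, h2, Equiv.swap_apply_of_ne_of_ne h1 h2]
  rw [sum_congr rfl this, ← sum_smul, sum_sub_distrib]
  simp

lemma coloring_hom {α : Type*} {H : SimpleGraph α} {r : ℕ} {K : Fin r → ι}
    (hK : ∀ p p', p ≠ p' → R.Adj (K p) (K p')) (c : H.Coloring (Fin r)) (e : Equiv.Perm (Fin r))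
      (u v : α) (huv : H.Adj u v) :
    R.Adj (K (e (c u))) (K (e (c v))) :=
  hK _ _ fun h => c.valid huv (e.injective h)

lemma classDiff_smul_mem {r : ℕ} {K : Fin r → ι} (hK : ∀ p p', p ≠ p' → R.Adj (K p) (K p'))
    (c : H.Coloring (Fin r)) (i j p p' : Fin r) :
    (({v | c v = i}.ncard : ℤ) - ({v | c v = j}.ncard : ℤ)) •
      (Pi.single (K p) 1 - Pi.single (K p') 1 : ι → ℤ) ∈ homLattice H R := by
  rcases eq_or_ne p p' with rfl | hp
  · simp
  rcases eq_or_ne i j with rfl | hij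
  · simp
  obtain ⟨e, hei, hej⟩ : ∃ e : Equiv.Perm (Fin r), e i = p ∧ e j = p' := by
    refine ⟨(Equiv.swap i p).trans (Equiv.swap (Equiv.swap i p j) p'), ?_, ?_⟩
    · simp only [Equiv.trans_apply, Equiv.swap_apply_left]
      refine Equiv.swap_apply_of_ne_of_ne ?_ hp
      intro h
      have : Equiv.swap i p i = Equiv.swap i p j := by rw [Equiv.swap_apply_left]; exact h
      exact hij ((Equiv.swap i p).injective this)
    · simp
  have h := (homLattice H R).sub_mem (indexVec_mem_homLattice (coloring_hom hK c e))
    (indexVec_mem_homLattice (coloring_hom hK c (e.trans (Equiv.swap p p'))))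
  unfold indexVec at h
  rw [← sum_sub_distrib] at h
  have h2 := sum_single_sub_single_swap K (fun v => e (c v)) univ hp
  simp only [Equiv.trans_apply] at h
  rw [h2] at h
  convert h using 3
  · rw [Set.ncard_eq_toFinset_card']
    congr 2
    ext v
    simp [← hei]
  · rw [Set.ncard_eq_toFinset_card']
    congr 2
    ext v
    simp [← hej]

/-- The multipliers that send `x` into `L`. -/
def multipliers (L : AddSubgroup (ι → ℤ)) (x : ι → ℤ) : AddSubgroup ℤ :=
  L.comap (AddMonoidHom.mk' (fun z : ℤ => z • x) fun a b => add_smul a b x)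

lemma mem_multipliers {L : AddSubgroup (ι → ℤ)} {x : ι → ℤ} {z : ℤ} :
    z ∈ multipliers L x ↔ z • x ∈ L := Iff.rfl

lemma single_sub_single_mem_of_hcfChiOne {r : ℕ} (hH : HcfChiOne H r) {K : Fin r → ι}
    (hK : ∀ p p', p ≠ p' → R.Adj (K p) (K p')) (p p' : Fin r) :
    (Pi.single (K p) 1 - Pi.single (K p') 1 : ι → ℤ) ∈ homLattice H R := by
  have : (1 : ℤ) ∈ multipliers (homLattice H R) (Pi.single (K p) 1 - Pi.single (K p') 1) := by
    refine AddSubgroup.one_mem_of_forall_two_le fun d hd => ?_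
    have := hH d hd
    push Not at this
    obtain ⟨c, i, j, h⟩ := this
    exact ⟨_, classDiff_smul_mem hK c i j p p', h⟩
  simpa [mem_multipliers] using this

lemma component_mix_hom {α : Type*} {H : SimpleGraph α} {φ φ' : α → ι}
    (h : ∀ u v, H.Adj u v → R.Adj (φ u) (φ v))
    (h' : ∀ u v, H.Adj u v → R.Adj (φ' u) (φ' v)) (C : H.ConnectedComponent) (u v : α)
    (huv : H.Adj u v) :
    R.Adj (if H.connectedComponentMk u = C then φ' u else φ u)
      (if H.connectedComponentMk v = C then φ' v else φ v) := by
  rw [ConnectedComponent.connectedComponentMk_eq_of_adj huv]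
  split_ifs
  · exact h' u v huv
  · exact h u v huv

lemma sum_component_sub_mem {φ φ' : α → ι} (h : ∀ u v, H.Adj u v → R.Adj (φ u) (φ v))
    (h' : ∀ u v, H.Adj u v → R.Adj (φ' u) (φ' v)) (C : H.ConnectedComponent) :
    ∑ v ∈ univ.filter (fun v => H.connectedComponentMk v = C),
      ((Pi.single (φ v) 1 : ι → ℤ) - Pi.single (φ' v) 1) ∈ homLattice H R := by
  have := (homLattice H R).sub_mem (indexVec_mem_homLattice h)
    (indexVec_mem_homLattice (component_mix_hom h h' C))
  unfold indexVec at this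
  rw [← sum_sub_distrib] at this
  convert this using 1
  rw [sum_filter]
  refine sum_congr rfl fun v _ => ?_
  by_cases hv : H.connectedComponentMk v = C <;> simp [hv]

lemma ncard_supp (C : H.ConnectedComponent) :
    C.supp.ncard = (univ.filter fun v => H.connectedComponentMk v = C).card := by
  rw [Set.ncard_eq_toFinset_card']
  congr 1
  ext v
  simp

lemma single_sub_single_mem_of_hcfComp (hH : HcfCompOne H) (hH' : HcfChiLeTwo H 2)
    {K : Fin 2 → ι} (hK : ∀ p p', p ≠ p' → R.Adj (K p) (K p')) :
    (Pi.single (K 0) 1 - Pi.single (K 1) 1 : ι → ℤ) ∈ homLattice H R := by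
  have : (1 : ℤ) ∈ multipliers (homLattice H R) (Pi.single (K 0) 1 - Pi.single (K 1) 1) := by
    refine AddSubgroup.one_mem_of_forall_two_le fun d hd => ?_
    rcases hd.eq_or_lt with rfl | hd
    · obtain ⟨c, -⟩ := hH'.1
      obtain ⟨C, hC⟩ := hH 2 le_rfl
      refine ⟨(((univ.filter fun v => H.connectedComponentMk v = C).filter
          fun v => c v = 0).card : ℤ) -
        ((univ.filter fun v => H.connectedComponentMk v = C).filter fun v => c v = 1).card,
        ?_, fun hdvd => ?_⟩
      · rw [mem_multipliers, ← sum_single_sub_single_swap K (fun v => c v)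
          (univ.filter fun v => H.connectedComponentMk v = C) (by decide : (0 : Fin 2) ≠ 1)]
        exact sum_component_sub_mem (coloring_hom hK c 1) (coloring_hom hK c (Equiv.swap 0 1)) C
      · rw [ncard_supp] at hC
        rw [← card_filter_add_card_filter_not
          (s := univ.filter fun v => H.connectedComponentMk v = C)
          (p := fun v => c v = 0)] at hC
        have : ∀ v, ¬ c v = 0 ↔ c v = 1 := by
          intro v
          generalize c v = x
          fin_cases x <;> simp
        simp only [this] at hC
        omega
    · have := hH'.2 d hd
      push Not at this
      obtain ⟨c, i, j, h⟩ := this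
      exact ⟨_, classDiff_smul_mem hK c i j 0 1, h⟩
  simpa [mem_multipliers] using this

lemma single_sub_single_mem_of_two_edges (hH : HcfCompOne H) (hH' : HcfChiLeTwo H 2)
    {K K' : Fin 2 → ι} (hK : ∀ p p', p ≠ p' → R.Adj (K p) (K p'))
    (hK' : ∀ p p', p ≠ p' → R.Adj (K' p) (K' p')) :
    (Pi.single (K 0) 1 - Pi.single (K' 0) 1 : ι → ℤ) ∈ homLattice H R := by
  have : (1 : ℤ) ∈ multipliers (homLattice H R) (Pi.single (K 0) 1 - Pi.single (K' 0) 1) := by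
    refine AddSubgroup.one_mem_of_forall_two_le fun d hd => ?_
    obtain ⟨c, -⟩ := hH'.1
    obtain ⟨C, hC⟩ := hH d hd
    refine ⟨(C.supp.ncard : ℤ), ?_, by exact_mod_cast hC⟩
    rw [mem_multipliers, ncard_supp, natCast_zsmul, ← sum_const]
    have h1 := sum_component_sub_mem (coloring_hom hK c 1) (coloring_hom hK' c 1) C
    have h2 := single_sub_single_mem_of_hcfComp hH hH' hK
    have h3 := single_sub_single_mem_of_hcfComp hH hH' hK'
    refine (AddSubgroup.add_mem_cancel_right _ ((homLattice H R).neg_mem h1)).1 ?_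
    rw [← sub_eq_add_neg, ← sum_sub_distrib]
    refine (homLattice H R).sum_mem fun v _ => ?_
    have h4 : ∀ {J : Fin 2 → ι}, (Pi.single (J 0) 1 - Pi.single (J 1) 1 : ι → ℤ) ∈ homLattice H R →
        ∀ x, (Pi.single (J 0) 1 - Pi.single (J x) 1 : ι → ℤ) ∈ homLattice H R := by
      intro J hJ x
      fin_cases x
      · simp
      · exact hJ
    convert (homLattice H R).sub_mem (h4 h2 (c v)) (h4 h3 (c v)) using 1
    simp only [Equiv.Perm.one_apply]
    abel
  simpa [mem_multipliers] using this

end Lattice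

section Absorber
open scoped Classical

variable {α ι : Type*} [Fintype α] {H : SimpleGraph α} {R : SimpleGraph ι}

lemma gadgetClique_injective {α : Type*} (d : ℕ) (a : α) (t : Fin 3) :
    Function.Injective (gadgetClique d a t) := by
  fin_cases t
  · refine Fin.cons_injective_iff.2 ⟨by simp, fun i j h => by simpa using h⟩
  · refine Fin.cons_injective_iff.2 ⟨?_,
        Fin.cons_injective_iff.2 ⟨by simp, fun i j h => by simpa using h⟩⟩
    rintro ⟨i, hi⟩
    revert hi
    refine Fin.cases ?_ (fun i => ?_) i <;> simp
  · refine Fin.cons_injective_iff.2 ⟨?_,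
        Fin.cons_injective_iff.2 ⟨by simp, fun i j h => by simpa using h⟩⟩
    rintro ⟨i, hi⟩
    revert hi
    refine Fin.cases ?_ (fun i => ?_) i <;> simp

lemma gadgetClique_adj {α : Type*} {d : ℕ} (a : α) {t : Fin 3} (ht : d = 0 → t = 0)
    (p p' : Fin (d + 2)) (h : p ≠ p') :
    (gadgetGraph α d).Adj (gadgetClique d a t p) (gadgetClique d a t p') :=
  ⟨(gadgetClique_injective d a t).ne h, a, t, p, p', ht, h, rfl, rfl⟩

lemma gadget_single_sub_single_mem {d : ℕ} (hH : HcfOne H (d + 2)) (a b : α) (p p' : Fin (d + 2)) :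
    (Pi.single (gadgetClique d a 0 p) 1 - Pi.single (gadgetClique d b 0 p') 1 :
      Option (α × Cell d) → ℤ) ∈ homLattice H (gadgetGraph α d) := by
  have htrans : ∀ {i j k : Option (α × Cell d)},
      (Pi.single i 1 - Pi.single j 1 : Option (α × Cell d) → ℤ) ∈ homLattice H (gadgetGraph α d) →
      (Pi.single j 1 - Pi.single k 1 : Option (α × Cell d) → ℤ) ∈ homLattice H (gadgetGraph α d) →
      (Pi.single i 1 - Pi.single k 1 : Option (α × Cell d) → ℤ) ∈
        homLattice H (gadgetGraph α d) := by
    intro i j k h1 h2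
    simpa using (homLattice H (gadgetGraph α d)).add_mem h1 h2
  have hsymm : ∀ {i j : Option (α × Cell d)},
      (Pi.single i 1 - Pi.single j 1 : Option (α × Cell d) → ℤ) ∈ homLattice H (gadgetGraph α d) →
      (Pi.single j 1 - Pi.single i 1 : Option (α × Cell d) → ℤ) ∈
        homLattice H (gadgetGraph α d) := by
    intro i j h1
    simpa using (homLattice H (gadgetGraph α d)).neg_mem h1
  rcases Nat.eq_zero_or_pos d with rfl | hd
  · obtain ⟨h1, h2⟩ := hH.1 rfl
    have h4 (a : α) (x : Fin 2) : (Pi.single (gadgetClique 0 a 0 0) 1 -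
        Pi.single (gadgetClique 0 a 0 x) 1 :
        Option (α × Cell 0) → ℤ) ∈ homLattice H (gadgetGraph α 0) := by
      fin_cases x
      · simp
      · exact single_sub_single_mem_of_hcfComp h1 h2 (gadgetClique_adj a fun _ => rfl)
    exact htrans (htrans (hsymm (h4 a p)) (single_sub_single_mem_of_two_edges h1 h2
      (gadgetClique_adj a fun _ => rfl) (gadgetClique_adj b fun _ => rfl))) (h4 b p')
  · have h1 := hH.2 (by omega)
    have hc (a : α) (t : Fin 3) (p p' : Fin (d + 2)) :=
      single_sub_single_mem_of_hcfChiOne h1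
      (gadgetClique_adj (t := t) a fun h => absurd h hd.ne') p p'
    have hub (a : α) (p : Fin (d + 2)) : (Pi.single (gadgetClique d a 0 p) 1 - Pi.single none 1 :
        Option (α × Cell d) → ℤ) ∈ homLattice H (gadgetGraph α d) :=
      htrans (hc a 0 p 1) (htrans (hc a 1 0 1) (hc a 2 1 0))
    exact htrans (hub a p) (hsymm (hub b p'))

lemma indexVec_eq_sum_ite {β : Type*} [Fintype β] (φ : β → ι) (i : ι) :
    indexVec φ i = ∑ v, if φ v = i then 1 else 0 := by
  rw [indexVec_apply]
  simp

lemma exists_equiv_of_indexVec_eq {β γ : Type*} [Fintype β] [Fintype γ] {φ : β → ι} {ψ : γ → ι}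
    (h : indexVec φ = indexVec ψ) : ∃ e : β ≃ γ, ∀ x, ψ (e x) = φ x := by
  have (i : ι) : Nonempty ({x // φ x = i} ≃ {x // ψ x = i}) := by
    refine Fintype.card_eq.1 ?_
    have := congrFun h i
    rw [indexVec_apply, indexVec_apply] at this
    rw [Fintype.card_subtype, Fintype.card_subtype]
    exact_mod_cast this
  exact ⟨Equiv.ofFiberEquiv fun i => (this i).some, Equiv.ofFiberEquiv_map _⟩

/-- The tiles of an absorber: one tile for each root `b`,
in which `b` itself is replaced by the root,
and finitely many further tiles `ψ m`. -/
noncomputable def tileLabel {m N : ℕ} (K : α → Fin (m + 1) → ι) (cb : α → α → Fin (m + 1))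
    (ψ : Fin N → α → ι) (x : (α ⊕ Fin N) × α) : ι ⊕ α :=
  Sum.elim (fun b => if x.2 = b then .inr b else .inl (K b (cb b x.2)))
  (fun t => .inl (ψ t x.2)) x.1

lemma indexVec_tileLabel_inl {m N : ℕ} (K : α → Fin (m + 1) → ι) (cb : α → α → Fin (m + 1))
    (ψ : Fin N → α → ι) (i : ι) :
    indexVec (tileLabel K cb ψ) (.inl i) =
      (∑ b, ∑ v ∈ univ.filter (· ≠ b), (Pi.single (K b (cb b v)) 1 : ι → ℤ) +
        ∑ t, indexVec (ψ t)) i := by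
  rw [indexVec_eq_sum_ite, Fintype.sum_prod_type, Fintype.sum_sum_type]
  simp only [tileLabel, Sum.elim_inl, Sum.elim_inr, Pi.add_apply, Finset.sum_apply,
      indexVec_eq_sum_ite,
    Sum.inl.injEq]
  congr 1
  refine sum_congr rfl fun b _ => ?_
  rw [sum_filter]
  refine sum_congr rfl fun v _ => ?_
  by_cases hv : v = b
  · simp [hv]
  · simp [hv, Pi.single_apply, eq_comm]

lemma indexVec_tileLabel_inr {m N : ℕ} (K : α → Fin (m + 1) → ι) (cb : α → α → Fin (m + 1))
    (ψ : Fin N → α → ι) (a : α) : indexVec (tileLabel K cb ψ) (.inr a) = 1 := by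
  rw [indexVec_eq_sum_ite, Fintype.sum_prod_type, Fintype.sum_sum_type]
  simp only [tileLabel, Sum.elim_inl, Sum.elim_inr]
  have : ∀ b v : α, (if (if v = b then Sum.inr b else Sum.inl (K b (cb b v)) : ι ⊕ α) = .inr a
      then (1 : ℤ) else 0) = if v = b then (if b = a then 1 else 0) else 0 := by
    intro b v
    by_cases hv : v = b <;> simp [hv]
  simp [this]

lemma exists_tile_system [Nonempty α] {m : ℕ} (c : H.Coloring (Fin (m + 1)))
    (K : α → Fin (m + 1) → ι)
    (hK : ∀ a p p', p ≠ p' → R.Adj (K a p) (K a p'))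
    (hL : ∀ a b p p', (Pi.single (K a p) 1 - Pi.single (K b p') 1 : ι → ℤ) ∈ homLattice H R) :
    ∃ (N N' : ℕ) (π : Fin N → α → ι) (ψ : Fin N' → α → ι) (cb : α → α → Fin (m + 1))
      (e : (Fin N × α) ⊕ α ≃ (α ⊕ Fin N') × α),
      (∀ t u v, H.Adj u v → R.Adj (π t u) (π t v)) ∧ (∀ t u v, H.Adj u v → R.Adj (ψ t u) (ψ t v)) ∧
      (∀ b u v, H.Adj u v → cb b u ≠ cb b v) ∧ (∀ b, cb b b = 0) ∧
      ∀ x, tileLabel K cb ψ (e x) = Sum.map (fun k => π k.1 k.2) id x := by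
  set cb : α → α → Fin (m + 1) := fun b v => Equiv.swap (c b) 0 (c v) with hcb
  have hcb' : ∀ b u v, H.Adj u v → cb b u ≠ cb b v := fun b u v huv h =>
    c.valid huv ((Equiv.swap (c b) 0).injective h)
  obtain ⟨a₀⟩ := ‹Nonempty α›
  set E : ι → ℤ := Pi.single (K a₀ 0) 1 with hE
  have hψ : indexVec (fun v => K a₀ (c v)) ∈ homLattice H R :=
    indexVec_mem_homLattice (coloring_hom (hK a₀) c 1)
  have hE1 : Fintype.card α • E ∈ homLattice H R := by
    rw [← (homLattice H R).neg_mem_iff]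
    refine (AddSubgroup.add_mem_cancel_right _ hψ).1 ?_
    have : -(Fintype.card α • E) + indexVec (fun v => K a₀ (c v)) =
        ∑ v, ((Pi.single (K a₀ (c v)) 1 : ι → ℤ) - E) := by
      rw [sum_sub_distrib, sum_const, card_univ, indexVec]
      abel
    rw [this]
    exact (homLattice H R).sum_mem fun v _ => hL _ _ _ _
  have hu : (∑ b, ∑ v ∈ univ.filter (· ≠ b), (Pi.single (K b (cb b v)) 1 : ι → ℤ)) ∈
      homLattice H R := by
    have h1 : (∑ b, ∑ v ∈ univ.filter (· ≠ b), ((Pi.single (K b (cb b v)) 1 : ι → ℤ) - E)) ∈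
        homLattice H R :=
      (homLattice H R).sum_mem fun b _ => (homLattice H R).sum_mem fun v _ => hL _ _ _ _
    have h2 : ∑ b : α, ∑ v ∈ univ.filter (· ≠ b), E =
        (Fintype.card α - 1) • (Fintype.card α • E) := by
      simp only [sum_const, filter_ne', card_erase_of_mem (mem_univ _), card_univ]
      rw [smul_comm]
    simp only [sum_sub_distrib] at h1
    rw [h2] at h1
    rw [sub_eq_add_neg] at h1
    exact (AddSubgroup.add_mem_cancel_right _
      ((homLattice H R).neg_mem ((homLattice H R).nsmul_mem hE1 _))).1 h1
  obtain ⟨l₁, l₂, h1, h2, h3⟩ := AddSubgroup.exists_list_of_mem_closure hu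
  have hsum : indexVec (Sum.map (fun k : Fin l₂.length × α => l₂[k.1] k.2) (id : α → α)) =
      indexVec (tileLabel K cb fun t : Fin l₁.length => l₁[t]) := by
    funext i
    rcases i with i | a
    · rw [indexVec_tileLabel_inl]
      have h4 : ∑ t : Fin l₁.length, indexVec (l₁[t]) = (l₁.map indexVec).sum :=
        Fin.sum_univ_fun_getElem l₁ indexVec
      have h5 : ∑ t : Fin l₂.length, indexVec (l₂[t]) = (l₂.map indexVec).sum :=
        Fin.sum_univ_fun_getElem l₂ indexVec
      rw [h4, h3, ← h5, indexVec_eq_sum_ite, Fintype.sum_sum_type, Fintype.sum_prod_type]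
      simp [Finset.sum_apply, indexVec_eq_sum_ite]
    · rw [indexVec_tileLabel_inr, indexVec_eq_sum_ite, Fintype.sum_sum_type]
      simp
  obtain ⟨e, he⟩ := exists_equiv_of_indexVec_eq hsum
  refine ⟨l₂.length, l₁.length, fun t => l₂[t], fun t => l₁[t], cb, e, fun t => h2 _ (by simp),
    fun t => h1 _ (by simp), hcb', fun b => by simp [hcb], he⟩

lemma exists_absorbing_pattern [Nonempty α] {m : ℕ} (c : H.Coloring (Fin (m + 1)))
    (K : α → Fin (m + 1) → ι)
    (hK : ∀ a p p', p ≠ p' → R.Adj (K a p) (K a p'))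
    (hL : ∀ a b p p', (Pi.single (K a p) 1 - Pi.single (K b p') 1 : ι → ℤ) ∈ homLattice H R) :
    ∃ (N : ℕ) (π : Fin N × α → ι), ∀ {V : Type u} {G : SimpleGraph V} {F : Fin N × α → V}
      {X : α → V},
      (∀ k k', R.Adj (π k) (π k') → G.Adj (F k) (F k')) →
      (∀ a p k, p ≠ 0 → π k = K a p → G.Adj (X a) (F k)) → Function.Injective (Sum.elim F X) →
      Tileable H G (univ.image F) ∧ Tileable H G (univ.image F ∪ univ.image X) := by
  obtain ⟨N, N', π, ψ, cb, e, hπ, hψ, hcb, hcb0, he⟩ := exists_tile_system c K hK hL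
  refine ⟨N, fun k => π k.1 k.2, fun {V G F X} hF hX hinj => ⟨?_, ?_⟩⟩
  · have hFinj : Function.Injective F := fun x y h => Sum.inl_injective (hinj (by simpa using h))
    have : univ.image F = univ.biUnion fun t => univ.image fun v => F (t, v) := by
      ext x
      simp
    rw [this]
    refine Tileable.biUnion _ (fun t _ =>
        Tileable.image_copy ⟨fun u v h => ?_, fun u v huv => ?_⟩) ?_
    · simpa using hFinj h
    · exact hF _ _ (hπ t u v huv)
    · intro t _ t' _ htt
      rw [Function.onFun, Finset.disjoint_left]
      intro x hx hx'
      obtain ⟨u, -, rfl⟩ := mem_image.1 hx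
      obtain ⟨v, -, h⟩ := mem_image.1 hx'
      exact htt (by simpa using congrArg Prod.fst (hFinj h).symm)
  · set g : (α ⊕ Fin N') × α → V := fun x => Sum.elim F X (e.symm x) with hg
    have hginj : Function.Injective g := hinj.comp e.symm.injective
    have : univ.image F ∪ univ.image X = univ.biUnion fun t => univ.image fun v => g (t, v) := by
      ext x
      simp only [mem_union, mem_image, mem_univ, true_and, mem_biUnion]
      constructor
      · rintro (⟨k, rfl⟩ | ⟨a, rfl⟩)
        · exact ⟨(e (.inl k)).1, (e (.inl k)).2, by simp [hg]⟩
        · exact ⟨(e (.inr a)).1, (e (.inr a)).2, by simp [hg]⟩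
      · rintro ⟨t, v, rfl⟩
        simp only [hg]
        rcases e.symm (t, v) with k | a
        · exact Or.inl ⟨k, rfl⟩
        · exact Or.inr ⟨a, rfl⟩
    have hinl : ∀ x i, tileLabel K cb ψ x = .inl i → ∃ k, g x = F k ∧ π k.1 k.2 = i := by
      intro x i hx
      have := he (e.symm x)
      rw [e.apply_symm_apply, hx] at this
      simp only [hg]
      generalize e.symm x = y at this ⊢
      rcases y with k | a
      · exact ⟨k, rfl, by simpa using this.symm⟩
      · simp at this
    have hinr : ∀ x a, tileLabel K cb ψ x = .inr a → g x = X a := by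
      intro x a hx
      have := he (e.symm x)
      rw [e.apply_symm_apply, hx] at this
      simp only [hg]
      generalize e.symm x = y at this ⊢
      rcases y with k | a'
      · simp at this
      · have : a = a' := by simpa using this
        rw [this]; rfl
    rw [this]
    refine Tileable.biUnion _ (fun t _ =>
        Tileable.image_copy ⟨fun u v h => ?_, fun u v huv => ?_⟩) ?_
    · simpa using hginj h
    · rcases t with b | t
      · have hroot : ∀ v, H.Adj b v → G.Adj (g (.inl b, b)) (g (.inl b, v)) := by
          intro v hv
          rw [hinr (.inl b, b) b (by simp [tileLabel])]
          obtain ⟨k, hk, hk'⟩ := hinl (.inl b, v) (K b (cb b v)) (by simp [tileLabel, hv.ne'])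
          rw [hk]
          refine hX b (cb b v) k ?_ hk'
          rw [← hcb0 b]
          exact (hcb b b v hv).symm
        by_cases hu : u = b
        · subst hu
          exact hroot v huv
        by_cases hv : v = b
        · subst hv
          exact (hroot u huv.symm).symm
        · obtain ⟨k, hk, hk'⟩ := hinl (.inl b, u) (K b (cb b u)) (by simp [tileLabel, hu])
          obtain ⟨l, hl, hl'⟩ := hinl (.inl b, v) (K b (cb b v)) (by simp [tileLabel, hv])
          change G.Adj (g (.inl b, u)) (g (.inl b, v))
          rw [hk, hl]
          refine hF _ _ ?_
          simp only [hk', hl']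
          exact hK b _ _ (hcb b u v huv)
      · obtain ⟨k, hk, hk'⟩ := hinl (.inr t, u) (ψ t u) (by simp [tileLabel])
        obtain ⟨l, hl, hl'⟩ := hinl (.inr t, v) (ψ t v) (by simp [tileLabel])
        change G.Adj (g (.inr t, u)) (g (.inr t, v))
        rw [hk, hl]
        refine hF _ _ ?_
        simp only [hk', hl']
        exact hψ t u v huv
    · intro t _ t' _ htt
      rw [Function.onFun, Finset.disjoint_left]
      intro x hx hx'
      obtain ⟨u, -, rfl⟩ := mem_image.1 hx
      obtain ⟨v, -, h⟩ := mem_image.1 hx'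
      exact htt (by simpa using congrArg Prod.fst (hginj h).symm)

end Absorber

section BlowUp
open scoped Classical

lemma card_filter_cons {V : Type*} [Fintype V] {m : ℕ} (P : (Fin (m + 1) → V) → Prop)
    [DecidablePred P] [∀ x, DecidablePred fun f => P (Fin.cons x f)] :
    (univ.filter P).card = ∑ x, (univ.filter fun f : Fin m → V => P (Fin.cons x f)).card := by
  rw [← card_sigma]
  refine card_bij' (fun f _ => ⟨f 0, Fin.tail f⟩) (fun y _ => Fin.cons y.1 y.2) ?_ ?_ ?_ ?_ <;> simp

lemma blowup_arith {N a a' b f : ℝ} {T m : ℕ} (hN : 0 < N) (ha : 0 ≤ a) (ha' : 0 ≤ a')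
    (h1 : a ^ (T + 1) ^ m * N ≤ N ^ (T + 1) ^ m * a')
    (h2 : b ^ (T + 1) ≤ (N ^ ((T + 1) * m)) ^ T * f)
    (h3 : a' * N ^ ((T + 1) * m) ≤ b * N ^ (m * (T + 1) ^ m)) :
    a ^ (T + 1) ^ (m + 1) * N ^ ((T + 1) * (m + 1)) ≤ f * N ^ ((m + 1) * (T + 1) ^ (m + 1)) := by
  refine le_of_mul_le_mul_right ?_ (by positivity : 0 < (N ^ ((T + 1) * m)) ^ T)
  calc a ^ (T + 1) ^ (m + 1) * N ^ ((T + 1) * (m + 1)) * (N ^ ((T + 1) * m)) ^ T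
      = (a ^ (T + 1) ^ m * N * N ^ ((T + 1) * m)) ^ (T + 1) := by ring
    _ ≤ (N ^ (T + 1) ^ m * a' * N ^ ((T + 1) * m)) ^ (T + 1) := by gcongr
    _ = (N ^ (T + 1) ^ m * (a' * N ^ ((T + 1) * m))) ^ (T + 1) := by rw [mul_assoc]
    _ ≤ (N ^ (T + 1) ^ m * (b * N ^ (m * (T + 1) ^ m))) ^ (T + 1) := by gcongr
    _ = b ^ (T + 1) * N ^ ((m + 1) * (T + 1) ^ (m + 1)) := by ring
    _ ≤ ((N ^ ((T + 1) * m)) ^ T * f) * N ^ ((m + 1) * (T + 1) ^ (m + 1)) := by gcongr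
    _ = _ := by ring

lemma pow_card_mul_le_card_blowup {V : Type*} [Fintype V] [Nonempty V] (T m : ℕ)
    (P : (Fin m → V) → Prop) :
    ((univ.filter P).card : ℝ) ^ ((T + 1) ^ m) * (Fintype.card V : ℝ) ^ ((T + 1) * m) ≤
      ((univ.filter fun F : Fin m → Fin (T + 1) → V =>
        ∀ s : Fin m → Fin (T + 1), P fun i => F i (s i)).card : ℝ) *
        (Fintype.card V : ℝ) ^ (m * (T + 1) ^ m) := by
  induction m with
  | zero =>
    simp only [pow_zero, mul_zero, pow_one, mul_one]
    norm_cast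
    refine card_le_card_of_injOn (fun _ => Fin.elim0) (fun f hf => ?_) fun f _ g _ _ => by
      funext i; exact i.elim0
    simp only [coe_filter, Set.mem_ofPred_eq, mem_univ, true_and] at hf ⊢
    intro s
    convert hf
  | succ m ih =>
    set N : ℝ := ((Fintype.card V : ℕ) : ℝ) with hN
    have hN0 : 0 < N := by simp only [hN]; exact_mod_cast Fintype.card_pos
    set e := (T + 1) ^ m with he
    have he0 : 0 < e := by positivity
    obtain ⟨e', he'⟩ : ∃ e', e = e' + 1 := ⟨e - 1, by omega⟩
    set Q : V → (Fin m → Fin (T + 1) → V) → Prop := fun x F =>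
      ∀ s : Fin m → Fin (T + 1), P (Fin.cons x fun i => F i (s i)) with hQ
    set A : V → ℝ := fun x => (univ.filter fun f : Fin m → V => P (Fin.cons x f)).card with hA
    set B : V → ℝ := fun x => (univ.filter (Q x)).card with hB
    have hA' : ((univ.filter P).card : ℝ) = ∑ x, A x := by
      rw [card_filter_cons]; push_cast; rfl
    have hF : ((univ.filter fun F : Fin (m + 1) → Fin (T + 1) → V =>
        ∀ s : Fin (m + 1) → Fin (T + 1), P fun i => F i (s i)).card : ℝ) =
        ∑ F : Fin m → Fin (T + 1) → V, ((univ.filter fun x => Q x F).card : ℝ) ^ (T + 1) := by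
      rw [card_filter_cons]
      have hx : ∀ (w : Fin (T + 1) → V) (F : Fin m → Fin (T + 1) → V),
          (∀ s : Fin (m + 1) → Fin (T + 1), P fun i => (Fin.cons w F : Fin (m + 1) → _) i (s i)) ↔
            ∀ t, Q (w t) F := by
        intro w F
        have hc : ∀ t (s : Fin m → Fin (T + 1)),
            (fun i => (Fin.cons w F : Fin (m + 1) → Fin (T + 1) → V) i
              ((Fin.cons t s : Fin (m + 1) → Fin (T + 1)) i)) =
            Fin.cons (w t) fun i => F i (s i) := by
          intro t s
          funext i
          refine Fin.cases ?_ (fun j => ?_) i <;> simp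
        refine ⟨fun h t s => ?_, fun h s => ?_⟩
        · rw [← hc]
          exact h _
        · have := h (s 0) (Fin.tail s)
          rwa [← hc, Fin.cons_self_tail] at this
      simp_rw [hx]
      have hd := sum_card_bipartiteAbove_eq_sum_card_bipartiteBelow
        (s := (univ : Finset (Fin (T + 1) → V))) (t := (univ : Finset (Fin m → Fin (T + 1) → V)))
        (fun w F => ∀ t, Q (w t) F)
      simp only [bipartiteAbove, bipartiteBelow] at hd
      rw [hd]
      push_cast
      refine sum_congr rfl fun F _ => ?_
      norm_cast
      have : (univ.filter fun w : Fin (T + 1) → V => ∀ t, Q (w t) F) =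
          Fintype.piFinset fun _ => univ.filter fun x => Q x F := by
        ext; simp
      rw [this, Fintype.card_piFinset_const]
    have hA0 : ∀ x, 0 ≤ A x := fun x => by positivity
    have h1 : (∑ x, A x) ^ e * N ≤ N ^ e * ∑ x, A x ^ e := by
      have := pow_sum_le_card_mul_sum_pow (s := univ) (fun x _ => hA0 x) e'
      rw [← he', card_univ, ← hN] at this
      calc (∑ x, A x) ^ e * N ≤ (N ^ e' * ∑ x, A x ^ e) * N := by gcongr
        _ = _ := by rw [he']; ring
    have h2 : (∑ x, B x) ^ (T + 1) ≤ (N ^ ((T + 1) * m)) ^ T *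
        ∑ F : Fin m → Fin (T + 1) → V, ((univ.filter fun x => Q x F).card : ℝ) ^ (T + 1) := by
      have hd := sum_card_bipartiteAbove_eq_sum_card_bipartiteBelow
        (s := (univ : Finset V)) (t := (univ : Finset (Fin m → Fin (T + 1) → V))) Q
      simp only [bipartiteAbove, bipartiteBelow] at hd
      have hB' : ∑ x, B x = ∑ F : Fin m → Fin (T + 1) → V,
          ((univ.filter fun x => Q x F).card : ℝ) := by
        simp only [hB]
        exact_mod_cast hd
      rw [hB']
      have := pow_sum_le_card_mul_sum_pow (s := univ)
        (f := fun F : Fin m → Fin (T + 1) → V => ((univ.filter fun x => Q x F).card : ℝ))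
        (fun x _ => by positivity) T
      refine this.trans_eq ?_
      rw [card_univ, Fintype.card_fun, Fintype.card_fun, Fintype.card_fin, Fintype.card_fin]
      push_cast
      rw [← pow_mul, ← pow_mul, ← pow_mul, ← hN]
      congr 2
      ring
    have h3 : (∑ x, A x ^ e) * N ^ ((T + 1) * m) ≤ (∑ x, B x) * N ^ (m * e) := by
      rw [sum_mul, sum_mul]
      exact sum_le_sum fun x _ => ih _
    rw [hA', hF]
    exact blowup_arith hN0 (sum_nonneg fun x _ => hA0 x)
      (sum_nonneg fun x _ => pow_nonneg (hA0 x) _) h1 h2 h3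

lemma le_card_blowup {ι : Type*} [Fintype ι] [DecidableEq ι] {V : Type*} [Fintype V]
    [Nonempty V] (T : ℕ)
    {c : ℝ} (hc : 0 ≤ c) (P : (ι → V) → Prop)
    (hP : c * (Fintype.card V : ℝ) ^ Fintype.card ι ≤ (univ.filter P).card) :
    c ^ ((T + 1) ^ Fintype.card ι) * (Fintype.card V : ℝ) ^ Fintype.card (ι × Fin (T + 1)) ≤
      (univ.filter fun F : ι × Fin (T + 1) → V =>
        ∀ s : ι → Fin (T + 1), P fun i => F (i, s i)).card := by
  obtain ⟨m, hm⟩ : ∃ m, m = Fintype.card ι := ⟨_, rfl⟩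
  rw [← hm] at hP ⊢
  let e : ι ≃ Fin m := Fintype.equivFinOfCardEq hm.symm
  have hV : (0 : ℝ) < Fintype.card V := by exact_mod_cast Fintype.card_pos
  have h1 : (univ.filter P).card =
      (univ.filter fun f : Fin m → V => P fun i => f (e i)).card := by
    refine card_equiv (e.arrowCongr (Equiv.refl V)) fun f => ?_
    simp only [mem_filter, mem_univ, true_and]
    have : (fun i => (e.arrowCongr (Equiv.refl V) f) (e i)) = f :=
      funext fun i => congrArg f (e.symm_apply_apply i)
    rw [this]
  have h2 : (univ.filter fun F : ι × Fin (T + 1) → V =>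
        ∀ s : ι → Fin (T + 1), P fun i => F (i, s i)).card =
      (univ.filter fun F : Fin m → Fin (T + 1) → V =>
        ∀ s : Fin m → Fin (T + 1), P fun i => F (e i) (s (e i))).card := by
    refine card_equiv ((Equiv.curry _ _ _).trans (e.arrowCongr (Equiv.refl _))) fun F => ?_
    simp only [mem_filter, mem_univ, true_and]
    refine ⟨fun h s => ?_, fun h s => ?_⟩
    · have := h fun i => s (e i)
      convert this using 2 with i
      exact congrArg (fun j => F (j, s (e i))) (e.symm_apply_apply i)
    · have := h fun i => s (e.symm i)
      convert this using 2 with i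
      simp [Equiv.arrowCongr, Equiv.curry]
  have h3 := pow_card_mul_le_card_blowup T m fun f : Fin m → V => P fun i => f (e i)
  rw [h2]
  rw [h1] at hP
  refine le_of_mul_le_mul_right (le_trans (le_of_eq ?_) ((mul_le_mul_of_nonneg_right
    (pow_le_pow_left₀ (by positivity) hP ((T + 1) ^ m)) (by positivity)).trans h3))
    (by positivity : 0 < (Fintype.card V : ℝ) ^ (m * (T + 1) ^ m))
  rw [Fintype.card_prod, Fintype.card_fin, ← hm]
  ring

end BlowUp

section Selection
open scoped Classical

variable {κ V : Type*} [Fintype κ] [DecidableEq κ] [Fintype V]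

lemma card_le_pow_pred_of_determined (i : κ) (A : Finset (κ → V))
    (hA : ∀ F ∈ A, ∀ F' ∈ A, (∀ x, x ≠ i → F x = F' x) → F = F') :
    A.card ≤ Fintype.card V ^ (Fintype.card κ - 1) := by
  have h : Fintype.card ({x // x ≠ i} → V) = Fintype.card V ^ (Fintype.card κ - 1) := by
    rw [Fintype.card_fun, Fintype.card_subtype_compl, Fintype.card_subtype_eq]
  rw [← h, ← card_univ]
  refine card_le_card_of_injOn (fun F x => F x.1) (fun _ _ => mem_coe.2 (mem_univ _))
    fun F hF F' hF' hFF' => hA F hF F' hF' fun x hx => congrFun hFF' ⟨x, hx⟩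

lemma card_filter_exists_mem_le (U : Finset V) :
    (univ.filter fun F : κ → V => ∃ i, F i ∈ U).card ≤
      Fintype.card κ * (U.card * Fintype.card V ^ (Fintype.card κ - 1)) := by
  have h : (univ.filter fun F : κ → V => ∃ i, F i ∈ U) ⊆
      univ.biUnion fun i => U.biUnion fun u => univ.filter fun F : κ → V => F i = u := by
    intro F hF
    simpa using hF
  refine (card_le_card h).trans (card_biUnion_le_card_mul _ _ _ fun i _ =>
    card_biUnion_le_card_mul _ _ _ fun u _ => card_le_pow_pred_of_determined i _ ?_)
  intro F hF F' hF' hFF'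
  funext x
  by_cases hx : x = i
  · rw [hx, (mem_filter.1 hF).2, (mem_filter.1 hF').2]
  · exact hFF' x hx

lemma card_filter_not_injective_le :
    (univ.filter fun F : κ → V => ¬ Function.Injective F).card ≤
      Fintype.card κ * (Fintype.card κ * Fintype.card V ^ (Fintype.card κ - 1)) := by
  have h : (univ.filter fun F : κ → V => ¬ Function.Injective F) ⊆
      univ.biUnion fun i => univ.biUnion fun j =>
        univ.filter fun F : κ → V => i ≠ j ∧ F i = F j := by
    intro F hF
    have hF := (mem_filter.1 hF).2
    unfold Function.Injective at hF
    push Not at hF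
    obtain ⟨i, j, h1, h2⟩ := hF
    simp only [mem_biUnion, mem_filter, mem_univ, true_and]
    exact ⟨i, j, h2, h1⟩
  refine (card_le_card h).trans (card_biUnion_le_card_mul _ _ _ fun i _ =>
    card_biUnion_le_card_mul _ _ _ fun j _ => card_le_pow_pred_of_determined i _ ?_)
  intro F hF F' hF' hFF'
  obtain ⟨-, hij, h1⟩ := mem_filter.1 hF
  obtain ⟨-, -, h2⟩ := mem_filter.1 hF'
  funext x
  by_cases hx : x = i
  · rw [hx, h1, h2, hFF' j hij.symm]
  · exact hFF' x hx

/-- Pairwise disjoint members of a family of maps can be chosen such that every `X` is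
related to many of them, provided that every `X` is related to a positive proportion of all
maps. This is the derandomised version of a random choice. -/
lemma exists_disjoint_family [Nonempty κ] [Nonempty V] {Ξ : Type*} [Fintype Ξ]
    (A : Ξ → (κ → V) → Prop) {δ : ℝ} (hδ1 : δ ≤ 1)
    (hA : ∀ X, δ * (Fintype.card V : ℝ) ^ Fintype.card κ ≤ (univ.filter (A X)).card) (T : ℕ)
    (hT : 2 * (Fintype.card κ : ℝ) ^ 2 * T ≤ δ * Fintype.card V) :
    ∃ L : Finset (κ → V), L.card ≤ T ∧
      (∀ F ∈ L, ∀ F' ∈ L, F ≠ F' → ∀ i j, F i ≠ F' j) ∧ (∀ F ∈ L, ∃ X, A X F) ∧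
      ∑ X, (1 / 2 : ℝ) ^ (L.filter (A X)).card ≤ (1 - δ / 4) ^ T * Fintype.card Ξ := by
  induction T with
  | zero => exact ⟨∅, by simp⟩
  | succ T ih =>
    push_cast at hT
    obtain ⟨L, hL, hd, hX, hs⟩ := ih (by nlinarith [sq_nonneg (Fintype.card κ : ℝ)])
    set n : ℝ := ((Fintype.card V : ℕ) : ℝ) with hn
    have hn0 : 0 < n := by rw [hn]; exact_mod_cast Fintype.card_pos
    obtain ⟨k, hk⟩ : ∃ k, Fintype.card κ = k + 1 :=
      ⟨Fintype.card κ - 1, by have := Fintype.card_pos (α := κ); omega⟩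
    rw [hk] at hT hA
    set U := L.biUnion fun F => univ.image F with hU
    have hUc : U.card ≤ T * (k + 1) := by
      refine (card_biUnion_le_card_mul _ _ (k + 1) fun F _ => ?_).trans (by gcongr)
      rw [← hk]
      exact card_image_le
    set B : Ξ → (κ → V) → Prop := fun X F => A X F ∧ ∀ i, F i ∉ U with hB
    have hBc : ∀ X, δ / 2 * n ^ (k + 1) ≤ (univ.filter (B X)).card := by
      intro X
      have h1 : univ.filter (A X) ⊆
          univ.filter (B X) ∪ univ.filter fun F : κ → V => ∃ i, F i ∈ U := by
        intro F hF
        simp only [mem_filter, mem_univ, true_and, mem_union, hB] at hF ⊢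
        by_cases h : ∃ i, F i ∈ U
        · exact .inr h
        · exact .inl ⟨hF, by simpa using h⟩
      have h2 := (card_le_card h1).trans ((card_union_le _ _).trans
        (Nat.add_le_add_left (card_filter_exists_mem_le U) _))
      rw [hk, Nat.add_sub_cancel] at h2
      have h3 : ((univ.filter (A X)).card : ℝ) ≤
          (univ.filter (B X)).card + ((k + 1 : ℕ) : ℝ) * (U.card * n ^ k) := by
        rw [hn]; exact_mod_cast h2
      have h4 : (U.card : ℝ) ≤ T * (k + 1) := by exact_mod_cast hUc
      have h5 : ((k + 1 : ℕ) : ℝ) * (U.card * n ^ k) ≤ δ / 2 * n * n ^ k := by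
        push_cast at hT ⊢
        rw [← mul_assoc]
        refine mul_le_mul_of_nonneg_right ?_ (by positivity)
        nlinarith
      have := hA X
      rw [pow_succ] at this ⊢
      nlinarith
    have hcard : ((univ : Finset (κ → V)).card : ℝ) = n ^ (k + 1) := by
      rw [card_univ, Fintype.card_fun, hk, hn]; push_cast; rfl
    set y : Ξ → ℝ := fun X => (1 / 2 : ℝ) ^ (L.filter (A X)).card with hy
    have hy0 : ∀ X, 0 < y X := fun X => by positivity
    obtain ⟨F, -, hF⟩ : ∃ F ∈ (univ : Finset (κ → V)),
        ∑ X, y X * (1 - if B X F then 1 / 2 else 0) ≤ (1 - δ / 4) * ∑ X, y X := by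
      refine exists_le_of_sum_le univ_nonempty ?_
      rw [sum_const, nsmul_eq_mul, hcard, sum_comm]
      have : ∀ X, ∑ F, y X * (1 - if B X F then (1 / 2 : ℝ) else 0) ≤
          n ^ (k + 1) * ((1 - δ / 4) * y X) := by
        intro X
        rw [← mul_sum, sum_sub_distrib, sum_const, nsmul_eq_mul, hcard, ← sum_filter, sum_const,
          nsmul_eq_mul]
        have := hBc X
        have h0 := hy0 X
        have : n ^ (k + 1) * 1 - ((univ.filter (B X)).card : ℝ) * (1 / 2) ≤
          n ^ (k + 1) * (1 - δ / 4) := by nlinarith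
        calc _ ≤ y X * (n ^ (k + 1) * (1 - δ / 4)) := by gcongr
          _ = _ := by ring
      refine (sum_le_sum fun X _ => this X).trans_eq ?_
      rw [← mul_sum, ← mul_sum]
    have hstep : (1 - δ / 4) * ∑ X, y X ≤ (1 - δ / 4) ^ (T + 1) * Fintype.card Ξ := by
      rw [pow_succ', mul_assoc]
      gcongr
      linarith
    by_cases hFB : ∃ X, B X F
    · obtain ⟨X₀, hX₀⟩ := hFB
      have hFU := hX₀.2
      have hne : ∀ F' ∈ L, ∀ i j, F i ≠ F' j := fun F' hF' i j h =>
        hFU i (h ▸ mem_biUnion.2 ⟨F', hF', mem_image_of_mem _ (mem_univ _)⟩)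
      have hFL : F ∉ L := fun h => hne F h (Classical.arbitrary κ) _ rfl
      refine ⟨insert F L, by rw [card_insert_of_notMem hFL]; omega, ?_, ?_, ?_⟩
      · intro F₁ h1 F₂ h2 h12 i j
        rcases mem_insert.1 h1 with h1 | h1 <;> rcases mem_insert.1 h2 with h2 | h2
        · exact absurd (h1.trans h2.symm) h12
        · exact h1 ▸ hne _ h2 i j
        · exact h2 ▸ (hne _ h1 j i).symm
        · exact hd _ h1 _ h2 h12 i j
      · intro F' hF'
        rcases mem_insert.1 hF' with rfl | hF'
        · exact ⟨X₀, hX₀.1⟩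
        · exact hX _ hF'
      · refine le_trans (le_of_eq (sum_congr rfl fun X _ => ?_)) (hF.trans hstep)
        rw [filter_insert]
        by_cases hXF : A X F
        · rw [if_pos hXF, if_pos ⟨hXF, hFU⟩,
            card_insert_of_notMem (fun h => hFL (mem_filter.1 h).1), pow_succ]
          ring
        · rw [if_neg hXF, if_neg fun h => hXF h.1]
          simp [hy]
    · push Not at hFB
      refine ⟨L, by omega, hd, hX, le_trans (le_of_eq (sum_congr rfl fun X _ => ?_))
        (hF.trans hstep)⟩
      rw [if_neg (hFB X)]
      simp [hy]

end Selection

section Absorb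
open scoped Classical

/-- Every root set is absorbed by all sections of the map `F`, and `F` avoids the roots. -/
def IsAbsorber {α V : Type*} {d m : ℕ} (G : SimpleGraph V) (X : α → V)
    (F : Option (α × Cell d) × Fin m → V) : Prop :=
  (∀ s : Option (α × Cell d) → Fin m, IsGadget G X fun i => F (i, s i)) ∧
    Function.Injective (Sum.elim F X)

lemma half_mul_le_card_filter_injective {α κ V : Type*} [Fintype α] [Fintype κ] [DecidableEq κ]
    [Nonempty κ]
    [Fintype V] {X : α → V} (hX : Function.Injective X) (Q : (κ → V) → Prop)
    [DecidablePred Q] [DecidablePred fun F => Q F ∧ Function.Injective (Sum.elim F X)] {c : ℝ}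
    (hn : 2 * (Fintype.card κ * (Fintype.card κ + Fintype.card α) : ℝ) ≤ c * Fintype.card V)
    (hQ : c * (Fintype.card V : ℝ) ^ Fintype.card κ ≤ (univ.filter Q).card) :
    c / 2 * (Fintype.card V : ℝ) ^ Fintype.card κ ≤
      (univ.filter fun F : κ → V => Q F ∧ Function.Injective (Sum.elim F X)).card := by
  obtain ⟨k, hk⟩ : ∃ k, Fintype.card κ = k + 1 :=
    ⟨Fintype.card κ - 1, by have := Fintype.card_pos (α := κ); omega⟩
  have h2 : univ.filter Q ⊆ (univ.filter fun F => Q F ∧ Function.Injective (Sum.elim F X)) ∪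
      ((univ.filter fun F => ¬ Function.Injective F) ∪
        univ.filter fun F => ∃ i, F i ∈ univ.image X) := by
    intro F hF
    simp only [mem_union, mem_filter, mem_univ, true_and] at hF ⊢
    by_cases hi : Function.Injective F
    · by_cases hm : ∃ i, F i ∈ univ.image X
      · exact .inr (.inr hm)
      · refine .inl ⟨hF, hi.sumElim hX fun i a hia => hm ⟨i, ?_⟩⟩
        rw [hia]
        exact mem_image_of_mem _ (mem_univ _)
    · exact .inr (.inl hi)
  have h3 := (card_le_card h2).trans ((card_union_le _ _).trans
    (Nat.add_le_add_left (card_union_le _ _) _))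
  have h4 := card_filter_not_injective_le (κ := κ) (V := V)
  have h5 := card_filter_exists_mem_le (κ := κ) (univ.image X)
  have h6 : (univ.image X).card ≤ Fintype.card α := card_image_le
  rw [hk] at h4 h5 hQ hn ⊢
  rw [Nat.add_sub_cancel] at h4 h5
  generalize Fintype.card V = n at *
  have h5' := h5.trans (Nat.mul_le_mul_left (k + 1) (Nat.mul_le_mul_right (n ^ k) h6))
  have h7 := h3.trans (Nat.add_le_add_left (Nat.add_le_add h4 h5') _)
  have h8 : ((univ.filter Q).card : ℝ) ≤
      (univ.filter fun F => Q F ∧ Function.Injective (Sum.elim F X)).card +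
        ((k + 1 : ℕ) * ((k + 1 : ℕ) * (n : ℝ) ^ k) + (k + 1 : ℕ) *
          (Fintype.card α * (n : ℝ) ^ k)) := by
    exact_mod_cast h7
  have h9 := mul_le_mul_of_nonneg_right hn (by positivity : 0 ≤ (n : ℝ) ^ k)
  rw [pow_succ] at hQ ⊢
  linarith

lemma exists_forall_le_card_injective_blowup (α ι : Type*) [Fintype α] [Fintype ι]
    [DecidableEq ι] [Nonempty ι] (T : ℕ) {c : ℝ} (hc : 0 < c) :
    ∃ c' : ℝ, 0 < c' ∧ c' ≤ 1 ∧ ∃ n₀ : ℕ, ∀ (V : Type u) [Fintype V] (X : α → V)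
      (P : (ι → V) → Prop) [DecidablePred fun F : ι × Fin (T + 1) → V =>
        (∀ s : ι → Fin (T + 1), P fun i => F (i, s i)) ∧ Function.Injective (Sum.elim F X)],
          n₀ ≤ Fintype.card V → Function.Injective X →
      c * (Fintype.card V : ℝ) ^ Fintype.card ι ≤ (univ.filter P).card →
        c' * (Fintype.card V : ℝ) ^ Fintype.card (ι × Fin (T + 1)) ≤
          (univ.filter fun F : ι × Fin (T + 1) → V =>
            (∀ s : ι → Fin (T + 1), P fun i => F (i, s i)) ∧
              Function.Injective (Sum.elim F X)).card := by
  set c' := c ^ ((T + 1) ^ Fintype.card ι) with hc'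
  have hc0 : 0 < c' := by positivity
  obtain ⟨k, hk⟩ : ∃ k, k = Fintype.card (ι × Fin (T + 1)) := ⟨_, rfl⟩
  obtain ⟨n₀, hn₀⟩ := exists_nat_ge (2 * (k * (k + Fintype.card α)) / c' : ℝ)
  refine ⟨min (c' / 2) 1, by positivity, min_le_right _ _, n₀ + 1, fun V _ X P _ hn hX hP => ?_⟩
  have : Nonempty V := Fintype.card_pos_iff.1 (by omega)
  have h1 := le_card_blowup T hc.le P hP
  rw [div_le_iff₀ hc0] at hn₀
  have h2 : (n₀ : ℝ) ≤ Fintype.card V := by exact_mod_cast (by omega)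
  refine le_trans ?_ (half_mul_le_card_filter_injective hX _ ?_ h1)
  · gcongr
    exact min_le_left _ _
  · rw [← hk]
    nlinarith

lemma DegCond.exists_le_card_isAbsorber {α : Type*} [Fintype α] {w s η : ℝ} {d : ℕ} (T : ℕ)
    (hs : 0 < s) (hw : 0 < w) (hη : 0 < η) (hsw : s + (d + 1 : ℕ) * w = 1) :
    ∃ c : ℝ, 0 < c ∧ c ≤ 1 ∧ ∃ n₀ : ℕ, ∀ (V : Type u) [Fintype V] (G : SimpleGraph V),
      n₀ ≤ Fintype.card V → DegCond G w s η → ∀ X : α → V, Function.Injective X →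
        c * (Fintype.card V : ℝ) ^ Fintype.card (Option (α × Cell d) × Fin (T + 1)) ≤
          (univ.filter fun F : Option (α × Cell d) × Fin (T + 1) → V =>
            IsAbsorber G X F).card := by
  obtain ⟨c, hc, h⟩ := DegCond.exists_le_card_isGadget (α := α) hs hw hη hsw
  obtain ⟨c', hc', hc1, n₀, h'⟩ :=
    exists_forall_le_card_injective_blowup.{u} α (Option (α × Cell d)) T hc
  refine ⟨c', hc', hc1, n₀, fun V _ G hn hG X hX => ?_⟩
  refine (h' V X (fun f => IsGadget G X f) hn hX (h V G hG X)).trans ?_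
  refine Nat.cast_le.2 (card_le_card fun F hF => ?_)
  rw [mem_filter] at hF ⊢
  exact hF

lemma exists_forall_pow_lt_two_pow_floor (m : ℕ) {β : ℝ} (hβ : 0 < β) :
    ∃ n₀ : ℕ, ∀ n : ℕ, n₀ ≤ n → (n : ℝ) ^ m < 2 ^ ⌊β * n⌋₊ := by
  have hρ : (1 : ℝ) < 2 ^ β := Real.one_lt_rpow (by norm_num) hβ
  have h := tendsto_pow_const_div_const_pow_of_one_lt m hρ
  obtain ⟨n₀, hn₀⟩ := Filter.eventually_atTop.1
      (h.eventually_lt_const (by norm_num : (0 : ℝ) < 1 / 2))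
  refine ⟨n₀, fun n hn => ?_⟩
  have h1 := hn₀ n hn
  rw [div_lt_iff₀ (by positivity)] at h1
  have h2 : ((2 : ℝ) ^ β) ^ n ≤ 2 ^ ⌊β * n⌋₊ * 2 := by
    rw [← Real.rpow_natCast, ← Real.rpow_mul (by norm_num), ← pow_succ, ← Real.rpow_natCast]
    refine Real.rpow_le_rpow_of_exponent_le (by norm_num) ?_
    push_cast
    exact (Nat.lt_floor_add_one _).le
  linarith

/-- Sets are absorbed greedily by a family of absorbers that has many absorbers for each
set of `Fintype.card α` vertices. -/
lemma tileable_biUnion_union {α : Type*} [Fintype α] [Nonempty α] {H : SimpleGraph α}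
    {V : Type u} [Fintype V] {G : SimpleGraph V} {K : Type*} (A : (α ↪ V) → K → Prop)
    (S : K → Finset V) (L : Finset K) (hS : (L : Set K).PairwiseDisjoint S)
    (h1 : ∀ F ∈ L, Tileable H G (S F))
    (h2 : ∀ F ∈ L, ∀ X, A X F → Tileable H G (S F ∪ univ.image X)) (t : ℕ)
    (hA : ∀ X, t ≤ (L.filter (A X)).card) (W : Finset V) (hW : W.card = Fintype.card α * t)
    (hd : Disjoint (L.biUnion S) W) : Tileable H G (L.biUnion S ∪ W) := by
  induction t generalizing L W with
  | zero =>
    rw [mul_zero, card_eq_zero] at hW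
    rw [hW, union_empty]
    exact Tileable.biUnion L h1 hS
  | succ t ih =>
    obtain ⟨W', hW', hc⟩ := exists_subset_card_eq (s := W) (n := Fintype.card α)
      (by rw [hW]; exact Nat.le_mul_of_pos_right _ (by omega))
    have e : α ≃ W' := Fintype.equivOfCardEq (by simp [hc])
    set X : α ↪ V := e.toEmbedding.trans (Function.Embedding.subtype _) with hX
    have hXW : univ.image X = W' := by
      ext v
      simp only [mem_image, mem_univ, true_and]
      refine ⟨fun ⟨a, ha⟩ => ha ▸ (e a).2, fun hv => ⟨e.symm ⟨v, hv⟩, ?_⟩⟩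
      simp [hX]
    obtain ⟨F, hF⟩ := card_pos.1 (lt_of_lt_of_le (Nat.succ_pos t) (hA X))
    obtain ⟨hFL, hXF⟩ := mem_filter.1 hF
    have hsub : (L.erase F).biUnion S ⊆ L.biUnion S :=
      biUnion_subset_biUnion_of_subset_left _ (erase_subset _ _)
    have hrest := ih (L.erase F) (hS.subset (coe_subset.2 (erase_subset _ _)))
      (fun F' hF' => h1 F' (mem_of_mem_erase hF')) (fun F' hF' => h2 F' (mem_of_mem_erase hF'))
      (fun X' => by
        rw [filter_erase]
        have := hA X'
        have := pred_card_le_card_erase (s := L.filter (A X')) (a := F)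
        omega)
      (W \ W') (by rw [card_sdiff_of_subset hW', hW, hc, Nat.mul_succ, Nat.add_sub_cancel])
      (hd.mono hsub sdiff_subset)
    have heq : L.biUnion S ∪ W = ((L.erase F).biUnion S ∪ W \ W') ∪ (S F ∪ W') := by
      conv_lhs => rw [← insert_erase hFL, biUnion_insert, ← sdiff_union_of_subset hW']
      ext v
      simp only [mem_union]
      tauto
    rw [heq]
    have h3 := h2 F hFL X hXF
    rw [hXW] at h3
    refine hrest.union h3 ?_
    have hFS : S F ⊆ L.biUnion S := subset_biUnion_of_mem S hFL
    rw [disjoint_union_left, disjoint_union_right, disjoint_union_right]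
    refine ⟨⟨?_, hd.mono hsub hW'⟩, (hd.mono hFS sdiff_subset).symm, sdiff_disjoint⟩
    rw [disjoint_biUnion_left]
    exact fun F' hF' => hS (mem_of_mem_erase hF') hFL (ne_of_mem_erase hF')

theorem exists_absorbing_set {α : Type*} [Fintype α] [Nonempty α] {H : SimpleGraph α} {d : ℕ}
    (hH : HcfOne H (d + 2)) (c : H.Coloring (Fin (d + 2))) {w s η μ : ℝ}
    (hs : 0 < s) (hw : 0 < w) (hη : 0 < η) (hsw : s + (d + 1 : ℕ) * w = 1) (hμ : 0 < μ) :
    ∃ β : ℝ, 0 < β ∧ ∃ n₀ : ℕ, ∀ (V : Type u) [Fintype V] (G : SimpleGraph V),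
      n₀ ≤ Fintype.card V → DegCond G w s η →
      ∃ M : Finset V, (M.card : ℝ) ≤ μ * Fintype.card V ∧
        ∀ W : Finset V, Disjoint M W → Fintype.card α ∣ W.card →
          (W.card : ℝ) ≤ β * Fintype.card V → Tileable H G (M ∪ W) := by
  obtain ⟨N, π, hπ⟩ := exists_absorbing_pattern.{u} (R := gadgetGraph α d) c
    (fun a p => gadgetClique d a 0 p)
    (fun a p p' h => gadgetClique_adj a (fun _ => rfl) p p' h)
    (fun a b p p' => gadget_single_sub_single_mem hH a b p p')
  set T₀ := Fintype.card (Fin N × α) with hT₀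
  obtain ⟨δ, hδ0, hδ1, n₁, hδ⟩ :=
    DegCond.exists_le_card_isAbsorber.{u} (α := α) T₀ hs hw hη hsw
  let e := Fintype.equivFin (Fin N × α)
  let j : Fin N × α → Option (α × Cell d) × Fin (T₀ + 1) := fun k => (π k, (e k).castSucc)
  have hj : Function.Injective j := fun k k' h =>
    e.injective (Fin.castSucc_injective _ (Prod.ext_iff.1 h).2)
  have habs : ∀ {V : Type u} {G : SimpleGraph V} {F : Option (α × Cell d) × Fin (T₀ + 1) → V}
      {X : α → V}, IsAbsorber G X F → Tileable H G (univ.image (F ∘ j)) ∧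
        Tileable H G (univ.image (F ∘ j) ∪ univ.image X) := by
    intro V G F X hF
    refine hπ (fun k k' hk => ?_) (fun a p k hp hk => ?_) ?_
    · have := (hF.1 fun i => if i = π k then (e k).castSucc else (e k').castSucc).1 _ _ hk
      simpa [hk.ne'] using this
    · have := (hF.1 fun i => (e k).castSucc).2 a p hp
      rw [← hk] at this
      exact this
    · have : Sum.elim (F ∘ j) X = Sum.elim F X ∘ Sum.map j id := by
        ext i; cases i <;> rfl
      rw [this]
      exact hF.2.comp (hj.sumMap Function.injective_id)
  set k := Fintype.card (Option (α × Cell d) × Fin (T₀ + 1)) with hk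
  have hk0 : (0 : ℝ) < k := by exact_mod_cast (Fintype.card_pos : 0 < k)
  obtain ⟨ℓ, hℓ⟩ := exists_pow_lt_of_lt_one (by norm_num : (0 : ℝ) < 1 / 4)
    (by linarith : 1 - δ / 4 < 1)
  set β : ℝ := min (δ / (2 * k ^ 2 * (ℓ + 1))) (μ / (k * (ℓ + 1))) with hβ
  have hβ0 : 0 < β := by positivity
  obtain ⟨n₂, hn₂⟩ := exists_forall_pow_lt_two_pow_floor (Fintype.card α) hβ0
  refine ⟨β, hβ0, n₁ + n₂ + 1, fun V _ G hn hG => ?_⟩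
  have : Nonempty V := Fintype.card_pos_iff.1 (by omega)
  set n : ℝ := ((Fintype.card V : ℕ) : ℝ) with hnn
  have hn0 : 0 < n := by rw [hnn]; exact_mod_cast Fintype.card_pos
  set b := ⌊β * n⌋₊ with hb
  have hbn : (b : ℝ) ≤ β * n := Nat.floor_le (by positivity)
  have hβ1 : β * (2 * k ^ 2 * (ℓ + 1)) ≤ δ := (le_div_iff₀ (by positivity)).1 (min_le_left _ _)
  have hβ2 : β * (k * (ℓ + 1)) ≤ μ := (le_div_iff₀ (by positivity)).1 (min_le_right _ _)
  have hbℓ : ((ℓ * b : ℕ) : ℝ) ≤ (ℓ + 1) * (β * n) := by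
    push_cast
    gcongr
    linarith
  obtain ⟨L, hL, hLd, hLX, hLs⟩ := exists_disjoint_family
    (κ := Option (α × Cell d) × Fin (T₀ + 1)) (V := V) (Ξ := α ↪ V)
    (fun X F => IsAbsorber G X F) hδ1
    (fun X => hδ V G (by omega) hG X X.injective) (ℓ * b) (by
      rw [← hk, ← hnn]
      calc 2 * (k : ℝ) ^ 2 * ((ℓ * b : ℕ) : ℝ) ≤ 2 * (k : ℝ) ^ 2 * ((ℓ + 1) * (β * n)) := by gcongr
        _ = β * (2 * k ^ 2 * (ℓ + 1)) * n := by ring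
        _ ≤ _ := by gcongr)
  have hcount : ∀ X : α ↪ V, b ≤ (L.filter fun F => IsAbsorber G X F).card := by
    intro X
    by_contra! hlt
    have h1 : (1 / 2 : ℝ) ^ b ≤ (1 / 2 : ℝ) ^ (L.filter fun F => IsAbsorber G X F).card :=
      pow_le_pow_of_le_one (by norm_num) (by norm_num) hlt.le
    have h2 := single_le_sum (f := fun X : α ↪ V =>
      (1 / 2 : ℝ) ^ (L.filter fun F => IsAbsorber G X F).card)
      (fun _ _ => by positivity) (mem_univ X)
    have h3 : (Fintype.card (α ↪ V) : ℝ) ≤ n ^ Fintype.card α := by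
      have : Fintype.card (α ↪ V) ≤ Fintype.card (α → V) :=
        Fintype.card_le_of_injective _ DFunLike.coe_injective
      rw [Fintype.card_fun] at this
      rw [hnn]
      exact_mod_cast this
    have h4 : (1 - δ / 4) ^ (ℓ * b) ≤ (1 / 4 : ℝ) ^ b := by
      rw [pow_mul]
      exact pow_le_pow_left₀ (pow_nonneg (by linarith) _) hℓ.le _
    have h5 : (1 - δ / 4) ^ (ℓ * b) * (Fintype.card (α ↪ V) : ℝ) < (1 / 4 : ℝ) ^ b * 2 ^ b :=
      mul_lt_mul' h4 (h3.trans_lt (hn₂ _ (by omega))) (by positivity) (by positivity)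
    rw [← mul_pow] at h5
    norm_num at h5
    have h6 := h1.trans (h2.trans hLs)
    norm_num at h6
    linarith
  refine ⟨L.biUnion fun F => univ.image (F ∘ j), ?_, fun W hW hdvd hWc => ?_⟩
  · have h1 : (L.biUnion fun F => univ.image (F ∘ j)).card ≤ ℓ * b * k := by
      refine (card_biUnion_le_card_mul _ _ k fun F _ => ?_).trans (by gcongr)
      refine card_image_le.trans ?_
      rw [card_univ]
      exact Fintype.card_le_of_injective j hj
    calc ((L.biUnion fun F => univ.image (F ∘ j)).card : ℝ) ≤ ((ℓ * b : ℕ) : ℝ) * k := by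
          exact_mod_cast h1
      _ ≤ (ℓ + 1) * (β * n) * k := by gcongr
      _ = β * (k * (ℓ + 1)) * n := by ring
      _ ≤ μ * n := by gcongr
  · obtain ⟨t, ht⟩ := hdvd
    refine tileable_biUnion_union (fun X F => IsAbsorber G X F) _ L ?_
      (fun F hF => ?_) (fun F _ X hX => (habs hX).2) t (fun X => le_trans ?_ (hcount X)) W ht hW
    · intro F hF F' hF' hne
      simp only [Function.onFun]
      rw [Finset.disjoint_left]
      intro v hv hv'
      obtain ⟨i, -, rfl⟩ := mem_image.1 hv
      obtain ⟨i', -, h⟩ := mem_image.1 hv'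
      exact hLd F hF F' hF' hne _ _ h.symm
    · obtain ⟨X, hX⟩ := hLX F hF
      exact (habs hX).1
    · refine Nat.le_floor (le_trans ?_ hWc)
      rw [ht]
      exact_mod_cast Nat.le_mul_of_pos_left _ Fintype.card_pos

end Absorb

section Assembly
open scoped Classical

lemma DegCond.induce_compl {V : Type*} [Fintype V] {G : SimpleGraph V} {w s η : ℝ}
    (hG : DegCond G w s η) (hs : 0 ≤ s) (hη : 0 ≤ η) (hws : w + s ≤ 1)
    {M : Finset V} (hM : (M.card : ℝ) ≤ η / 2 * Fintype.card V) :
    DegCond (G.induce {v | v ∉ M}) w s (η / 2) := by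
  intro Z hZ
  obtain ⟨x, hx, hxn⟩ := hG (Z.map (Function.Embedding.subtype _)) (hZ.map)
  obtain ⟨y, hy, rfl⟩ := mem_map.1 hx
  refine ⟨y, hy, ?_⟩
  rw [card_map] at hxn
  have h1 : nonNbr (G.induce {v | v ∉ M}) y ≤ nonNbr G (y : V) := by
    refine card_le_card_of_injOn Subtype.val (fun u hu => ?_) Subtype.val_injective.injOn
    simpa using hu
  have h2 : (Fintype.card ({v | v ∉ M} : Set V) : ℝ) = Fintype.card V - M.card := by
    rw [eq_sub_iff_add_eq]
    norm_cast
    have := Fintype.card_subtype_compl (fun v => v ∈ M)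
    rw [Fintype.card_coe] at this
    have h3 := card_le_univ M
    have h4 : Fintype.card ({v | v ∉ M} : Set V) = Fintype.card {v // v ∉ M} :=
      Fintype.card_congr (Equiv.refl _)
    omega
  have h3 : (nonNbr (G.induce {v | v ∉ M}) y : ℝ) ≤ nonNbr G (y : V) := by exact_mod_cast h1
  have h4 : s * min (Fintype.card ({v | v ∉ M} : Set V) : ℝ) (Z.card / w) ≤
      s * min (Fintype.card V : ℝ) (Z.card / w) := by
    refine mul_le_mul_of_nonneg_left (min_le_min_right _ ?_) hs
    rw [h2]
    linarith [(Nat.cast_nonneg M.card : (0 : ℝ) ≤ _)]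
  have h5 : (w + s - η) * Fintype.card V ≤ (w + s - η / 2) * (Fintype.card V - M.card) := by
    have := (Nat.cast_nonneg M.card : (0 : ℝ) ≤ _)
    nlinarith
  rw [← h2] at h5
  have h6 : (nonNbr G (y : V) : ℝ) + s * min (Fintype.card V : ℝ) (Z.card / w) ≤
    (w + s - η) * Fintype.card V := hxn
  linarith

theorem exists_forall_tileable_univ {α : Type*} [Fintype α] [Nonempty α] {H : SimpleGraph α}
    {d : ℕ} (hH : HcfOne H (d + 2)) (c : H.Coloring (Fin (d + 2))) {σ w s η : ℝ}
    (hσ0 : 0 < σ) (hc : ((univ.filter fun a => c a = 0).card : ℝ) ≤ σ)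
    (hσ : σ < Fintype.card α / (d + 2 : ℕ)) (hs : s = σ / Fintype.card α)
    (hsw : s + (d + 1 : ℕ) * w = 1) (hslt : s < w) (hη : 0 < η) :
    ∃ n₀ : ℕ, ∀ (V : Type u) [Fintype V] (G : SimpleGraph V), n₀ ≤ Fintype.card V →
      Fintype.card α ∣ Fintype.card V → DegCond G w s η → Tileable H G univ := by
  have hα : (0 : ℝ) < Fintype.card α := by exact_mod_cast Fintype.card_pos
  have hs0 : 0 < s := hs ▸ div_pos hσ0 hα
  have hw0 : 0 < w := hs0.trans hslt
  have hws : w + s ≤ 1 := by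
    push_cast at hsw
    nlinarith [(Nat.cast_nonneg d : (0 : ℝ) ≤ d)]
  obtain ⟨β, hβ, n₁, hn₁⟩ := exists_absorbing_set.{u} (μ := min (η / 2) (1 / 2)) hH c hs0 hw0 hη hsw
    (by positivity)
  obtain ⟨n₂, hn₂⟩ := exists_almost_tiling.{u} (Nat.succ_ne_zero d) c hσ0 hc
    (by push_cast at hσ ⊢; convert hσ using 2; ring) hs hsw hslt (half_pos hη) hβ
  refine ⟨n₁ + 2 * n₂, fun V _ G hn hdvd hG => ?_⟩
  obtain ⟨M, hM, hMW⟩ := hn₁ V G (by omega) hG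
  have hM1 : (M.card : ℝ) ≤ η / 2 * Fintype.card V :=
    hM.trans (by gcongr; exact min_le_left _ _)
  have hM2 : (M.card : ℝ) ≤ 1 / 2 * Fintype.card V :=
    hM.trans (by gcongr; exact min_le_right _ _)
  have hcard : Fintype.card ({v | v ∉ M} : Set V) = Fintype.card V - M.card := by
    rw [← Fintype.card_coe M, ← Fintype.card_subtype_compl (fun v => v ∈ M)]
    exact Fintype.card_congr (Equiv.refl _)
  have hMle := card_le_univ M
  obtain ⟨S', hS', hS'c⟩ := hn₂ ({v | v ∉ M} : Set V) (G.induce {v | v ∉ M}) (by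
    rw [hcard]
    have : (2 * M.card : ℝ) ≤ Fintype.card V := by linarith
    have : 2 * M.card ≤ Fintype.card V := by exact_mod_cast this
    omega) (hG.induce_compl hs0.le hη.le hws hM1)
  set S := S'.image (Subtype.val : ({v | v ∉ M} : Set V) → V) with hS
  have hST : Tileable H G S := hS'.map ⟨Subtype.val_injective, fun _ _ h => h⟩
  have hMS : Disjoint M S := by
    rw [Finset.disjoint_left]
    intro v hv hvS
    obtain ⟨u, -, rfl⟩ := mem_image.1 hvS
    exact u.2 hv
  have hMT : Tileable H G M := by simpa using hMW ∅ (by simp) (by simp) (by simp; positivity)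
  have hSc : S.card = S'.card := card_image_of_injective _ Subtype.val_injective
  have hWc : ((M ∪ S)ᶜ).card = Fintype.card V - (M.card + S.card) := by
    rw [card_compl, card_union_of_disjoint hMS]
  have hle : M.card + S.card ≤ Fintype.card V := by
    rw [← card_union_of_disjoint hMS]
    exact card_le_univ _
  have hT := hMW (M ∪ S)ᶜ (disjoint_compl_right.mono_left subset_union_left) (by
    rw [hWc]
    exact Nat.dvd_sub hdvd (dvd_add hMT.dvd_card hST.dvd_card)) (by
    rw [hWc, Nat.cast_sub hle]
    rw [hcard, ← hSc, Nat.cast_sub hMle] at hS'c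
    push_cast
    have := (Nat.cast_nonneg M.card : (0 : ℝ) ≤ _)
    nlinarith)
  have huniv : (univ : Finset V) = (M ∪ (M ∪ S)ᶜ) ∪ S := by
    ext v
    simp only [mem_union, mem_compl, mem_univ, true_iff]
    tauto
  rw [huniv]
  refine hT.union hST ?_
  rw [disjoint_union_left]
  exact ⟨hMS, (disjoint_compl_right.mono_left subset_union_right).symm⟩

end Assembly

section Main
open scoped Classical

lemma nonNbr_add_degN {V : Type*} [Fintype V] (G : SimpleGraph V) (v : V) :
    nonNbr G v + degN G v = Fintype.card V := by
  have : degN G v = (univ.filter fun u => G.Adj v u).card := by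
    unfold degN
    rw [← Set.ncard_coe_finset]
    congr 1
    ext u
    simp
  rw [this, add_comm, nonNbr, card_filter_add_card_filter_not, card_univ]

lemma degCond_of_degree_sequence {V : Type*} [Fintype V] {G : SimpleGraph V} {w s η : ℝ} {n : ℕ}
    (e : Fin n ≃ V) (hmono : ∀ i j : Fin n, i ≤ j → degN G (e i) ≤ degN G (e j))
    (hdeg : ∀ i : Fin n, ((i : ℕ) + 1 : ℝ) ≤ w * n →
      (1 - (w + s)) * n + s / w * ((i : ℕ) + 1) + η * n ≤ (degN G (e i) : ℝ))
    (hs : 0 < s) (hsw : s < w) (hn1 : 1 ≤ w * n) (hn2 : 2 ≤ η * n) :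
    DegCond G w s (η / 2) := by
  have hw : 0 < w := hs.trans hsw
  have hV : Fintype.card V = n := by rw [← Fintype.card_congr e, Fintype.card_fin]
  intro Z hZ
  have hZ1 : 1 ≤ Z.card := hZ.card_pos
  have hZn : Z.card ≤ n := hV ▸ card_le_univ Z
  obtain ⟨x, hx, hxi⟩ : ∃ x ∈ Z, Z.card ≤ (e.symm x : ℕ) + 1 := by
    by_contra! hcon
    have : Z.card ≤ (range (Z.card - 1)).card :=
      card_le_card_of_injOn (fun x => (e.symm x : ℕ)) (fun x hx => by
        have := hcon x hx
        simp only [coe_range, Set.mem_Iio]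
        omega) fun x _ y _ h => e.symm.injective (Fin.ext h)
    rw [card_range] at this
    omega
  refine ⟨x, hx, ?_⟩
  set m := min Z.card ⌊w * n⌋₊ with hm
  have hf1 : 1 ≤ ⌊w * n⌋₊ := Nat.le_floor (by simpa using hn1)
  have hf : (⌊w * n⌋₊ : ℝ) ≤ w * n := Nat.floor_le (by linarith)
  have hm1 : 1 ≤ m := le_min hZ1 hf1
  have hmZ : m ≤ Z.card := min_le_left _ _
  have hmw : (m : ℝ) ≤ w * n := le_trans (by exact_mod_cast min_le_right _ _) hf
  have hmcast : (((m - 1 : ℕ) : ℝ) + 1) = m := by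
    rw [Nat.cast_sub hm1]; simp
  have h1 := hdeg ⟨m - 1, by omega⟩ (by simpa only [hmcast] using hmw)
  have h2 := hmono ⟨m - 1, by omega⟩ (e.symm x) (by
    rw [Fin.le_def]
    simp only
    omega)
  rw [Equiv.apply_symm_apply] at h2
  simp only [hmcast] at h1
  have h3 : (nonNbr G x : ℝ) + degN G x = n := by
    rw [← hV]; exact_mod_cast nonNbr_add_degN G x
  have h4 : ((degN G (e ⟨m - 1, by omega⟩) : ℕ) : ℝ) ≤ degN G x := by exact_mod_cast h2
  have h5 : min (n : ℝ) (Z.card / w) ≤ (m + 1) / w := by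
    rw [le_div_iff₀ hw]
    rcases min_choice Z.card ⌊w * n⌋₊ with h | h
    · have := min_le_right (n : ℝ) (Z.card / w)
      rw [le_div_iff₀ hw] at this
      rw [hm, h]
      linarith
    · have := min_le_left (n : ℝ) (Z.card / w)
      have h6 := Nat.lt_floor_add_one (w * n)
      rw [hm, h]
      nlinarith
  have h6 : s * ((m + 1) / w) ≤ s / w * m + 1 := by
    have : s / w ≤ 1 := (div_le_one hw).2 hsw.le
    calc s * ((m + 1) / w) = s / w * m + s / w := by ring
      _ ≤ _ := by gcongr
  have h7 := mul_le_mul_of_nonneg_left h5 hs.le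
  rw [hV]
  nlinarith

lemma exists_coloring_card_eq_minClassSize {α : Type*} [Fintype α] {H : SimpleGraph α} {r : ℕ}
    (hr : 0 < r) (hchi : H.chromaticNumber = (r : ℕ∞)) :
    0 < minClassSize H r ∧ ∀ z : Fin r, ∃ c : H.Coloring (Fin r),
      (univ.filter fun a => c a = z).card = minClassSize H r := by
  obtain ⟨c₀⟩ : H.Colorable r := chromaticNumber_le_iff_colorable.1 hchi.le
  have hmem : minClassSize H r ∈ {s : ℕ | ∃ (c : H.Coloring (Fin r)) (i : Fin r),
      s = {v | c v = i}.ncard} := Nat.sInf_mem ⟨_, c₀, ⟨0, hr⟩, rfl⟩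
  obtain ⟨c, i, hci⟩ := hmem
  refine ⟨?_, fun z => ⟨Coloring.mk (fun v => Equiv.swap i z (c v)) fun {u v} h h' =>
    c.valid h ((Equiv.swap i z).injective h'), ?_⟩⟩
  · obtain ⟨v, hv⟩ := le_chromaticNumber_iff_forall_surjective.1 hchi.ge c i
    rw [hci]
    exact (Set.ncard_pos).2 ⟨v, hv⟩
  · rw [hci, ← Set.ncard_coe_finset]
    congr 1
    ext v
    simp only [coe_filter, mem_univ, true_and, Set.mem_ofPred_eq]
    change Equiv.swap i z (c v) = z ↔ _
    rw [← Equiv.eq_symm_apply, Equiv.symm_swap, Equiv.swap_apply_right]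

end Main

end KuhnOsthus

/-- Theorem 1.8: generalisation of Theorem 1.6 allowing any real
`σ` with `σ(H) ≤ σ < h/r`. -/
theorem kuhnOsthus_degreeSequence_sigma
    {α : Type*} [Fintype α] (H : SimpleGraph α) (r : ℕ)
    (hr : 2 ≤ r) (hchi : H.chromaticNumber = (r : ℕ∞)) (hhcf : HcfOne H r)
    (σ ω h : ℝ) (hh : h = (Fintype.card α : ℝ))
    (hσ₁ : (minClassSize H r : ℝ) ≤ σ) (hσ₂ : σ < h / r)
    (hω : ω = (h - σ) / ((r : ℝ) - 1))
    (η : ℝ) (hη : 0 < η) :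
    ∃ n₁ : ℕ, ∀ (β : Type) [Fintype β] (G : SimpleGraph β) (n : ℕ),
      Fintype.card β = n → n₁ ≤ n → Fintype.card α ∣ n →
      (∃ e : Fin n ≃ β,
        (∀ i j : Fin n, i ≤ j → degN G (e i) ≤ degN G (e j)) ∧
        (∀ i : Fin n, ((i : ℕ) + 1 : ℝ) ≤ ω * n / h →
          (1 - (ω + σ) / h) * n + (σ / ω) * ((i : ℕ) + 1) + η * n ≤ (degN G (e i) : ℝ))) →
      HasPerfectTiling H G := by
  obtain ⟨d, rfl⟩ : ∃ d, r = d + 2 := ⟨r - 2, by omega⟩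
  obtain ⟨hpos, hcol⟩ := KuhnOsthus.exists_coloring_card_eq_minClassSize (by omega) hchi
  obtain ⟨c, hc⟩ := hcol 0
  have hσ0 : 0 < σ := lt_of_lt_of_le (by exact_mod_cast hpos) hσ₁
  have hr0 : (0 : ℝ) < (d + 2 : ℕ) := by positivity
  have hd0 : (0 : ℝ) < d + 1 := by positivity
  have hh0 : 0 < h := by
    by_contra! hneg
    exact absurd (hσ0.trans hσ₂) (div_nonpos_of_nonpos_of_nonneg hneg hr0.le).not_gt
  have : Nonempty α := Fintype.card_pos_iff.1 (by rw [hh] at hh0; exact_mod_cast hh0)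
  have hω' : ω * (d + 1) = h - σ := by
    rw [hω, show ((d + 2 : ℕ) : ℝ) - 1 = d + 1 by push_cast; ring, div_mul_cancel₀ _ hd0.ne']
  have hσω : σ < ω := by
    rw [lt_div_iff₀ hr0] at hσ₂
    push_cast at hσ₂
    nlinarith
  have hω0 : 0 < ω := hσ0.trans hσω
  have hslt : σ / h < ω / h := by gcongr
  obtain ⟨n₀, hn₀⟩ := KuhnOsthus.exists_forall_tileable_univ.{0} hhcf c (σ := σ) (w := ω / h)
      (s := σ / h)
    (η := η / 2) hσ0 (by rw [hc]; exact hσ₁) (by rw [← hh]; exact hσ₂) (by rw [hh])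
    (by push_cast; field_simp; linarith) hslt (half_pos hη)
  obtain ⟨n₂, hn₂⟩ := exists_nat_ge (h / ω + 2 / η)
  refine ⟨n₀ + n₂, fun β _ G n hβ hn hdvd ⟨e, hmono, hdeg⟩ => ?_⟩
  have hnn : h / ω + 2 / η ≤ n := hn₂.trans (by exact_mod_cast (by omega))
  have h1 : 0 < h / ω := by positivity
  have h2 : 0 < 2 / η := by positivity
  have hG : KuhnOsthus.DegCond G (ω / h) (σ / h) (η / 2) := by
    refine KuhnOsthus.degCond_of_degree_sequence e hmono (fun i hi => ?_) (by positivity) hslt ?_ ?_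
    · have := hdeg i (by rwa [mul_div_right_comm])
      rwa [div_div_div_cancel_right₀ hh0.ne', ← add_div]
    · have : h / ω ≤ n := by linarith
      rw [div_le_iff₀ hω0] at this
      rw [div_mul_eq_mul_div, le_div_iff₀ hh0]
      linarith
    · have : 2 / η ≤ n := by linarith
      rw [div_le_iff₀ hη] at this
      linarith
  obtain ⟨T, hT, hcov⟩ :=
    (hn₀ β G (by omega) (by rwa [hβ]) hG).hasPerfectTiling
  exact ⟨T, hT, fun v => (hcov v).1 (Finset.mem_univ v)⟩
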